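/- arXiv:math/0408371 — 4 statements merged into one kernel-verified Lean document; each statement's English description precedes it below -/
import Mathlib

section
/- Let a, b, c be positive integers with a and b odd and gcd(a,b) = 1. If −a^8 + 2a^4b^2 + b^4 = 2c^2, then (a,b) = (1,1) or (a,b) = (1,3). -/
open WithZero in
/-- The arithmetic input used about the quartic field `ℚ(θ)` with `θ ^ 4 + 2 * θ ^ 2 = 1`: the
totally ramified valuation above `2`, two real embeddings, and the finiteness statements that follow
from unique factorization and the unit theorem. -/
structure QuarticData (K : Type*) [Field K] where
  /-- The generator of the field. -/
  θ : K
  θ_eq : θ ^ 4 + 2 * θ ^ 2 = 1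
  /-- The valuation above `2`. -/
  v : Valuation K (WithZero (Multiplicative ℤ))
  v_uniformizer : v (1 - θ) = exp (-1)
  v_sub_one : ∀ x, v x = 1 → v (x - 1) < 1
  /-- The real embedding that is positive at the generator. -/
  σ₁ : K →+* ℝ
  /-- The real embedding that is negative at the generator. -/
  σ₂ : K →+* ℝ
  σ₁_pos : 0 < σ₁ θ
  σ₂_neg : σ₂ θ < 0
  selmer : ∀ (A ε x y : K) (i j k : ℕ), IsIntegral ℤ A → ε = 1 ∨ ε = -1 → x ≠ 0 →
    x * (x ^ 2 + A * x + ε * θ⁻¹ ^ i * (2 + 3 * θ + θ ^ 2 + θ ^ 3) ^ j * (1 - θ) ^ k) = y ^ 2 →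
    ∃ i < 2, ∃ j < 2, ∃ k < 2, ∃ l < 2, ∃ r : K,
      x = (-1) ^ i * θ ^ j * (2 + 3 * θ + θ ^ 2 + θ ^ 3) ^ k * (1 - θ) ^ l * r ^ 2
  factor : ∀ (a b c : ℤ) (e : K), e = 1 ∨ e = -1 → IsCoprime a b → c ≠ 0 →
    -a ^ 8 + 2 * a ^ 4 * b ^ 2 + b ^ 4 = 2 * c ^ 2 →
    ∃ i < 2, ∃ j < 2, ∃ k < 2, ∃ l < 2, ∃ r : K,
      b - e * θ * a ^ 2 =
        (-1) ^ i * θ ^ j * (2 + 3 * θ + θ ^ 2 + θ ^ 3) ^ k * (1 - θ) ^ l * r ^ 2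

namespace QuarticData

open WithZero

variable {K : Type*} [Field K] (D : QuarticData K)

/-- `D.Ord n x`: the valuation of `x` is exactly `n`. -/
def Ord (n : ℤ) (x : K) : Prop := D.v x = exp (-n)

/-- `D.Ge n x`: the valuation of `x` is at least `n`. -/
def Ge (n : ℤ) (x : K) : Prop := D.v x ≤ exp (-n)

variable {D} {m n : ℤ} {x y z : K}

theorem Ord.ge (h : D.Ord n x) : D.Ge n x := le_of_eq h

theorem Ord.ne_zero (h : D.Ord n x) : x ≠ 0 := by
  rintro rfl
  simp only [Ord, map_zero] at h
  exact exp_ne_zero h.symm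

theorem Ord.unique (h : D.Ord n x) (h' : D.Ord m x) : n = m := by
  have := h.symm.trans h'
  rw [exp_inj] at this
  omega

theorem exists_ord (D : QuarticData K) (hx : x ≠ 0) : ∃ n, D.Ord n x :=
  ⟨-log (D.v x), by rw [Ord, neg_neg, exp_log ((Valuation.ne_zero_iff _).2 hx)]⟩

theorem Ge.mono (h : D.Ge n x) (hm : m ≤ n) : D.Ge m x :=
  h.trans (exp_le_exp.2 (by omega))

theorem ge_zero (D : QuarticData K) (n : ℤ) : D.Ge n 0 := by simp [Ge]

theorem Ord.le_of_ge (h : D.Ord n x) (h' : D.Ge m x) : m ≤ n := by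
  rw [Ge, h, exp_le_exp] at h'
  omega

theorem Ge.add (h : D.Ge n x) (h' : D.Ge n y) : D.Ge n (x + y) :=
  (D.v.map_add x y).trans (max_le h h')

theorem Ge.neg (h : D.Ge n x) : D.Ge n (-x) := by rwa [Ge, Valuation.map_neg]

theorem Ge.sub (h : D.Ge n x) (h' : D.Ge n y) : D.Ge n (x - y) := by
  rw [sub_eq_add_neg]; exact h.add h'.neg

theorem Ge.mul (h : D.Ge n x) (h' : D.Ge m y) : D.Ge (n + m) (x * y) := by
  rw [Ge, map_mul, neg_add, WithZero.exp_add]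
  exact mul_le_mul' h h'

theorem Ord.neg (h : D.Ord n x) : D.Ord n (-x) := by rwa [Ord, Valuation.map_neg]

theorem Ord.mul (h : D.Ord n x) (h' : D.Ord m y) : D.Ord (n + m) (x * y) := by
  rw [Ord, map_mul, neg_add, WithZero.exp_add, h, h']

theorem Ord.inv (h : D.Ord n x) : D.Ord (-n) x⁻¹ := by
  rw [Ord, map_inv₀, h, ← WithZero.exp_neg]

theorem Ord.div (h : D.Ord n x) (h' : D.Ord m y) : D.Ord (n - m) (x / y) := by
  rw [div_eq_mul_inv, sub_eq_add_neg]; exact h.mul h'.inv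

theorem Ord.pow (h : D.Ord n x) (k : ℕ) : D.Ord (k * n) (x ^ k) := by
  induction k with
  | zero => simp [Ord]
  | succ k ih =>
    rw [pow_succ]
    convert ih.mul h using 1
    push_cast; ring

theorem Ord.add_ge (h : D.Ord n x) (h' : D.Ge m y) (hm : n < m) : D.Ord n (x + y) := by
  rw [Ord, Valuation.map_add_eq_of_lt_left, h]
  rw [h]
  exact lt_of_le_of_lt h' (exp_lt_exp.2 (by omega))

theorem lt_exp_iff (D : QuarticData K) : D.v x < exp (-n) ↔ D.Ge (n + 1) x := by
  by_cases hx : x = 0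
  · simp [hx, Ge, zero_lt_iff]
  · obtain ⟨k, hk⟩ := D.exists_ord hx
    rw [Ge, hk, exp_lt_exp, exp_le_exp]
    omega

theorem Ord.sub_ord (h : D.Ord n x) (h' : D.Ord n y) : D.Ge (n + 1) (x - y) := by
  have h0 := h'.ne_zero
  have h1 : D.Ord 0 (x / y) := by simpa using h.div h'
  have h2 : D.Ge 1 (x / y - 1) := by
    have := D.v_sub_one (x / y) (by simpa [Ord] using h1)
    simpa using (D.lt_exp_iff (n := 0)).1 (by simpa using this)
  have := h'.ge.mul h2
  rwa [mul_sub, mul_div_cancel₀ _ h0, mul_one] at this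

theorem Ord.add_ord (h : D.Ord n x) (h' : D.Ord n y) : D.Ge (n + 1) (x + y) := by
  simpa using h.sub_ord h'.neg

theorem Ge.pow (h : D.Ge n x) (k : ℕ) : D.Ge (k * n) (x ^ k) := by
  induction k with
  | zero => simp [Ge]
  | succ k ih =>
    rw [pow_succ]
    refine (ih.mul h).mono ?_
    push_cast; linarith

/-- If two elements of the same product differ by an element of valuation `k`, and the product has
odd valuation, then this valuation exceeds `2 * k`. -/
theorem Ord.lt_of_odd (hz : D.Ord n (x * y)) (hd : D.Ord m (x - y)) (hn : Odd n) :
    2 * m < n := by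
  have h0 := hz.ne_zero
  obtain ⟨i, hi⟩ := D.exists_ord (left_ne_zero_of_mul h0)
  obtain ⟨j, hj⟩ := D.exists_ord (right_ne_zero_of_mul h0)
  have hij := hz.unique (hi.mul hj)
  obtain ⟨k, hk⟩ := hn
  rcases lt_trichotomy i j with h | h | h
  · have := hd.unique (sub_eq_add_neg x y ▸ hi.add_ge hj.neg.ge h)
    omega
  · omega
  · have := hd.unique (by
      rw [sub_eq_add_neg, add_comm]
      exact hj.neg.add_ge hi.ge h)
    omega

theorem θ_ne_zero (D : QuarticData K) : D.θ ≠ 0 := by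
  intro h
  have := D.σ₁_pos
  simp [h] at this

theorem ord_pi (D : QuarticData K) : D.Ord 1 (1 - D.θ) := D.v_uniformizer

theorem ord_one (D : QuarticData K) : D.Ord 0 1 := by simp [Ord]

theorem ge_int (D : QuarticData K) (a : ℤ) : D.Ge 0 (a : K) := by
  induction a using Int.induction_on with
  | zero => simpa using D.ge_zero 0
  | succ i ih => rw [Int.cast_add, Int.cast_one]; exact ih.add D.ord_one.ge
  | pred i ih => rw [Int.cast_sub, Int.cast_one]; exact ih.sub D.ord_one.ge

theorem ord_θ (D : QuarticData K) : D.Ord 0 D.θ := by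
  have := D.ord_one.add_ge D.ord_pi.neg.ge (by norm_num)
  convert this using 1
  ring

theorem ge_poly (D : QuarticData K) (a b c d : ℤ) :
    D.Ge 0 (a + b * D.θ + c * D.θ ^ 2 + d * D.θ ^ 3) := by
  have h := D.ord_θ.ge
  refine (((D.ge_int a).add ?_).add ?_).add ?_
  · simpa using (D.ge_int b).mul h
  · simpa using (D.ge_int c).mul (h.pow 2)
  · simpa using (D.ge_int d).mul (h.pow 3)

theorem ord_of_eq (D : QuarticData K) (k : ℕ) (a b c d : ℤ)
    (h : x = (1 - D.θ) ^ k * (1 + (1 - D.θ) * (a + b * D.θ + c * D.θ ^ 2 + d * D.θ ^ 3))) :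
    D.Ord k x := by
  have h1 := D.ord_one.add_ge (D.ord_pi.ge.mul (D.ge_poly a b c d)) (by norm_num)
  have := (D.ord_pi.pow k).mul h1
  rw [h]
  simpa using this

end QuarticData

namespace QuarticData

variable {K : Type*} [Field K] {D : QuarticData K} {m n : ℤ} {x y w s e : K}

theorem ord_two (D : QuarticData K) : D.Ord 4 2 :=
  D.ord_of_eq 4 147 229 61 95 <| by
    push_cast
    linear_combination (146 - 510 * D.θ + 684 * D.θ ^ 2 - 414 * D.θ ^ 3 + 95 * D.θ ^ 4) * D.θ_eq

theorem ord_one_add (D : QuarticData K) : D.Ord 1 (1 + D.θ) :=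
  D.ord_of_eq 1 4 7 2 3 <| by push_cast; linear_combination (4 - 3 * D.θ) * D.θ_eq

theorem ord_sqrt_two (D : QuarticData K) : D.Ord 2 (1 + D.θ ^ 2) :=
  D.ord_of_eq 2 12 19 5 8 <| by
    push_cast; linear_combination (12 - 19 * D.θ + 8 * D.θ ^ 2) * D.θ_eq

/-- The unit `(1 + θ) / (1 - θ)`. -/
def η (D : QuarticData K) : K := 2 + 3 * D.θ + D.θ ^ 2 + D.θ ^ 3

theorem one_sub_mul_η (D : QuarticData K) : (1 - D.θ) * D.η = 1 + D.θ := by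
  rw [η]; linear_combination -D.θ_eq

theorem ord_η (D : QuarticData K) : D.Ord 0 D.η :=
  D.ord_of_eq 0 4 7 2 3 <| by rw [η]; push_cast; linear_combination 3 * D.θ_eq

theorem ord_η_sub_one (D : QuarticData K) : D.Ord 3 (D.η - 1) :=
  D.ord_of_eq 3 94 147 39 61 <| by
    rw [η]; push_cast
    linear_combination (94 - 235 * D.θ + 205 * D.θ ^ 2 - 61 * D.θ ^ 3) * D.θ_eq

theorem ord_four (D : QuarticData K) : D.Ord 8 4 := by
  have := D.ord_two.mul D.ord_two
  norm_num at this
  exact this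

/-- The coefficient of `x ^ 2` in the elliptic curves `y ^ 2 = x ^ 3 + A * x ^ 2 + B * x`. -/
def A (D : QuarticData K) (e : K) : K := 2 * e * D.θ * (1 + D.θ)

/-- The coefficient of `x` in the elliptic curves `y ^ 2 = x ^ 3 + A * x ^ 2 + B * x`. -/
def B (D : QuarticData K) : K := 2 * (1 + D.θ ^ 2) * (1 + D.θ) ^ 2

/-- A square root of `4 * B - A ^ 2`. -/
def κ (D : QuarticData K) : K := 2 * (1 + D.θ) * D.θ⁻¹

theorem ord_A (D : QuarticData K) (he : e = 1 ∨ e = -1) : D.Ord 5 (D.A e) := by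
  have h : D.Ord 0 e := by
    rcases he with rfl | rfl
    exacts [D.ord_one, D.ord_one.neg]
  rw [A]
  simpa using ((D.ord_two.mul h).mul D.ord_θ).mul D.ord_one_add

theorem ord_B (D : QuarticData K) : D.Ord 8 D.B := by
  rw [B]
  simpa using (D.ord_two.mul D.ord_sqrt_two).mul (D.ord_one_add.pow 2)

theorem ord_κ (D : QuarticData K) : D.Ord 5 D.κ := by
  rw [κ]
  simpa using (D.ord_two.mul D.ord_one_add).mul D.ord_θ.inv

theorem inv_θ (D : QuarticData K) : D.θ⁻¹ = D.θ ^ 3 + 2 * D.θ := by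
  rw [inv_eq_iff_eq_inv]
  refine eq_inv_of_mul_eq_one_left ?_
  linear_combination D.θ_eq

theorem sqrt_two_eq (D : QuarticData K) : 1 + D.θ ^ 2 = (1 - D.θ) ^ 2 * D.η * D.θ⁻¹ ^ 2 := by
  rw [inv_θ, η]
  linear_combination (-1 + 5 * D.θ ^ 2 - 4 * D.θ ^ 3 + 5 * D.θ ^ 4 - 4 * D.θ ^ 5 + D.θ ^ 6 -
    D.θ ^ 7) * D.θ_eq

theorem two_eq (D : QuarticData K) : (2 : K) = (1 + D.θ ^ 2) ^ 2 := by
  linear_combination -D.θ_eq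

theorem two_eq' (D : QuarticData K) : (2 : K) = (1 - D.θ) ^ 4 * D.η ^ 2 * D.θ⁻¹ ^ 4 := by
  rw [two_eq, sqrt_two_eq]; ring

theorem B_eq (D : QuarticData K) : D.B = D.θ⁻¹ ^ 6 * D.η ^ 5 * (1 - D.θ) ^ 8 := by
  rw [B, sqrt_two_eq, two_eq', ← one_sub_mul_η]; ring

theorem κ_sq (D : QuarticData K) : D.κ ^ 2 = D.θ⁻¹ ^ 10 * D.η ^ 6 * (1 - D.θ) ^ 10 := by
  rw [κ, two_eq', ← one_sub_mul_η]; ring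

theorem κ_sq_eq (D : QuarticData K) (he : e = 1 ∨ e = -1) :
    D.κ ^ 2 = 4 * D.B - D.A e ^ 2 := by
  have h : e ^ 2 = 1 := by rcases he with rfl | rfl <;> norm_num
  rw [κ, B, A, inv_θ]
  linear_combination (4 * (1 + D.θ) ^ 2 * (D.θ ^ 2 + 2)) * D.θ_eq + 4 * D.θ ^ 2 * (1 + D.θ) ^ 2 * h

theorem isIntegral_θ (D : QuarticData K) : IsIntegral ℤ D.θ := by
  refine ⟨Polynomial.X ^ 4 + 2 * Polynomial.X ^ 2 - 1, ?_, ?_⟩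
  · monicity!
  · simp [D.θ_eq]

theorem isIntegral_two : IsIntegral ℤ (2 : K) := by
  simpa using isIntegral_algebraMap (R := ℤ) (A := K) (x := 2)

theorem isIntegral_A (D : QuarticData K) (he : e = 1 ∨ e = -1) : IsIntegral ℤ (D.A e) := by
  have h : IsIntegral ℤ e := by
    rcases he with rfl | rfl
    exacts [isIntegral_one, isIntegral_one.neg]
  exact ((isIntegral_two.mul h).mul D.isIntegral_θ).mul (isIntegral_one.add D.isIntegral_θ)

theorem abs_lt_one {t : ℝ} (h : t ^ 4 + 2 * t ^ 2 = 1) : -1 < t ∧ t < 1 := by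
  constructor <;> nlinarith [sq_nonneg (t ^ 2), sq_nonneg t, sq_nonneg (t - 1), sq_nonneg (t + 1)]

theorem map_θ (D : QuarticData K) (σ : K →+* ℝ) : σ D.θ ^ 4 + 2 * σ D.θ ^ 2 = 1 := by
  simpa only [map_add, map_mul, map_pow, map_one, map_ofNat] using congrArg σ D.θ_eq

theorem map_uniformizer_pos (D : QuarticData K) (σ : K →+* ℝ) : 0 < σ (1 - D.θ) := by
  have := abs_lt_one (D.map_θ σ)
  simp only [map_sub, map_one]
  linarith

theorem map_η_pos (D : QuarticData K) (σ : K →+* ℝ) : 0 < σ D.η := by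
  have h1 := D.map_uniformizer_pos σ
  have h2 := congrArg σ D.one_sub_mul_η
  have := abs_lt_one (D.map_θ σ)
  simp only [map_mul, map_add, map_one] at h2
  nlinarith

/-- The squares, up to the units and powers of the uniformizer that generate the relevant part of
`Kˣ / Kˣ ^ 2`. -/
def IsSelmer (D : QuarticData K) (x : K) : Prop :=
  ∃ i < 2, ∃ j < 2, ∃ k < 2, ∃ l < 2, ∃ r : K,
    x = (-1) ^ i * D.θ ^ j * D.η ^ k * (1 - D.θ) ^ l * r ^ 2

theorem IsSelmer.of_pos (h : D.IsSelmer x) (h₁ : 0 < D.σ₁ x) (h₂ : 0 < D.σ₂ x) :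
    ∃ k < 2, ∃ l < 2, ∃ r : K, x = D.η ^ k * (1 - D.θ) ^ l * r ^ 2 := by
  obtain ⟨i, hi, j, hj, k, hk, l, hl, r, rfl⟩ := h
  refine ⟨k, hk, l, hl, r, ?_⟩
  have hp (σ : K →+* ℝ) : 0 ≤ σ (D.η ^ k * (1 - D.θ) ^ l * r ^ 2) := by
    simp only [map_mul, map_pow]
    have := D.map_η_pos σ
    have := D.map_uniformizer_pos σ
    positivity
  have e1 (σ : K →+* ℝ) : σ ((-1) ^ i * D.θ ^ j * D.η ^ k * (1 - D.θ) ^ l * r ^ 2) =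
      (-1) ^ i * σ D.θ ^ j * σ (D.η ^ k * (1 - D.θ) ^ l * r ^ 2) := by
    simp only [map_mul, map_pow, map_neg, map_one]; ring
  rw [e1] at h₁ h₂
  have p1 := hp D.σ₁
  have p2 := hp D.σ₂
  generalize D.σ₁ (D.η ^ k * (1 - D.θ) ^ l * r ^ 2) = z₁ at *
  generalize D.σ₂ (D.η ^ k * (1 - D.θ) ^ l * r ^ 2) = z₂ at *
  have t1 := D.σ₁_pos
  have t2 := D.σ₂_neg
  interval_cases i <;> interval_cases j <;> simp at h₁ h₂ ⊢
  · nlinarith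
  · nlinarith
  · nlinarith

/-- The points of the elliptic curve have `x`-coordinates in the two classes `1` and `η`. -/
theorem eq_sq_or_eq_η_mul_sq (he : e = 1 ∨ e = -1) (hx : x ≠ 0)
    (h : x * (x ^ 2 + D.A e * x + D.B) = y ^ 2) : ∃ r, x = r ^ 2 ∨ x = D.η * r ^ 2 := by
  have hs : D.IsSelmer x := by
    refine D.selmer (D.A e) 1 x y 6 5 8 (D.isIntegral_A he) (Or.inl rfl) hx ?_
    rw [← h, B_eq, η]; ring
  have hq (σ : K →+* ℝ) : 0 < σ (x ^ 2 + D.A e * x + D.B) := by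
    have h2 : 0 < σ D.κ ^ 2 := by
      have : σ D.κ ≠ 0 := by simpa using D.ord_κ.ne_zero
      positivity
    rw [← map_pow, κ_sq_eq D he] at h2
    simp only [map_add, map_mul, map_pow, map_sub, map_ofNat] at h2 ⊢
    nlinarith [sq_nonneg (2 * σ x + σ (D.A e))]
  have hpos (σ : K →+* ℝ) : 0 < σ x := by
    have h3 : 0 ≤ σ x * σ (x ^ 2 + D.A e * x + D.B) := by
      rw [← map_mul, h, map_pow]; positivity
    have h4 : σ x ≠ 0 := by simpa using hx
    exact lt_of_le_of_ne (nonneg_of_mul_nonneg_left h3 (hq σ)) h4.symm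
  have hq0 : x ^ 2 + D.A e * x + D.B ≠ 0 := by
    intro h0
    simpa [h0] using hq D.σ₁
  obtain ⟨k, hk, l, hl, r, hxr⟩ := hs.of_pos (hpos _) (hpos _)
  have hr : r ≠ 0 := by
    rintro rfl
    simp [hx] at hxr
  obtain ⟨a, ha⟩ := D.exists_ord hr
  have hxa : D.Ord (l + 2 * a) x := by
    rw [hxr]
    simpa using ((D.ord_η.pow k).mul (D.ord_pi.pow l)).mul (ha.pow 2)
  obtain ⟨b, hb⟩ := D.exists_ord (x := y) (by
    rintro rfl
    simp [hx, hq0] at h)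
  have hyb := hb.pow 2
  rw [← h] at hyb
  have hA := D.ord_A he
  obtain rfl : l = 0 := by
    by_contra hl0
    obtain rfl : l = 1 := by omega
    rcases le_or_gt a 1 with h1 | h1
    · have := hyb.unique (hxa.mul (((hxa.pow 2).add_ge (hA.mul hxa).ge (by push_cast; omega)).add_ge
        D.ord_B.ge (by push_cast; omega)))
      push_cast at this; omega
    · have h5 : D.Ge 9 (x ^ 2 + D.A e * x) :=
        ((hxa.pow 2).ge.mono (by push_cast; omega)).add
          ((hA.mul hxa).ge.mono (by push_cast; omega))
      have := hyb.unique (hxa.mul (add_comm D.B _ ▸ D.ord_B.add_ge h5 (by norm_num)))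
      push_cast at this; omega
  refine ⟨r, ?_⟩
  interval_cases k
  · exact Or.inl (by simpa using hxr)
  · exact Or.inr (by simpa using hxr)

end QuarticData

namespace QuarticData

variable {K : Type*} [Field K] {D : QuarticData K} {m n : ℤ} {x y w s e r : K}

theorem Ord.sq_sub_one (h : D.Ord 0 x) : D.Ge 2 (x ^ 2 - 1) := by
  have := (h.sub_ord D.ord_one).mul (h.add_ord D.ord_one)
  norm_num at this
  convert this using 1
  ring

theorem Ord.ne_zero_of_quartic (hw : D.Ord 0 w) (he : e = 1 ∨ e = -1)
    (h : s ^ 2 = w ^ 4 + D.A e * w ^ 2 + D.B) : False := by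
  have h1 : D.Ord 5 ((s + w ^ 2) * (s - w ^ 2)) := by
    have : D.Ord 5 (D.A e * w ^ 2 + D.B) :=
      (by simpa using (D.ord_A he).mul (hw.pow 2) : D.Ord 5 (D.A e * w ^ 2)).add_ge
        D.ord_B.ge (by norm_num)
    convert this using 1
    linear_combination h
  have h2 : D.Ord 4 ((s + w ^ 2) - (s - w ^ 2)) := by
    have : D.Ord 4 (2 * w ^ 2) := by simpa using D.ord_two.mul (hw.pow 2)
    convert this using 1
    ring
  have := h1.lt_of_odd h2 (by decide)
  omega

theorem sq_ord_even (hn : D.Ord n (x ^ 2)) : Even n := by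
  obtain ⟨k, hk⟩ := D.exists_ord (x := x) (by
    rintro rfl
    simpa using hn.ne_zero)
  have := hn.unique (hk.pow 2)
  exact ⟨k, by push_cast at this; omega⟩

theorem Ord.ne_two_of_quartic (hw : D.Ord 2 w) (he : e = 1 ∨ e = -1)
    (h : s ^ 2 = w ^ 4 + D.A e * w ^ 2 + D.B) : False := by
  obtain ⟨z, rfl⟩ : ∃ z, w = (1 + D.θ ^ 2) * z :=
    ⟨w / (1 + D.θ ^ 2), by rw [mul_div_cancel₀ _ D.ord_sqrt_two.ne_zero]⟩
  have hz : D.Ord 0 z := by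
    have := hw.div D.ord_sqrt_two
    rwa [mul_div_cancel_left₀ _ D.ord_sqrt_two.ne_zero] at this
  have h1 : D.Ge 10 (4 * (z ^ 4 - 1)) := by
    have := D.ord_four.ge.mul (hz.pow 2).sq_sub_one
    convert this using 1 <;> ring
  have h2 : D.Ord 10 (4 + D.B) := by
    have h3 : D.Ord 2 (2 + (1 + D.θ ^ 2) * D.θ) :=
      D.ord_of_eq 2 26 41 11 17 <| by
        push_cast; linear_combination (25 - 40 * D.θ + 17 * D.θ ^ 2) * D.θ_eq
    have h4 : D.Ord 10 (4 * (2 + (1 + D.θ ^ 2) * D.θ)) := D.ord_four.mul h3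
    convert h4 using 1
    rw [B]
    linear_combination 2 * D.θ_eq
  have h4 : D.Ord 9 (D.A e * ((1 + D.θ ^ 2) * z) ^ 2) := by
    simpa using (D.ord_A he).mul (hw.pow 2)
  have h5 : D.Ord 9 (s ^ 2) := by
    convert h4.add_ge (h1.add h2.ge) (by norm_num) using 1
    rw [h]
    linear_combination z ^ 4 * (D.θ ^ 4 + 2 * D.θ ^ 2 + 3) * D.θ_eq
  exact absurd (sq_ord_even h5) (by decide)

theorem Ord.lt_four_of_quartic (hw : D.Ord n w) (he : e = 1 ∨ e = -1)
    (h : s ^ 2 = w ^ 4 + D.A e * w ^ 2 + D.B) : n < 4 := by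
  by_contra! hn
  obtain ⟨E, hE, hs⟩ : ∃ E, D.Ge 13 E ∧ s ^ 2 = D.B + E :=
    ⟨w ^ 4 + D.A e * w ^ 2, ((hw.pow 4).ge.mono (by push_cast; omega)).add
      (((D.ord_A he).mul (hw.pow 2)).ge.mono (by push_cast; omega)), by rw [h]; ring⟩
  have hB : D.B = 4 * (1 + (1 + D.θ ^ 2) * D.θ) := by
    rw [B]; linear_combination 2 * D.θ_eq
  have h1 : D.Ord 10 ((s + 2) * (s - 2)) := by
    have : D.Ord 10 (4 * (1 + D.θ ^ 2) * D.θ) := by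
      simpa using (D.ord_four.mul D.ord_sqrt_two).mul D.ord_θ
    convert this.add_ge hE (by norm_num) using 1
    linear_combination hs + hB
  obtain ⟨i, hi⟩ := D.exists_ord (right_ne_zero_of_mul h1.ne_zero)
  obtain ⟨j, hj⟩ := D.exists_ord (left_ne_zero_of_mul h1.ne_zero)
  have hij := h1.unique (hj.mul hi)
  obtain rfl : i = 5 := by
    have h4 : D.Ord 8 ((s + 2) - (s - 2)) := by
      convert D.ord_four using 1
      ring
    rcases lt_trichotomy i j with hlt | rfl | hlt
    · have := h4.unique (by
        rw [sub_eq_add_neg, add_comm]; exact hi.neg.add_ge hj.ge hlt)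
      omega
    · omega
    · have := h4.unique (by rw [sub_eq_add_neg]; exact hj.add_ge hi.neg.ge hlt)
      omega
  have h20 := D.ord_two.ne_zero
  obtain ⟨δ, hδ⟩ : ∃ δ, s = 2 + 2 * δ := ⟨(s - 2) / 2, by field_simp; ring⟩
  have hδ1 : D.Ord 1 δ := by
    have : D.Ord 1 ((s - 2) / 2) := hi.div D.ord_two
    convert this using 1
    rw [hδ, add_sub_cancel_left, mul_div_cancel_left₀ _ h20]
  have hE4 : D.Ge 5 (E / 4) := by
    rw [div_eq_mul_inv]
    exact hE.mul D.ord_four.inv.ge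
  have h40 := D.ord_four.ne_zero
  have h6 : D.Ord 3 ((1 + D.θ ^ 2) * D.θ - (1 - D.θ) ^ 2) :=
    D.ord_of_eq 3 19 31 8 13 <| by
      push_cast
      linear_combination (21 - 51 * D.θ + 44 * D.θ ^ 2 - 13 * D.θ ^ 3) * D.θ_eq
  have h7 : D.Ord 3 ((δ + (1 - D.θ)) * (δ - (1 - D.θ))) := by
    convert h6.add_ge (hE4.sub (D.ord_two.mul hδ1).ge) (by norm_num) using 1
    rw [hB, hδ] at hs
    field_simp
    linear_combination hs
  have h8 : D.Ord 5 ((δ + (1 - D.θ)) - (δ - (1 - D.θ))) := by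
    convert D.ord_two.mul D.ord_pi using 1 <;> ring
  have := h7.lt_of_odd h8 (by decide)
  omega

theorem Ord.neg_of_even (hw : D.Ord n w) (he : e = 1 ∨ e = -1)
    (h : s ^ 2 = w ^ 4 + D.A e * w ^ 2 + D.B) (hn : Even n) : n < 0 := by
  have h4 := hw.lt_four_of_quartic he h
  by_contra! h0
  obtain ⟨k, rfl⟩ := hn
  obtain rfl | rfl : k = 0 ∨ k = 1 := by omega
  · exact hw.ne_zero_of_quartic he h
  · exact hw.ne_two_of_quartic he h

/-- The factor `2 * w ^ 2 + A + 2 * s` is a square up to sign. -/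
theorem eq_sq_or_neg_sq (hw : D.Ord n w) (he : e = 1 ∨ e = -1) (hn : n ≤ -2)
    (h : s ^ 2 = w ^ 4 + D.A e * w ^ 2 + D.B) (hX : D.Ord (8 + 2 * n) (2 * w ^ 2 + D.A e + 2 * s)) :
    ∃ r ≠ 0, 2 * w ^ 2 + D.A e + 2 * s = r ^ 2 ∨ 2 * w ^ 2 + D.A e + 2 * s = -r ^ 2 := by
  have hκ := D.κ_sq_eq he
  obtain ⟨X, hXd⟩ : ∃ X, X = 2 * w ^ 2 + D.A e + 2 * s := ⟨_, rfl⟩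
  rw [← hXd] at hX ⊢
  have hX0 := hX.ne_zero
  have hXX : X - D.κ ^ 2 / X = 4 * w ^ 2 + 2 * D.A e := by
    field_simp
    rw [hκ, hXd]
    linear_combination 4 * h
  obtain ⟨i, hi, j, hj, k, hk, l, hl, r, hr⟩ : D.IsSelmer X := by
    refine D.selmer (-2 * D.A e) (-1) X (2 * w * X) 10 6 10
      ((isIntegral_two.neg).mul (D.isIntegral_A he)) (Or.inr rfl) hX0 ?_
    rw [← η]
    have := D.κ_sq
    field_simp at hXX
    linear_combination X * this + X * hXX
  have hr0 : r ≠ 0 := by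
    rintro rfl
    simp [hX0] at hr
  obtain ⟨a, ha⟩ := D.exists_ord hr0
  have hs1 : D.Ord 0 ((-1 : K) ^ i) := by simpa using D.ord_one.neg.pow i
  have hXa := hX.unique (hr ▸ (((hs1.mul (D.ord_θ.pow j)).mul (D.ord_η.pow k)).mul
    (D.ord_pi.pow l)).mul (ha.pow 2))
  push_cast at hXa
  obtain rfl : l = 0 := by omega
  obtain rfl : a = 4 + n := by push_cast at hXa; omega
  clear hXa
  obtain ⟨u, hu⟩ : ∃ u, u = (-1 : K) ^ i * D.θ ^ j * D.η ^ k := ⟨_, rfl⟩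
  have hu0 : D.Ord 0 u := by
    rw [hu]; simpa using (hs1.mul (D.ord_θ.pow j)).mul (D.ord_η.pow k)
  have hXu : X = u * r ^ 2 := by rw [hr, hu]; ring
  have hun := hu0.ne_zero
  obtain ⟨c, hc⟩ : ∃ c, c = D.κ / r := ⟨_, rfl⟩
  obtain ⟨b, hb⟩ : ∃ b, b = c / r := ⟨_, rfl⟩
  obtain ⟨ρ, hρ⟩ : ∃ ρ, ρ = 2 * w / r := ⟨_, rfl⟩
  have hbo : D.Ord (-3 - 2 * n) b := by
    rw [hb, hc]
    convert (D.ord_κ.div ha).div ha using 1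
    ring
  have hρo : D.Ord 0 ρ := by
    rw [hρ]
    convert (D.ord_two.mul hw).div ha using 1
    ring
  have hAo : D.Ge 5 (2 * D.A e / r ^ 2) :=
    ((D.ord_two.mul (D.ord_A he)).div (ha.pow 2)).ge.mono (by push_cast; omega)
  have hb2 : D.Ge 2 (b ^ 2) := (hbo.pow 2).ge.mono (by push_cast; omega)
  have key : u - b ^ 2 / u = ρ ^ 2 + 2 * D.A e / r ^ 2 := by
    rw [hXu] at hXX
    rw [hρ, hb, hc]
    field_simp at hXX ⊢
    linear_combination hXX
  have hbu : D.Ge 2 (b ^ 2 / u) := by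
    rw [div_eq_mul_inv]
    simpa using hb2.mul hu0.inv.ge
  have hj0 : j = 0 := by
    by_contra hj0
    obtain rfl : j = 1 := by omega
    have h1 : D.Ge 2 (u - 1) := by
      have h3 := (hρo.sq_sub_one.add hbu).add (hAo.mono (by norm_num : (2 : ℤ) ≤ 5))
      convert h3 using 1
      linear_combination key
    have h2 : D.Ord 1 (u - 1) := by
      rw [hu]
      interval_cases i <;> interval_cases k
      · convert D.ord_pi.neg using 1
        ring
      · refine D.ord_of_eq 1 5 9 2 4 ?_
        rw [η]; push_cast; linear_combination (7 - 4 * D.θ) * D.θ_eq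
      · convert D.ord_one_add.neg using 1
        ring
      · refine D.ord_of_eq 1 (-15) (-22) (-6) (-9) ?_
        rw [η]; push_cast; linear_combination (-13 + 9 * D.θ) * D.θ_eq
    have := h2.le_of_ge h1
    omega
  subst hj0
  have hk0 : k = 0 := by
    by_contra hk0
    obtain rfl : k = 1 := by omega
    have hρb : D.Ge 5 (2 * ρ * b) :=
      ((D.ord_two.mul hρo).mul hbo).ge.mono (by omega)
    have hu1 : D.Ord 3 (u - 1) ∧ D.Ge 3 (u - 1) := by
      have : D.Ord 3 (u - 1) := by
        rw [hu]
        interval_cases i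
        · convert D.ord_η_sub_one using 1
          ring
        · convert D.ord_η_sub_one.neg.add_ge D.ord_two.neg.ge (by norm_num) using 1
          ring
      exact ⟨this, this.ge⟩
    have h1 : D.Ge 4 (b ^ 2 / u * (u - 1)) := (hbu.mul hu1.2).mono (by norm_num)
    have h2 : D.Ord 3 ((ρ + b + 1) * (ρ + b - 1)) := by
      have := ((hu1.1.add_ge h1 (by norm_num)).add_ge hAo.neg (by norm_num)).add_ge hρb
        (by norm_num)
      convert this using 1
      have h3 : b ^ 2 / u * (u - 1) = b ^ 2 - b ^ 2 / u := by field_simp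
      rw [h3]
      linear_combination -key
    have := h2.lt_of_odd (m := 4) (by
      convert D.ord_two using 1
      ring) (by decide)
    omega
  subst hk0
  refine ⟨r, hr0, ?_⟩
  rw [hXu, hu]
  interval_cases i
  · left; ring
  · right; ring

end QuarticData

namespace QuarticData

variable {K : Type*} [Field K] {D : QuarticData K} {m n : ℤ} {x y w s e r : K}

theorem exists_ord_factor (hw : D.Ord n w) (he : e = 1 ∨ e = -1) (hn : n ≤ -2)
    (h : s ^ 2 = w ^ 4 + D.A e * w ^ 2 + D.B) :
    D.Ord (8 + 2 * n) (2 * w ^ 2 + D.A e + 2 * s) ∨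
      D.Ord (8 + 2 * n) (2 * w ^ 2 + D.A e + 2 * -s) := by
  have h1 : D.Ord 10 ((2 * w ^ 2 + D.A e + 2 * s) * (2 * w ^ 2 + D.A e + 2 * -s)) := by
    have h0 : D.Ord 10 (-D.κ ^ 2) := (D.ord_κ.pow 2).neg
    convert h0 using 1
    rw [κ_sq_eq D he]
    linear_combination -4 * h
  have h2 : D.Ord (8 + 2 * n) ((2 * w ^ 2 + D.A e + 2 * s) + (2 * w ^ 2 + D.A e + 2 * -s)) := by
    have h3 : D.Ord (8 + 2 * n) (4 * w ^ 2) := D.ord_four.mul (hw.pow 2)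
    convert h3.add_ge (D.ord_two.mul (D.ord_A he)).ge (by omega) using 1
    ring
  obtain ⟨i, hi⟩ := D.exists_ord (left_ne_zero_of_mul h1.ne_zero)
  obtain ⟨j, hj⟩ := D.exists_ord (right_ne_zero_of_mul h1.ne_zero)
  have hij := h1.unique (hi.mul hj)
  rcases lt_trichotomy i j with hlt | rfl | hlt
  · left
    rwa [h2.unique (hi.add_ge hj.ge hlt)]
  · have := h2.le_of_ge (hi.add_ord hj)
    omega
  · right
    rw [add_comm (_ + _) (_ + _)] at h2
    rwa [h2.unique (hj.add_ge hi.ge hlt)]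

/-- Up to the sign of `s`, the factor `2 * w ^ 2 + A + 2 * s` is a square. -/
theorem exists_eq_sq (hw : D.Ord n w) (he : e = 1 ∨ e = -1) (hn : n ≤ -2)
    (h : s ^ 2 = w ^ 4 + D.A e * w ^ 2 + D.B) :
    ∃ t r, r ≠ 0 ∧ t ^ 2 = w ^ 4 + D.A e * w ^ 2 + D.B ∧ 2 * w ^ 2 + D.A e + 2 * t = r ^ 2 := by
  have main (s : K) (h : s ^ 2 = w ^ 4 + D.A e * w ^ 2 + D.B)
      (hX : D.Ord (8 + 2 * n) (2 * w ^ 2 + D.A e + 2 * s)) :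
      ∃ t r, r ≠ 0 ∧ t ^ 2 = w ^ 4 + D.A e * w ^ 2 + D.B ∧
        2 * w ^ 2 + D.A e + 2 * t = r ^ 2 := by
    obtain ⟨r, hr, h1 | h1⟩ := eq_sq_or_neg_sq hw he hn h hX
    · exact ⟨s, r, hr, h, h1⟩
    · refine ⟨-s, D.κ / r, div_ne_zero D.ord_κ.ne_zero hr, by rw [neg_sq, h], ?_⟩
      rw [div_pow, κ_sq_eq D he, eq_div_iff (pow_ne_zero 2 hr), ← neg_eq_iff_eq_neg.2 h1]
      linear_combination 4 * h
  rcases exists_ord_factor hw he hn h with h1 | h1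
  · exact main s h h1
  · exact main (-s) (by rw [neg_sq, h]) h1

/-- The descent step. -/
theorem exists_descent (hw : D.Ord n w) (he : e = 1 ∨ e = -1) (hn : n ≤ -2)
    (h : s ^ 2 = w ^ 4 + D.A e * w ^ 2 + D.B) :
    ∃ z r, z ≠ 0 ∧ r ^ 2 * z ^ 2 = z ^ 4 + D.A e * z ^ 2 + D.B ∧
      z ^ 4 - D.B = 2 * r * w * z ^ 2 := by
  obtain ⟨t, r, -, ht, htr⟩ := exists_eq_sq hw he hn h
  have main (r z : K) (htr : 2 * w ^ 2 + D.A e + 2 * t = r ^ 2) (hz : w ^ 2 + t + r * w = z ^ 2) :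
      ∃ z r, z ≠ 0 ∧ r ^ 2 * z ^ 2 = z ^ 4 + D.A e * z ^ 2 + D.B ∧
        z ^ 4 - D.B = 2 * r * w * z ^ 2 := by
    have hprod : z ^ 2 * (w ^ 2 + t - r * w) = D.B := by
      rw [← hz]; linear_combination ht + w ^ 2 * htr
    refine ⟨z, r, ?_, ?_, ?_⟩
    · rintro rfl
      exact D.ord_B.ne_zero (by simpa using hprod.symm)
    · linear_combination hprod - z ^ 2 * htr + z ^ 2 * hz
    · linear_combination hprod - z ^ 2 * hz
  have hprod : (w ^ 2 + t + r * w) * (w ^ 2 + t - r * w) = D.B := by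
    linear_combination ht + w ^ 2 * htr
  have hx0 : w ^ 2 + t + r * w ≠ 0 := left_ne_zero_of_mul (hprod ▸ D.ord_B.ne_zero)
  obtain ⟨z, hz | hz⟩ := eq_sq_or_eq_η_mul_sq (x := w ^ 2 + t + r * w)
    (y := (w ^ 2 + t + r * w) * r) he hx0 (by
      rw [← hprod]; linear_combination (w ^ 2 + t + r * w) ^ 2 * htr)
  · exact main r z htr hz
  · have hz0 : z ≠ 0 := by
      rintro rfl
      simp [hz] at hx0
    refine main (-r) (D.θ⁻¹ ^ 3 * D.η ^ 2 * (1 - D.θ) ^ 4 / z) (by rw [neg_sq, htr]) ?_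
    rw [hz, B_eq] at hprod
    have h0 := D.ord_η.ne_zero
    have h1 := D.θ_ne_zero
    rw [div_pow, eq_div_iff (pow_ne_zero 2 hz0)]
    refine mul_left_cancel₀ h0 ?_
    linear_combination hprod

/-- On the quartic `s ^ 2 = w ^ 4 + A * w ^ 2 + B`, the coordinate `w` has odd valuation. -/
theorem Ord.odd_of_quartic (hw : D.Ord n w) (he : e = 1 ∨ e = -1)
    (h : s ^ 2 = w ^ 4 + D.A e * w ^ 2 + D.B) : Odd n := by
  induction hN : n.natAbs using Nat.strong_induction_on generalizing n w s with
  | _ N ih =>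
  by_contra hodd
  rw [Int.not_odd_iff_even] at hodd
  have hneg := hw.neg_of_even he h hodd
  have hn : n ≤ -2 := by
    obtain ⟨k, rfl⟩ := hodd
    omega
  obtain ⟨z, r, hz, h1, h2⟩ := exists_descent hw he hn h
  obtain ⟨m, hm⟩ := D.exists_ord hz
  have h1' : (r * z) ^ 2 = z ^ 4 + D.A e * z ^ 2 + D.B := by rw [mul_pow, h1]
  have hev : ¬ Odd m := by
    intro hmo
    rcases le_or_gt m 1 with hm1 | hm1
    · have h3 : D.Ord (4 * m) (z ^ 4 - D.B) := by
        rw [sub_eq_add_neg]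
        exact (hm.pow 4).add_ge D.ord_B.neg.ge (by push_cast; omega)
      have h4 : D.Ord (4 * m) ((r * z) ^ 2) := by
        rw [h1']
        exact ((hm.pow 4).add_ge ((D.ord_A he).mul (hm.pow 2)).ge (by push_cast; omega)).add_ge
          D.ord_B.ge (by push_cast; omega)
      obtain ⟨a, ha⟩ := D.exists_ord (x := r) (by
        rintro rfl
        simpa using h4.ne_zero)
      have h5 := h4.unique ((ha.mul hm).pow 2)
      rw [h2] at h3
      have h6 := h3.unique (((D.ord_two.mul ha).mul hw).mul (hm.pow 2))
      push_cast at h5 h6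
      obtain ⟨k, rfl⟩ := hodd
      obtain ⟨l, rfl⟩ := hmo
      omega
    · obtain ⟨k, rfl⟩ := hodd
      obtain ⟨l, rfl⟩ := hmo
      have h3 : D.Ord 8 (z ^ 4 - D.B) := by
        rw [sub_eq_add_neg, add_comm]
        exact D.ord_B.neg.add_ge (hm.pow 4).ge (by push_cast; omega)
      have h4 : D.Ord 8 ((r * z) ^ 2) := by
        have h5 : D.Ge 9 (z ^ 4) := (hm.pow 4).ge.mono (by push_cast; omega)
        have h6 : D.Ge 9 (D.A e * z ^ 2) :=
          ((D.ord_A he).mul (hm.pow 2)).ge.mono (by push_cast; omega)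
        rw [h1', add_comm]
        exact D.ord_B.add_ge (h5.add h6) (by norm_num)
      obtain ⟨a, ha⟩ := D.exists_ord (x := r) (by
        rintro rfl
        simpa using h4.ne_zero)
      have h5 := h4.unique ((ha.mul hm).pow 2)
      rw [h2] at h3
      have h6 := h3.unique (((D.ord_two.mul ha).mul hw).mul (hm.pow 2))
      push_cast at h5 h6
      omega
  have hmneg := hm.neg_of_even he h1' (Int.not_odd_iff_even.1 hev)
  refine hev (ih m.natAbs ?_ hm h1' rfl)
  have h3 : D.Ord (4 * m) (z ^ 4 - D.B) := by
    rw [sub_eq_add_neg]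
    exact (hm.pow 4).add_ge D.ord_B.neg.ge (by push_cast; omega)
  have h4 : D.Ord (4 * m) ((r * z) ^ 2) := by
    rw [h1']
    exact ((hm.pow 4).add_ge ((D.ord_A he).mul (hm.pow 2)).ge (by push_cast; omega)).add_ge
      D.ord_B.ge (by push_cast; omega)
  obtain ⟨a, ha⟩ := D.exists_ord (x := r) (by
    rintro rfl
    simpa using h4.ne_zero)
  have h5 := h4.unique ((ha.mul hm).pow 2)
  rw [h2] at h3
  have h6 := h3.unique (((D.ord_two.mul ha).mul hw).mul (hm.pow 2))
  push_cast at h5 h6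
  omega

/-- On the elliptic curve `y ^ 2 = x ^ 3 + A * x ^ 2 + B * x`, the valuation of a nonzero `x` is
`2` modulo `4`. -/
theorem exists_ord_eq (he : e = 1 ∨ e = -1) (hx : x ≠ 0)
    (h : x * (x ^ 2 + D.A e * x + D.B) = y ^ 2) : ∃ k, D.Ord (4 * k + 2) x := by
  obtain ⟨r, hr | hr⟩ := eq_sq_or_eq_η_mul_sq he hx h
  all_goals
    have hr0 : r ≠ 0 := by
      rintro rfl
      simp [hx] at hr
    obtain ⟨a, ha⟩ := D.exists_ord hr0
  · obtain ⟨k, hk⟩ := ha.odd_of_quartic (s := y / r) he (by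
      rw [div_pow, ← h, hr]; field_simp)
    refine ⟨k, ?_⟩
    convert ha.pow 2 using 1
    push_cast; omega
  · obtain ⟨c, hc⟩ : ∃ c, c = D.θ⁻¹ ^ 3 * D.η ^ 2 * (1 - D.θ) ^ 4 := ⟨_, rfl⟩
    have hB : D.B = D.η * c ^ 2 := by rw [B_eq, hc]; ring
    have hco : D.Ord 4 c := by
      rw [hc]
      simpa using ((D.ord_θ.inv.pow 3).mul (D.ord_η.pow 2)).mul (D.ord_pi.pow 4)
    have hη := D.ord_η.ne_zero
    have hc0 := hco.ne_zero
    obtain ⟨k, hk⟩ := (hco.div ha).odd_of_quartic (s := c * y / (D.η * r ^ 3)) he (by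
      rw [div_pow, mul_pow, ← h, hr, hB]; field_simp; ring)
    refine ⟨1 - k, ?_⟩
    rw [hr]
    convert D.ord_η.mul (ha.pow 2) using 1
    push_cast; omega

end QuarticData

/-- The third intersection point of a chord with the curve `y ^ 2 = x * (x ^ 2 + A * x + B)`. -/
theorem chord_mem_curve {K : Type*} [Field K] {A B x y x₁ y₁ : K} (hx : x ≠ x₁)
    (h : x * (x ^ 2 + A * x + B) = y ^ 2) (h₁ : x₁ * (x₁ ^ 2 + A * x₁ + B) = y₁ ^ 2) {m X : K}
    (hm : m = (y - y₁) / (x - x₁)) (hX : X = m ^ 2 - A - x - x₁) :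
    X * (X ^ 2 + A * X + B) = (y₁ + m * (X - x₁)) ^ 2 := by
  have hd : x - x₁ ≠ 0 := sub_ne_zero.2 hx
  have hy : y = y₁ + m * (x - x₁) := by rw [hm]; field_simp; ring
  rw [hy] at h
  refine mul_left_cancel₀ hd ?_
  rw [hX]
  linear_combination (m ^ 2 - A - x - x₁ - x₁) * h - (m ^ 2 - A - x - x₁ - x) * h₁

theorem chord_mul_chord {K : Type*} [Field K] {A B x y x₁ y₁ : K} (hx : x ≠ x₁)
    (h : x * (x ^ 2 + A * x + B) = y ^ 2) (h₁ : x₁ * (x₁ ^ 2 + A * x₁ + B) = y₁ ^ 2) :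
    (x - x₁) ^ 2 * ((((y - y₁) / (x - x₁)) ^ 2 - A - x - x₁) *
      (((y - -y₁) / (x - x₁)) ^ 2 - A - x - x₁)) = (x * x₁ - B) ^ 2 := by
  have hd : x - x₁ ≠ 0 := sub_ne_zero.2 hx
  have e (z : K) : ((z / (x - x₁)) ^ 2 - A - x - x₁) =
      (z ^ 2 - (A + x + x₁) * (x - x₁) ^ 2) / (x - x₁) ^ 2 := by
    field_simp; ring
  rw [e, e]
  field_simp
  have e2 : ((y - y₁) ^ 2 - (x - x₁) ^ 2 * (A + x + x₁)) *
      ((y + y₁) ^ 2 - (x - x₁) ^ 2 * (A + x + x₁)) =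
      (y ^ 2 + y₁ ^ 2 - (A + x + x₁) * (x - x₁) ^ 2) ^ 2 - 4 * y ^ 2 * y₁ ^ 2 := by ring
  rw [sub_neg_eq_add, e2, ← h, ← h₁]
  ring

namespace QuarticData

variable {K : Type*} [Field K] {D : QuarticData K} {m n : ℤ} {x y w s e r : K} {a b c : ℤ}

theorem ge_of_even (D : QuarticData K) (ha : Even a) : D.Ge 4 (a : K) := by
  obtain ⟨k, rfl⟩ := ha
  have := D.ord_two.ge.mul (D.ge_int k)
  rw [Int.cast_add, ← two_mul]
  simpa using this

theorem ord_of_odd (D : QuarticData K) (ha : Odd a) : D.Ord 0 (a : K) := by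
  have := D.ord_one.add_ge (D.ge_of_even (a := a - 1) (ha.sub_odd odd_one)) (by norm_num)
  simpa using this

theorem exists_ord_int (D : QuarticData K) (ha : a ≠ 0) : ∃ k, D.Ord (4 * k) (a : K) := by
  obtain ⟨k, hk, hnd⟩ := FiniteMultiplicity.exists_eq_pow_mul_and_not_dvd
    (Int.finiteMultiplicity_iff.2 ⟨by decide, ha⟩ : FiniteMultiplicity 2 a)
  have hk' : Odd k := Int.not_even_iff_odd.1 fun h => hnd h.two_dvd
  generalize multiplicity 2 a = n at hk
  subst hk
  refine ⟨n, ?_⟩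
  rw [mul_comm (4 : ℤ)]
  simpa using (D.ord_two.pow n).mul (D.ord_of_odd hk')

theorem map_linear_pos (σ : K →+* ℝ) (he : e = 1 ∨ e = -1) (hb : 0 < b) (hc : c ≠ 0)
    (h : -a ^ 8 + 2 * a ^ 4 * b ^ 2 + b ^ 4 = 2 * c ^ 2) :
    0 < σ (b - e * D.θ * a ^ 2) := by
  have h1 := D.map_θ σ
  have hR : -(a : ℝ) ^ 8 + 2 * a ^ 4 * b ^ 2 + b ^ 4 = 2 * c ^ 2 := by exact_mod_cast h
  have hc' : (0 : ℝ) < c ^ 2 := by positivity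
  have hb' : (0 : ℝ) < b := by exact_mod_cast hb
  obtain ⟨t, ht⟩ : ∃ t, t = σ (e * D.θ) := ⟨_, rfl⟩
  have ht1 : t ^ 4 + 2 * t ^ 2 = 1 := by
    rcases he with rfl | rfl <;> simp [ht, ← h1, Even.neg_pow (by decide : Even 4)]
  have e1 : σ (b - e * D.θ * a ^ 2) = b - t * a ^ 2 := by simp [ht]
  rw [e1]
  by_contra! hle
  have h2 : (b : ℝ) ^ 2 ≤ t ^ 2 * a ^ 4 := by
    calc (b : ℝ) ^ 2 ≤ (t * a ^ 2) ^ 2 := by gcongr; linarith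
      _ = _ := by ring
  have h3 : (b : ℝ) ^ 4 ≤ t ^ 4 * a ^ 8 := by
    calc (b : ℝ) ^ 4 = (b ^ 2) ^ 2 := by ring
      _ ≤ (t ^ 2 * a ^ 4) ^ 2 := by gcongr
      _ = _ := by ring
  have h4 : (a : ℝ) ^ 4 * b ^ 2 ≤ a ^ 4 * (t ^ 2 * a ^ 4) := by gcongr
  have h5 : (a : ℝ) ^ 8 = t ^ 4 * a ^ 8 + 2 * (a ^ 4 * (t ^ 2 * a ^ 4)) := by
    linear_combination -(a : ℝ) ^ 8 * ht1
  linarith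

theorem ord_linear (D : QuarticData K) (he : e = 1 ∨ e = -1) (ha : Odd a) (hb : Odd b) :
    D.Ord 1 (b - e * D.θ * a ^ 2) := by
  have h1 : D.Ge 4 ((b - 1 : ℤ) : K) := D.ge_of_even (hb.sub_odd odd_one)
  have h2 : D.Ge 4 (D.θ * (1 - e * a ^ 2)) := by
    have : D.Ge 4 (1 - e * a ^ 2) := by
      rcases he with rfl | rfl
      · have := D.ge_of_even (odd_one.sub_odd (ha.pow (n := 2)))
        simpa using this
      · have := D.ge_of_even (odd_one.add_odd (ha.pow (n := 2)))
        simpa using this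
    simpa using D.ord_θ.ge.mul this
  convert D.ord_pi.add_ge (h1.add h2) (by norm_num) using 1
  push_cast
  ring

theorem linear_eq (D : QuarticData K) (he : e = 1 ∨ e = -1) (ha : Odd a) (hb : Odd b) (hb0 : 0 < b)
    (hc : c ≠ 0) (hcop : IsCoprime a b) (h : -a ^ 8 + 2 * a ^ 4 * b ^ 2 + b ^ 4 = 2 * c ^ 2) :
    ∃ k < 2, ∃ r ≠ 0, b - e * D.θ * a ^ 2 = D.η ^ k * (1 - D.θ) * r ^ 2 := by
  have hs : D.IsSelmer (b - e * D.θ * a ^ 2) := D.factor a b c e he hcop hc h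
  obtain ⟨k, hk, l, hl, r, hr⟩ := hs.of_pos (map_linear_pos _ he hb0 hc h)
    (map_linear_pos _ he hb0 hc h)
  have h1 := D.ord_linear he ha hb
  rw [hr] at h1
  have hr0 : r ≠ 0 := by
    rintro rfl
    simpa using h1.ne_zero
  obtain ⟨n, hn⟩ := D.exists_ord hr0
  have := h1.unique (((D.ord_η.pow k).mul (D.ord_pi.pow l)).mul (hn.pow 2))
  push_cast at this
  obtain rfl : l = 1 := by omega
  exact ⟨k, hk, r, hr0, by rw [hr, pow_one]⟩

/-- A solution whose linear factor `b + e * θ * a ^ 2` is `1 + θ` times a square corresponds to a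
known point of the elliptic curve. -/
theorem eq_of_point (D : QuarticData K) (he : e = 1 ∨ e = -1) (ha : Odd a) (hb : Odd b)
    (h : -a ^ 8 + 2 * a ^ 4 * b ^ 2 + b ^ 4 = 2 * c ^ 2)
    (hr : b + e * D.θ * a ^ 2 = (1 + D.θ) * r ^ 2) {t : ℤ} (ht : Odd t) {x₁ y₁ : K}
    (hx₁ : x₁ = (1 + D.θ) * (t - e * D.θ))
    (hy₁ : x₁ * (x₁ ^ 2 + D.A e * x₁ + D.B) = y₁ ^ 2) : b = t * a ^ 2 := by
  by_contra hne
  have he2 : e ^ 2 = 1 := by rcases he with rfl | rfl <;> norm_num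
  have ha0 : D.Ord 0 (a : K) := D.ord_of_odd ha
  have ha1 := ha0.ne_zero
  have hK : -(a : K) ^ 8 + 2 * a ^ 4 * b ^ 2 + b ^ 4 = 2 * c ^ 2 := by
    have := congrArg (Int.cast : ℤ → K) h
    push_cast at this
    exact this
  obtain ⟨x, hx⟩ : ∃ x, x = (1 + D.θ) * (b - e * D.θ * a ^ 2) / a ^ 2 := ⟨_, rfl⟩
  have hxo : D.Ord 2 x := by
    rw [hx]
    simpa using (D.ord_one_add.mul (D.ord_linear he ha hb)).div (ha0.pow 2)
  have hx₁o : D.Ord 2 x₁ := by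
    have := D.ord_one_add.mul (D.ord_linear he odd_one ht)
    rw [hx₁]
    simpa using this
  have hbr : D.Ord 1 (b + e * D.θ * a ^ 2) := by
    have := D.ord_linear (e := -e) (by rcases he with rfl | rfl <;> simp) ha hb
    convert this using 1
    ring
  have hr0 : r ≠ 0 := by
    rintro rfl
    exact hbr.ne_zero (by simpa using hr)
  have hd0 := D.ord_one_add.ne_zero
  have hθ := D.θ_ne_zero
  obtain ⟨y, hy⟩ : ∃ y, y = (1 + D.θ) * (1 + D.θ ^ 2) * c / (r * a ^ 3) := ⟨_, rfl⟩
  have hcurve : x * (x ^ 2 + D.A e * x + D.B) = y ^ 2 := by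
    have h1 : x ^ 2 + D.A e * x + D.B =
        (1 + D.θ) ^ 2 * (b ^ 2 + (D.θ ^ 2 + 2) * a ^ 4) / a ^ 4 := by
      rw [hx, A, B]
      field_simp
      linear_combination (-D.θ ^ 2 * a ^ 4) * he2
    have h2 : (b - e * D.θ * a ^ 2) * (b ^ 2 + (D.θ ^ 2 + 2) * a ^ 4) * ((1 + D.θ) * r ^ 2) =
        (1 + D.θ ^ 2) ^ 2 * c ^ 2 := by
      rw [← hr, ← two_eq, ← hK]
      linear_combination (-D.θ ^ 2 * a ^ 4 * (b ^ 2 + (D.θ ^ 2 + 2) * a ^ 4)) * he2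
        - (a : K) ^ 8 * D.θ_eq
    rw [h1, hx, hy]
    field_simp
    linear_combination h2
  have hsub : x - x₁ = (1 + D.θ) * ((b - t * a ^ 2 : ℤ) : K) / a ^ 2 := by
    rw [hx, hx₁]
    push_cast
    field_simp
    ring
  obtain ⟨k, hk⟩ := D.exists_ord_int (sub_ne_zero.2 hne)
  have hso : D.Ord (1 + 4 * k) (x - x₁) := by
    rw [hsub]
    simpa using (D.ord_one_add.mul hk).div (ha0.pow 2)
  have hxne : x ≠ x₁ := sub_ne_zero.1 hso.ne_zero
  have hprod := chord_mul_chord hxne hcurve hy₁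
  have hmem₁ := chord_mem_curve hxne hcurve hy₁ rfl rfl
  have hmem₂ := chord_mem_curve (y₁ := -y₁) hxne hcurve (by rw [hy₁, neg_sq]) rfl rfl
  have hB : D.Ord 4 (x * x₁ - D.B) := by
    rw [sub_eq_add_neg]
    exact (hxo.mul hx₁o).add_ge D.ord_B.neg.ge (by norm_num)
  have h8 := hB.pow 2
  rw [← hprod] at h8
  have hne0 := right_ne_zero_of_mul h8.ne_zero
  obtain ⟨i, hi⟩ := exists_ord_eq he (left_ne_zero_of_mul hne0) hmem₁
  obtain ⟨j, hj⟩ := exists_ord_eq he (right_ne_zero_of_mul hne0) hmem₂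
  have := h8.unique ((hso.pow 2).mul (hi.mul hj))
  push_cast at this
  omega

theorem eq_or_eq (D : QuarticData K) (ha : Odd a) (hb : Odd b) (hb0 : 0 < b)
    (hc : c ≠ 0) (hcop : IsCoprime a b) (h : -a ^ 8 + 2 * a ^ 4 * b ^ 2 + b ^ 4 = 2 * c ^ 2) :
    b = 1 * a ^ 2 ∨ b = 3 * a ^ 2 := by
  obtain ⟨i, hi, r, hr0, hr⟩ := D.linear_eq (Or.inl rfl) ha hb hb0 hc hcop h
  obtain ⟨j, hj, s, hs0, hs⟩ := D.linear_eq (Or.inr rfl) ha hb hb0 hc hcop h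
  have hπ := D.ord_pi.ne_zero
  have hη := D.ord_η.ne_zero
  have hij : i ≠ j := by
    rintro rfl
    have h1 : D.Ord 3 ((s / r + 1) * (s / r - 1)) := by
      have h2 : D.Ord 3 (2 * D.θ * a ^ 2 / (b - 1 * D.θ * a ^ 2)) :=
        ((D.ord_two.mul D.ord_θ).mul ((D.ord_of_odd ha).pow 2)).div
          (D.ord_linear (Or.inl rfl) ha hb)
      convert h2 using 1
      have h3 : 2 * D.θ * a ^ 2 =
          D.η ^ i * (1 - D.θ) * s ^ 2 - D.η ^ i * (1 - D.θ) * r ^ 2 := by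
        rw [← hr, ← hs]; ring
      rw [h3, hr]
      field_simp
      ring
    have := h1.lt_of_odd (m := 4) (by
      convert D.ord_two using 1
      ring) (by decide)
    omega
  obtain ⟨rfl, rfl⟩ | ⟨rfl, rfl⟩ : i = 0 ∧ j = 1 ∨ i = 1 ∧ j = 0 := by omega
  · left
    refine D.eq_of_point (e := 1) (r := s) (Or.inl rfl) ha hb h ?_ odd_one rfl
      (y₁ := (1 + D.θ) * (1 + D.θ ^ 2)) ?_
    · rw [← one_sub_mul_η]; linear_combination hs
    · rw [A, B]; push_cast
      linear_combination -(2 + 4 * D.θ + 2 * D.θ ^ 2) * D.θ_eq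
  · right
    refine D.eq_of_point (e := -1) (r := r) (Or.inr rfl) ha hb h ?_ (by decide) rfl
      (y₁ := 5 + 11 * D.θ + 3 * D.θ ^ 2 + D.θ ^ 3) ?_
    · rw [← one_sub_mul_η]; linear_combination hr
    · rw [A, B]; push_cast
      linear_combination -8 * D.θ_eq

theorem solutions (D : QuarticData K) (ha0 : 0 < a) (ha : Odd a) (hb : Odd b) (hb0 : 0 < b)
    (hc : c ≠ 0) (hcop : IsCoprime a b) (h : -a ^ 8 + 2 * a ^ 4 * b ^ 2 + b ^ 4 = 2 * c ^ 2) :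
    (a = 1 ∧ b = 1) ∨ (a = 1 ∧ b = 3) := by
  have key := D.eq_or_eq ha hb hb0 hc hcop h
  have hab : a ∣ b := by
    rcases key with h | h <;> exact h ▸ (dvd_pow_self a two_ne_zero).mul_left _
  obtain rfl : a = 1 := by
    have := hcop.isUnit_of_dvd' dvd_rfl hab
    rcases Int.isUnit_iff.1 this with h | h <;> omega
  omega

end QuarticData

open Polynomial in
/-- The minimal polynomial of `θ - 1`, where `θ ^ 4 + 2 * θ ^ 2 = 1`, is irreducible. -/
theorem irreducible_quartic : Irreducible (X ^ 4 + 4 * X ^ 3 + 8 * X ^ 2 + 8 * X + 2 : ℚ[X]) := by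
  let f : ℤ[X] := X ^ 4 + 4 * X ^ 3 + 8 * X ^ 2 + 8 * X + 2
  have hdeg : f.natDegree = 4 := by simp only [f]; compute_degree!
  have hmon : f.Monic := by simp only [f]; monicity!
  have hirr : Irreducible f := by
    have hP : (Ideal.span {(2 : ℤ)}).IsPrime :=
      (Ideal.span_singleton_prime two_ne_zero).2 Int.prime_two
    refine IsEisensteinAt.irreducible (𝓟 := Ideal.span {2}) ⟨?_, ?_, ?_⟩ hP hmon.isPrimitive
      (by omega)
    · rw [hmon.leadingCoeff, Ideal.mem_span_singleton]
      decide
    · intro n hn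
      rw [hdeg] at hn
      rw [Ideal.mem_span_singleton]
      interval_cases n <;> simp [f, coeff_X, coeff_ofNat_mul]
    · rw [Ideal.span_singleton_pow, Ideal.mem_span_singleton]
      simp [f, coeff_X]
  have := (hmon.irreducible_iff_irreducible_map_fraction_map (K := ℚ)).1 hirr
  simpa [f] using this

open Polynomial in
/-- A quartic number field generated by a root of `x ^ 4 + 2 * x ^ 2 = 1`, together with two real
embeddings and an embedding that is not real. -/
theorem exists_quartic_field : ∃ (K : Type) (_ : Field K) (_ : NumberField K) (θ : K)
    (σ₁ σ₂ : K →+* ℝ) (τ : K →+* ℂ), Module.finrank ℚ K = 4 ∧ θ ^ 4 + 2 * θ ^ 2 = 1 ∧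
      0 < σ₁ θ ∧ σ₂ θ < 0 ∧ (τ θ).im ≠ 0 := by
  let g : ℚ[X] := X ^ 4 + 4 * X ^ 3 + 8 * X ^ 2 + 8 * X + 2
  have hgirr : Irreducible g := irreducible_quartic
  have hgdeg : g.natDegree = 4 := by simp only [g]; compute_degree!
  have : Fact (Irreducible g) := ⟨hgirr⟩
  have hroot : (AdjoinRoot.root g) ^ 4 + 4 * (AdjoinRoot.root g) ^ 3 + 8 * (AdjoinRoot.root g) ^ 2 +
      8 * (AdjoinRoot.root g) + 2 = 0 := by
    have := AdjoinRoot.eval₂_root g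
    simpa [g, eval₂_add, eval₂_mul, eval₂_pow] using this
  have hlift {L : Type} [Field L] [CharZero L] [Algebra ℚ L] (z : L) (hz : z ^ 4 + 2 * z ^ 2 = 1) :
      ∃ σ : AdjoinRoot g →+* L, σ (AdjoinRoot.root g + 1) = z := by
    refine ⟨AdjoinRoot.lift (algebraMap ℚ L) (z - 1) ?_, ?_⟩
    · simp [g, eval₂_add, eval₂_mul, eval₂_pow]
      linear_combination hz
    · simp
  have hs : √2 ^ 2 = 2 := Real.sq_sqrt (by norm_num)
  have hs1 : 1 < √2 := by rw [Real.lt_sqrt] <;> norm_num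
  have hr : √(√2 - 1) ^ 2 = √2 - 1 := Real.sq_sqrt (by linarith)
  have hr0 : 0 < √(√2 - 1) := Real.sqrt_pos.2 (by linarith)
  have hq : √(√2 + 1) ^ 2 = √2 + 1 := Real.sq_sqrt (by linarith)
  have hq0 : 0 < √(√2 + 1) := Real.sqrt_pos.2 (by linarith)
  obtain ⟨σ₁, h₁⟩ := hlift (√(√2 - 1)) (by
    rw [show √(√2 - 1) ^ 4 = (√(√2 - 1) ^ 2) ^ 2 by ring, hr]; linear_combination hs)
  obtain ⟨σ₂, h₂⟩ := hlift (-√(√2 - 1)) (by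
    rw [show (-√(√2 - 1)) ^ 4 = (√(√2 - 1) ^ 2) ^ 2 by ring, neg_sq, hr]; linear_combination hs)
  obtain ⟨τ, h₃⟩ := hlift (Complex.I * (√(√2 + 1) : ℝ)) (by
    have h1 : (Complex.I * (√(√2 + 1) : ℝ)) ^ 2 = -(√2 + 1 : ℝ) := by
      rw [mul_pow, Complex.I_sq, ← Complex.ofReal_pow, hq]; ring
    have h2 : (Complex.I * (√(√2 + 1) : ℝ)) ^ 4 = ((√2 + 1) ^ 2 : ℝ) := by
      rw [show (4 : ℕ) = 2 * 2 by norm_num, pow_mul, h1]; push_cast; ring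
    rw [h1, h2]
    norm_cast
    linear_combination hs)
  have hnf : NumberField (AdjoinRoot g) :=
    { to_charZero := charZero_of_injective_algebraMap (algebraMap ℚ (AdjoinRoot g)).injective
      to_finiteDimensional := (AdjoinRoot.powerBasis hgirr.ne_zero).finite }
  refine ⟨AdjoinRoot g, inferInstance, hnf, AdjoinRoot.root g + 1, σ₁, σ₂, τ, ?_, ?_, ?_, ?_, ?_⟩
  · have := (AdjoinRoot.powerBasis hgirr.ne_zero).finrank
    rw [AdjoinRoot.powerBasis_dim, hgdeg] at this
    convert this
  · linear_combination hroot
  · rw [h₁]; exact hr0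
  · rw [h₂]; linarith
  · rw [h₃]
    simpa using hq0.ne'

namespace NumberField

open Polynomial Module

variable {K : Type*} [Field K] [NumberField K] {θ : K}

/-- The discriminant of a basis consisting of integers is a square multiple of the field
discriminant. -/
theorem abs_discr_le_of_isIntegral {ι : Type*} [Fintype ι] [DecidableEq ι] (b : Basis ι ℚ K)
    (hb : ∀ i, IsIntegral ℤ (b i)) : (|discr K| : ℚ) ≤ |Algebra.discr ℚ b| := by
  classical
  let c := (integralBasis K).reindex ((integralBasis K).indexEquiv b)
  have h1 : Algebra.discr ℚ b = (c.toMatrix b).det ^ 2 * discr K := by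
    rw [coe_discr, ← Algebra.discr_reindex ℚ (integralBasis K) ((integralBasis K).indexEquiv b),
      ← Basis.coe_reindex, ← Algebra.discr_of_matrix_vecMul, Basis.toMatrix_map_vecMul]
  have h2 : IsIntegral ℤ (c.toMatrix b).det := IsIntegral.det fun i j ↦ by
    have := integralBasis_repr_apply K ⟨b j, hb j⟩ (((integralBasis K).indexEquiv b).symm i)
    simp only [Basis.toMatrix_apply, c, Basis.repr_reindex_apply]
    erw [this]
    exact isIntegral_algebraMap
  obtain ⟨n, hn⟩ := IsIntegrallyClosed.isIntegral_iff.1 h2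
  have hn0 : n ≠ 0 := by
    rintro rfl
    rw [← hn] at h1
    exact Algebra.discr_not_zero_of_basis ℚ b (by simpa using h1)
  rw [h1, ← hn, abs_mul, abs_pow]
  have : (1 : ℚ) ≤ |algebraMap ℤ ℚ n| := by
    simpa using mod_cast Int.one_le_abs hn0
  exact le_mul_of_one_le_left (abs_nonneg _) (one_le_pow₀ this)

theorem minpoly_sub_one (h : θ ^ 4 + 2 * θ ^ 2 = 1) :
    minpoly ℚ (θ - 1) = X ^ 4 + 4 * X ^ 3 + 8 * X ^ 2 + 8 * X + 2 := by
  refine (minpoly.eq_of_irreducible_of_monic irreducible_quartic ?_ (by monicity!)).symm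
  simp [map_ofNat]
  linear_combination h

/-- The power basis generated by `θ - 1`. -/
theorem exists_powerBasis (hK : finrank ℚ K = 4) (h : θ ^ 4 + 2 * θ ^ 2 = 1) :
    ∃ b : PowerBasis ℚ K, b.dim = 4 ∧ b.gen = θ - 1 := by
  have hd : (minpoly ℚ (θ - 1)).natDegree = 4 := by
    rw [minpoly_sub_one h]; compute_degree!
  have hi : IsIntegral ℚ (θ - 1) := .of_finite ..
  have h1 : Algebra.adjoin ℚ {θ - 1} = ⊤ := by
    rw [← IntermediateField.adjoin_simple_toSubalgebra_of_isAlgebraic hi.isAlgebraic,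
      (Field.primitive_element_iff_minpoly_natDegree_eq ℚ (θ - 1)).2 (hd.trans hK.symm)]
    rfl
  exact ⟨.ofAdjoinEqTop hi h1, hd, rfl⟩

theorem norm_sub_one (hK : finrank ℚ K = 4) (h : θ ^ 4 + 2 * θ ^ 2 = 1) :
    Algebra.norm ℚ (θ - 1) = 2 := by
  obtain ⟨b, hb, hg⟩ := exists_powerBasis hK h
  rw [← hg, Algebra.PowerBasis.norm_gen_eq_coeff_zero_minpoly, hb, hg, minpoly_sub_one h]
  norm_num

omit [NumberField K] in
theorem isIntegral_of_quartic (h : θ ^ 4 + 2 * θ ^ 2 = 1) : IsIntegral ℤ θ :=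
  ⟨X ^ 4 + 2 * X ^ 2 - 1, by monicity!, by simp [h]⟩

theorem abs_discr_le (hK : finrank ℚ K = 4) (h : θ ^ 4 + 2 * θ ^ 2 = 1) : |discr K| ≤ 1024 := by
  obtain ⟨b, hb, hg⟩ := exists_powerBasis hK h
  have hi := isIntegral_of_quartic h
  have h1 := abs_discr_le_of_isIntegral b.basis fun i ↦ by
    rw [b.basis_eq_pow, hg]
    exact (hi.sub isIntegral_one).pow _
  rw [Algebra.discr_powerBasis_eq_norm, hg, minpoly_sub_one h, abs_mul, abs_pow, abs_neg, abs_one,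
    one_pow, one_mul] at h1
  have h2 : aeval (θ - 1) (derivative (X ^ 4 + 4 * X ^ 3 + 8 * X ^ 2 + 8 * X + 2 : ℚ[X])) =
      algebraMap ℚ K 4 * (θ * (1 + θ ^ 2)) := by
    simp [map_ofNat]
    ring
  have h3 : |Algebra.norm ℚ θ| = 1 := by
    obtain ⟨t, rfl⟩ : ∃ t : 𝓞 K, (t : K) = θ := ⟨⟨θ, hi⟩, rfl⟩
    have : IsUnit t := .of_mul_eq_one (t ^ 3 + 2 * t) <| RingOfIntegers.coe_injective <| by
      simp only [map_mul, map_add, map_pow, map_one, map_ofNat]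
      linear_combination h
    simpa [RingOfIntegers.coe_norm] using isUnit_iff_norm.1 this
  have h4 : |Algebra.norm ℚ (1 + θ ^ 2)| = 4 := by
    have : (1 + θ ^ 2) ^ 2 = algebraMap ℚ K 2 := by
      rw [map_ofNat]; linear_combination h
    have := congr_arg (Algebra.norm ℚ) this
    rw [Algebra.norm_algebraMap, hK, map_pow] at this
    rw [← abs_of_nonneg (show (0 : ℚ) ≤ 4 by norm_num), ← sq_eq_sq_iff_abs_eq_abs, this]
    norm_num
  rw [h2, map_mul, map_mul, Algebra.norm_algebraMap, hK, abs_mul, abs_mul, h3, h4] at h1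
  norm_num at h1
  exact_mod_cast h1

theorem nrRealPlaces_eq_two_and_nrComplexPlaces_eq_one (hK : finrank ℚ K = 4)
    (σ : K →+* ℝ) (τ : K →+* ℂ) (hτ : (τ θ).im ≠ 0) :
    InfinitePlace.nrRealPlaces K = 2 ∧ InfinitePlace.nrComplexPlaces K = 1 := by
  classical
  have h1 : Nonempty {w : InfinitePlace K // w.IsReal} := by
    refine ⟨⟨.mk (Complex.ofRealHom.comp σ), _, ?_, rfl⟩⟩
    rw [ComplexEmbedding.isReal_iff]
    ext x
    simp
  have h2 : Nonempty {w : InfinitePlace K // w.IsComplex} := by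
    refine ⟨⟨.mk τ, _, fun hr ↦ hτ ?_, rfl⟩⟩
    rw [ComplexEmbedding.isReal_iff] at hr
    exact Complex.conj_eq_iff_im.1 (RingHom.congr_fun hr θ)
  have h3 : InfinitePlace.nrRealPlaces K ≠ 0 := Fintype.card_ne_zero
  have h4 : InfinitePlace.nrComplexPlaces K ≠ 0 := Fintype.card_ne_zero
  have := InfinitePlace.card_add_two_mul_card_eq_rank K
  omega

end NumberField

namespace NumberField

open Module _root_.Ideal

section CommRing

variable {R : Type*} [CommRing R] {t : R}

theorem isUnit_of_quartic (h : t ^ 4 + 2 * t ^ 2 = 1) : IsUnit t :=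
  .of_mul_eq_one (t ^ 3 + 2 * t) (by linear_combination h)

theorem isUnit_η_of_quartic (h : t ^ 4 + 2 * t ^ 2 = 1) : IsUnit (2 + 3 * t + t ^ 2 + t ^ 3) :=
  .of_mul_eq_one (2 - 3 * t + t ^ 2 - t ^ 3) (by linear_combination (-3 - t ^ 2) * h)

theorem two_mul_of_quartic (h : t ^ 4 + 2 * t ^ 2 = 1) :
    2 * t ^ 4 = (1 - t) ^ 4 * (2 + 3 * t + t ^ 2 + t ^ 3) ^ 2 := by
  have h1 : (1 - t) * (2 + 3 * t + t ^ 2 + t ^ 3) = 1 + t := by linear_combination -h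
  rw [show (1 - t) ^ 4 * (2 + 3 * t + t ^ 2 + t ^ 3) ^ 2 =
    (1 - t) ^ 2 * ((1 - t) * (2 + 3 * t + t ^ 2 + t ^ 3)) ^ 2 by ring, h1]
  linear_combination h

theorem associated_two_of_quartic (h : t ^ 4 + 2 * t ^ 2 = 1) : Associated ((1 - t) ^ 4) 2 :=
  (associated_mul_isUnit_left_iff ((isUnit_η_of_quartic h).pow 2)).1
    (two_mul_of_quartic h ▸ associated_mul_unit_left 2 _ ((isUnit_of_quartic h).pow 4))

end CommRing

variable {K : Type*} [Field K] [NumberField K] {t : 𝓞 K}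

theorem absNorm_span_one_sub (hK : finrank ℚ K = 4) (h : t ^ 4 + 2 * t ^ 2 = 1) :
    absNorm (span {1 - t}) = 2 := by
  have h1 : (t : K) ^ 4 + 2 * (t : K) ^ 2 = 1 := by
    simpa [map_ofNat] using congr_arg (algebraMap (𝓞 K) K) h
  have h2 : (Algebra.norm ℤ (t - 1) : ℚ) = 2 := by
    rw [Algebra.coe_norm_int, RingOfIntegers.coe_eq_algebraMap, map_sub, map_one,
      norm_sub_one hK h1]
  rw [show 1 - t = -(t - 1) by ring, span_singleton_neg, absNorm_span_singleton,
    show Algebra.norm ℤ (t - 1) = 2 by exact_mod_cast h2]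
  rfl

theorem prime_one_sub (hK : finrank ℚ K = 4) (h : t ^ 4 + 2 * t ^ 2 = 1) : Prime (1 - t) := by
  have h1 := absNorm_span_one_sub hK h
  have h2 : 1 - t ≠ 0 := by
    intro h0
    simp [h0] at h1
  exact (span_singleton_prime h2).1 (isPrime_of_irreducible_absNorm (h1 ▸ Nat.prime_two))

theorem dvd_or_dvd_sub_one (hK : finrank ℚ K = 4) (h : t ^ 4 + 2 * t ^ 2 = 1) (x : 𝓞 K) :
    1 - t ∣ x ∨ 1 - t ∣ x - 1 := by
  have h1 : Nat.card (𝓞 K ⧸ span {1 - t}) = 2 := absNorm_span_one_sub hK h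
  have h2 := (Nat.card_eq_two_iff' 0).1 h1
  have : Finite (𝓞 K ⧸ span {1 - t}) := Nat.finite_of_card_ne_zero (by omega)
  have : Nontrivial (𝓞 K ⧸ span {1 - t}) := Finite.one_lt_card_iff_nontrivial.1 (by omega)
  simp only [← mem_span_singleton, ← Quotient.eq_zero_iff_mem, map_sub, map_one, sub_eq_zero]
  by_contra! hx
  exact hx.2 (h2.unique hx.1 one_ne_zero)

theorem isPrincipalIdealRing_of_quartic (hK : finrank ℚ K = 4) (h : t ^ 4 + 2 * t ^ 2 = 1)
    (hc : InfinitePlace.nrComplexPlaces K = 1) : IsPrincipalIdealRing (𝓞 K) := by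
  have h1 : (t : K) ^ 4 + 2 * (t : K) ^ 2 = 1 := by
    simpa [map_ofNat] using congr_arg (algebraMap (𝓞 K) K) h
  refine RingOfIntegers.isPrincipalIdealRing_of_isPrincipal_of_norm_le_of_isPrime fun P hP hM ↦ ?_
  have hlt : absNorm (P : Ideal (𝓞 K)) < 4 := by
    have h2 : √|(discr K : ℝ)| ≤ 32 := by
      rw [Real.sqrt_le_left (by norm_num)]
      norm_num
      exact_mod_cast abs_discr_le hK h1
    have h3 : 4 / Real.pi < 4 / 3 := by
      gcongr
      exact Real.pi_gt_three
    rw [hc, hK] at hM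
    have : (absNorm (P : Ideal (𝓞 K)) : ℝ) < 4 := by
      refine hM.trans_lt ?_
      norm_num [Nat.factorial]
      nlinarith [Real.sqrt_nonneg |(discr K : ℝ)|, div_pos four_pos Real.pi_pos]
    exact_mod_cast this
  have h0 : absNorm (P : Ideal (𝓞 K)) ≠ 0 := absNorm_ne_zero_of_nonZeroDivisors P
  have hone : absNorm (P : Ideal (𝓞 K)) ≠ 1 := fun h ↦ hP.ne_top (absNorm_eq_one_iff.1 h)
  have hmem := absNorm_mem (P : Ideal (𝓞 K))
  interval_cases hn : absNorm (P : Ideal (𝓞 K))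
  · exact (h0 rfl).elim
  · exact (hone rfl).elim
  · have h2 : 1 - t ∈ (P : Ideal (𝓞 K)) := by
      refine hP.mem_of_pow_mem 4 (mem_of_dvd _ (associated_two_of_quartic h).symm.dvd ?_)
      exact_mod_cast hmem
    have hp := prime_one_sub hK h
    have := ((span_singleton_prime hp.ne_zero).2 hp).isMaximal (by simpa using hp.ne_zero)
    exact ⟨1 - t, (this.eq_of_le hP.ne_top ((span_singleton_le_iff_mem _).2 h2)).symm⟩
  · have hmax := hP.isMaximal (nonZeroDivisors.coe_ne_zero P)
    let := Quotient.field (P : Ideal (𝓞 K))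
    have hcard : Nat.card (𝓞 K ⧸ (P : Ideal (𝓞 K))) = 3 := hn
    have : Finite (𝓞 K ⧸ (P : Ideal (𝓞 K))) := Nat.finite_of_card_ne_zero (by omega)
    have := Fintype.ofFinite (𝓞 K ⧸ (P : Ideal (𝓞 K)))
    have h3 := FiniteField.pow_card (Ideal.Quotient.mk (P : Ideal (𝓞 K)) t)
    rw [← Nat.card_eq_fintype_card, hcard] at h3
    have h4 : Ideal.Quotient.mk (P : Ideal (𝓞 K)) 3 = 0 :=
      Quotient.eq_zero_iff_mem.2 (by exact_mod_cast hmem)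
    have h5 := congr_arg (Ideal.Quotient.mk (P : Ideal (𝓞 K))) h
    simp only [map_add, map_mul, map_pow, map_one, map_ofNat] at h4 h5
    refine (one_ne_zero (α := 𝓞 K ⧸ (P : Ideal (𝓞 K))) ?_).elim
    linear_combination -h5 + Ideal.Quotient.mk (P : Ideal (𝓞 K)) t * h3 +
      Ideal.Quotient.mk (P : Ideal (𝓞 K)) t ^ 2 * h4

end NumberField

namespace NumberField

open Module IsDedekindDomain

variable {K : Type*} [Field K] [NumberField K] {t : 𝓞 K}

open WithZero in
theorem exists_valuation (hK : finrank ℚ K = 4) (h : t ^ 4 + 2 * t ^ 2 = 1) :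
    ∃ v : Valuation K (WithZero (Multiplicative ℤ)), v (1 - algebraMap (𝓞 K) K t) = exp (-1) ∧
      ∀ x, v x = 1 → v (x - 1) < 1 := by
  have hp := prime_one_sub hK h
  let w : HeightOneSpectrum (𝓞 K) := ⟨Ideal.span {1 - t},
    (Ideal.span_singleton_prime hp.ne_zero).2 hp, by simpa using hp.ne_zero⟩
  refine ⟨w.valuation K, ?_, fun x hx ↦ ?_⟩
  · rw [← map_one (algebraMap (𝓞 K) K), ← map_sub, w.valuation_of_algebraMap,
      w.intValuation_singleton hp.ne_zero rfl]
  · have hsub (y : 𝓞 K) (hy : w.valuation K (algebraMap (𝓞 K) K y) = 1) :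
        w.valuation K (algebraMap (𝓞 K) K y - 1) < 1 := by
      rw [w.valuation_eq_one_iff_notMem, Ideal.mem_span_singleton] at hy
      rw [← map_one (algebraMap (𝓞 K) K), ← map_sub, w.valuation_lt_one_iff_mem,
        Ideal.mem_span_singleton]
      exact (dvd_or_dvd_sub_one hK h y).resolve_left hy
    obtain ⟨a, s, hs⟩ := w.exists_primeCompl_mul_eq_of_integer x hx.le
    have h1 : w.valuation K (algebraMap (𝓞 K) K s) = 1 :=
      w.valuation_eq_one_iff_notMem.2 s.2
    have h2 : w.valuation K (algebraMap (𝓞 K) K a) = 1 := by rw [← hs, map_mul, hx, h1, one_mul]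
    have h3 : w.valuation K (x - 1) = w.valuation K
        ((algebraMap (𝓞 K) K a - 1) - (algebraMap (𝓞 K) K s - 1)) := by
      rw [show (algebraMap (𝓞 K) K a - 1) - (algebraMap (𝓞 K) K s - 1) =
        (x - 1) * algebraMap (𝓞 K) K s by linear_combination -hs, map_mul, h1, mul_one]
    exact h3 ▸ Valuation.map_sub_lt _ (hsub a h2) (hsub s h1)

end NumberField

namespace NumberField

open Module NumberField.Units

section CommRing

variable {R : Type*} [CommRing R] [IsDomain R] {t r : R}

/-- The unit `(1 + t) / (1 - t)` is not a square, as it is a nonsquare modulo a power of `1 - t`. -/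
theorem η_ne_sq (h : t ^ 4 + 2 * t ^ 2 = 1) (hp : Prime (1 - t)) :
    2 + 3 * t + t ^ 2 + t ^ 3 ≠ r ^ 2 := by
  intro hr
  obtain ⟨s, hs⟩ := (associated_two_of_quartic h).dvd
  have hg : r ^ 2 - 1 = (1 - t) ^ 3 * (1 + (1 - t) * (94 + 147 * t + 39 * t ^ 2 + 61 * t ^ 3)) := by
    rw [← hr]
    linear_combination (94 - 235 * t + 205 * t ^ 2 - 61 * t ^ 3) * h
  have h1 : 1 - t ∣ r - 1 := by
    rcases hp.dvd_or_dvd (show 1 - t ∣ (r - 1) * (r + 1) from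
      ⟨(1 - t) ^ 2 * (1 + (1 - t) * (94 + 147 * t + 39 * t ^ 2 + 61 * t ^ 3)),
        by linear_combination hg⟩) with h1 | ⟨q, hq⟩
    exacts [h1, ⟨q - (1 - t) ^ 3 * s, by linear_combination hq - hs⟩]
  obtain ⟨q, hq⟩ := h1
  have h2 : q * (q + (1 - t) ^ 3 * s) =
      (1 - t) * (1 + (1 - t) * (94 + 147 * t + 39 * t ^ 2 + 61 * t ^ 3)) := by
    apply mul_left_cancel₀ (pow_ne_zero 2 hp.ne_zero)
    rw [show r = 1 + (1 - t) * q by linear_combination hq] at hg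
    linear_combination hg - (1 - t) * q * hs
  have h3 : 1 - t ∣ q := by
    rcases hp.dvd_or_dvd (Dvd.intro _ h2.symm) with h3 | ⟨q', hq'⟩
    exacts [h3, ⟨q' - (1 - t) ^ 2 * s, by linear_combination hq'⟩]
  obtain ⟨q', rfl⟩ := h3
  have h4 : q' * (q' * (1 - t) + (1 - t) ^ 3 * s) =
      1 + (1 - t) * (94 + 147 * t + 39 * t ^ 2 + 61 * t ^ 3) := by
    apply mul_left_cancel₀ hp.ne_zero
    linear_combination h2
  refine hp.not_isUnit (isUnit_of_dvd_one ⟨q' * (q' + (1 - t) ^ 2 * s) -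
    (94 + 147 * t + 39 * t ^ 2 + 61 * t ^ 3), ?_⟩)
  linear_combination -h4

end CommRing

variable {K : Type*} [Field K] [NumberField K] {t : 𝓞 K}

omit [NumberField K] in
/-- A number field with a real embedding has only the roots of unity `1` and `-1`. -/
theorem eq_one_or_eq_neg_one_of_mem_torsion (σ : K →+* ℝ) {ζ : (𝓞 K)ˣ} (hζ : ζ ∈ torsion K) :
    ζ = 1 ∨ ζ = -1 := by
  obtain ⟨n, hn, h⟩ := isOfFinOrder_iff_pow_eq_one.1 ((CommGroup.mem_torsion _).1 hζ)
  let f : (𝓞 K) →+* ℝ := σ.comp (algebraMap (𝓞 K) K)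
  have hf : Function.Injective f := σ.injective.comp RingOfIntegers.coe_injective
  have h1 : f ζ ^ n = 1 := by
    rw [← map_pow, ← Units.val_pow_eq_pow_val, h]; simp
  have h2 : |f ζ| = 1 := by
    rw [← pow_eq_one_iff_of_nonneg (abs_nonneg _) hn.ne', ← abs_pow, h1, abs_one]
  rcases eq_or_eq_neg_of_abs_eq h2 with h3 | h3
  · exact .inl (Units.ext (hf (by simpa using h3)))
  · exact .inr (Units.ext (hf (by simpa using h3)))

/-- The class of a unit modulo squares, in terms of a fundamental system. -/
theorem exists_unit_class (σ : K →+* ℝ) : ∃ f : (𝓞 K)ˣ → Bool × (Fin (rank K) → ZMod 2),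
    ∀ u u', f u = f u' → ∃ w, u = u' * w ^ 2 := by
  classical
  choose e he using fun u : (𝓞 K)ˣ ↦ (exist_unique_eq_mul_prod K u).exists
  refine ⟨fun u ↦ (decide (((e u).1 : (𝓞 K)ˣ) = 1), fun i ↦ ((e u).2 i : ZMod 2)), fun u u' h ↦ ?_⟩
  simp only [Prod.mk.injEq, decide_eq_decide, funext_iff, ZMod.intCast_eq_intCast_iff_dvd_sub] at h
  choose m hm using h.2
  have h1 : ((e u).1 : (𝓞 K)ˣ) = (e u').1 := by
    rcases eq_one_or_eq_neg_one_of_mem_torsion σ (e u).1.2 with h1 | h1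
    · exact h1.trans (h.1.1 h1).symm
    · rcases eq_one_or_eq_neg_one_of_mem_torsion σ (e u').1.2 with h2 | h2
      exacts [(h.1.2 h2).trans h2.symm, h1.trans h2.symm]
  refine ⟨∏ i, (fundSystem K i) ^ (-m i), ?_⟩
  rw [he u, he u', h1, mul_assoc, ← Finset.prod_pow, ← Finset.prod_mul_distrib]
  congr 1
  refine Finset.prod_congr rfl fun i _ ↦ ?_
  rw [← zpow_natCast, ← zpow_mul, ← zpow_add]
  congr 1
  have := hm i
  push_cast at this ⊢
  linarith

theorem neg_one_pow_mul_inj {i j : Fin 2} {x y : ℝ} (hx : 0 < x) (hy : 0 < y)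
    (h : (-1) ^ (i : ℕ) * x = (-1) ^ (j : ℕ) * y) : i = j := by
  fin_cases i <;> fin_cases j <;> simp at h ⊢ <;> linarith

/-- The units are generated modulo squares by `-1`, `t` and `(1 + t) / (1 - t)`. -/
theorem exists_unit_eq (hK : finrank ℚ K = 4) (h : t ^ 4 + 2 * t ^ 2 = 1) (hr : rank K = 2)
    (σ₁ σ₂ : K →+* ℝ) (h₁ : 0 < σ₁ t) (h₂ : σ₂ t < 0) (u : (𝓞 K)ˣ) :
    ∃ i < 2, ∃ j < 2, ∃ k < 2, ∃ w : 𝓞 K, IsUnit w ∧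
      u = (-1) ^ i * t ^ j * (2 + 3 * t + t ^ 2 + t ^ 3) ^ k * w ^ 2 := by
  obtain ⟨f, hf⟩ := exists_unit_class (K := K) σ₁
  obtain ⟨T, hT⟩ := isUnit_of_quartic h
  obtain ⟨H, hH⟩ := isUnit_η_of_quartic h
  let g (p : Fin 2 × Fin 2 × Fin 2) : (𝓞 K)ˣ :=
    (-1) ^ (p.1 : ℕ) * T ^ (p.2.1 : ℕ) * H ^ (p.2.2 : ℕ)
  have hinj : Function.Injective (f ∘ g) := by
    rintro ⟨i, j, k⟩ ⟨i', j', k'⟩ hp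
    obtain ⟨w, hw⟩ := hf _ _ hp
    have hσ (σ : K →+* ℝ) : (-1) ^ (i : ℕ) * σ t ^ (j : ℕ) * σ (H : 𝓞 K) ^ (k : ℕ) =
        (-1) ^ (i' : ℕ) * σ t ^ (j' : ℕ) * σ (H : 𝓞 K) ^ (k' : ℕ) * σ (w : 𝓞 K) ^ 2 := by
      have := congr_arg (fun x : (𝓞 K)ˣ ↦ σ (algebraMap (𝓞 K) K x)) hw
      simpa [g, hT] using this
    have hη (σ : K →+* ℝ) : 0 < σ (H : 𝓞 K) := by
      have h3 : σ t ^ 4 + 2 * σ t ^ 2 = 1 := by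
        simpa [map_ofNat] using congr_arg (fun x : 𝓞 K ↦ σ (algebraMap (𝓞 K) K x)) h
      have h4 : (H : 𝓞 K) * (1 - t) = 1 + t := by rw [hH]; linear_combination -h
      have h5 : σ (H : 𝓞 K) * (1 - σ t) = 1 + σ t := by
        simpa using congr_arg (fun x : 𝓞 K ↦ σ (algebraMap (𝓞 K) K x)) h4
      have h6 : |σ t| < 1 := (sq_lt_one_iff_abs_lt_one _).1 (by nlinarith [sq_nonneg (σ t)])
      rw [abs_lt] at h6
      exact pos_of_mul_pos_left (h5 ▸ (by linarith)) (by linarith : 0 ≤ 1 - σ t)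
    have hw0 (σ : K →+* ℝ) : 0 < σ (w : 𝓞 K) ^ 2 := by
      have : σ (w : 𝓞 K) ≠ 0 := by simp
      positivity
    obtain rfl : i = i' := neg_one_pow_mul_inj (x := σ₁ t ^ (j : ℕ) * σ₁ (H : 𝓞 K) ^ (k : ℕ))
      (y := σ₁ t ^ (j' : ℕ) * σ₁ (H : 𝓞 K) ^ (k' : ℕ) * σ₁ (w : 𝓞 K) ^ 2)
      (by have := hη σ₁; positivity) (by have := hη σ₁; have := hw0 σ₁; positivity)
      (by linear_combination hσ σ₁)
    obtain rfl : j = j' := neg_one_pow_mul_inj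
      (x := (-σ₂ t) ^ (j : ℕ) * σ₂ (H : 𝓞 K) ^ (k : ℕ))
      (y := (-σ₂ t) ^ (j' : ℕ) * σ₂ (H : 𝓞 K) ^ (k' : ℕ) * σ₂ (w : 𝓞 K) ^ 2)
      (by have := hη σ₂; have := neg_pos.2 h₂; positivity)
      (by have := hη σ₂; have := neg_pos.2 h₂; have := hw0 σ₂; positivity)
      (by
        rw [← mul_assoc, ← mul_pow, mul_assoc _ _ (σ₂ (w : 𝓞 K) ^ 2), ← mul_assoc, ← mul_pow]
        apply mul_left_cancel₀ (pow_ne_zero (i : ℕ) (neg_ne_zero.2 (one_ne_zero (α := ℝ))))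
        simpa [mul_assoc] using hσ σ₂)
    have hk : H ^ (k : ℕ) = H ^ (k' : ℕ) * w ^ 2 := by
      simpa [g, mul_assoc] using hw
    have hH' (r : (𝓞 K)ˣ) : H ≠ r ^ 2 := fun hr ↦ by
      refine η_ne_sq (r := (r : 𝓞 K)) h (prime_one_sub hK h) ?_
      rw [← hH, hr, Units.val_pow_eq_pow_val]
    fin_cases k <;> fin_cases k' <;> simp at hk ⊢
    · exact hH' w⁻¹ (by rw [inv_pow]; exact eq_inv_of_mul_eq_one_left hk.symm)
    · exact hH' w hk
  have hcard : Fintype.card (Fin 2 × Fin 2 × Fin 2) =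
      Fintype.card (Bool × (Fin (rank K) → ZMod 2)) := by
    simp [hr]
  obtain ⟨p, hp⟩ := ((Fintype.bijective_iff_injective_and_card _).2 ⟨hinj, hcard⟩).2 (f u)
  obtain ⟨w, hw⟩ := hf u (g p) hp.symm
  refine ⟨p.1, p.1.2, p.2.1, p.2.1.2, p.2.2, p.2.2.2, w, w.isUnit, ?_⟩
  rw [hw]
  simp [g, hT, hH]

end NumberField

/-- If a product is a square and the only common prime factor of its two factors is `p`, each factor
is a square up to a unit and a power of `p`. -/
theorem exists_eq_unit_mul_prime_pow_mul_sq {R : Type*} [CommRing R] [IsDomain R]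
    [IsPrincipalIdealRing R] {p x y z : R} (hp : Prime p) (hx : x ≠ 0) (h : x * y = z ^ 2)
    (hxy : ∀ q, Prime q → q ∣ x → q ∣ y → q ∣ p) :
    ∃ e < 2, ∃ (u : Rˣ) (r : R), x = u * p ^ e * r ^ 2 := by
  suffices H : ∃ (m : ℕ) (u : Rˣ) (r : R), x = u * p ^ m * r ^ 2 by
    obtain ⟨m, u, r, rfl⟩ := H
    refine ⟨m % 2, Nat.mod_lt _ two_pos, u, p ^ (m / 2) * r, ?_⟩
    conv_lhs => rw [← Nat.mod_add_div m 2]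
    ring
  have hstrip {s : R} (hs : s ≠ 0) : ∃ (m : ℕ) (s' : R), ¬p ∣ s' ∧ s = p ^ m * s' := by
    obtain ⟨s', h1, h2⟩ := (FiniteMultiplicity.of_prime_left hp hs).exists_eq_pow_mul_and_not_dvd
    exact ⟨_, s', h2, h1⟩
  obtain ⟨m, x', hx', rfl⟩ := hstrip hx
  obtain ⟨y', z', hy', hz'⟩ : ∃ y' z', y' ∣ y ∧ x' * y' = z' ^ 2 := by
    rcases eq_or_ne y 0 with rfl | hy
    · exact ⟨0, 0, dvd_rfl, by ring⟩
    have hz : z ≠ 0 := by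
      rintro rfl
      simp_all
    obtain ⟨n, y', hy', rfl⟩ := hstrip hy
    obtain ⟨l, z', hz', rfl⟩ := hstrip hz
    have h1 : p ^ (m + n) * (x' * y') = p ^ (2 * l) * z' ^ 2 := by linear_combination h
    have h2 : ¬p ∣ x' * y' := fun h2 ↦ (hp.dvd_or_dvd h2).elim hx' hy'
    have h3 : ¬p ∣ z' ^ 2 := fun h3 ↦ hz' (hp.dvd_of_dvd_pow h3)
    have h4 : m + n = 2 * l := le_antisymm
      ((pow_dvd_pow_iff hp.ne_zero hp.not_isUnit).1
        (hp.pow_dvd_of_dvd_mul_right _ h3 (Dvd.intro _ h1)))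
      ((pow_dvd_pow_iff hp.ne_zero hp.not_isUnit).1
        (hp.pow_dvd_of_dvd_mul_right _ h2 (Dvd.intro _ h1.symm)))
    rw [h4] at h1
    exact ⟨y', z', dvd_mul_left .., mul_left_cancel₀ (pow_ne_zero _ hp.ne_zero) h1⟩
  have hcop : IsCoprime x' y' := by
    refine isCoprime_of_prime_dvd (fun h0 ↦ hx' (h0.1 ▸ dvd_zero p)) fun q hq hqx hqy ↦ hx' ?_
    have := hxy q hq (hqx.mul_left _) (hqy.trans hy')
    exact (hq.associated_of_dvd hp this).symm.dvd.trans hqx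
  obtain ⟨r, u, hu⟩ := exists_associated_pow_of_mul_eq_pow' hcop hz'
  exact ⟨m, u, r, by rw [← hu]; ring⟩

namespace NumberField

open Module

variable {K : Type*} [Field K] {t : 𝓞 K}

/-- The image of an element that is a square up to a unit and a power of `1 - t`. -/
theorem exists_selmer_form (hunit : ∀ u : (𝓞 K)ˣ, ∃ i < 2, ∃ j < 2, ∃ k < 2, ∃ w : 𝓞 K, IsUnit w ∧
      u = (-1) ^ i * t ^ j * (2 + 3 * t + t ^ 2 + t ^ 3) ^ k * w ^ 2) {x y z : 𝓞 K}
    [IsPrincipalIdealRing (𝓞 K)]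
    (hp : Prime (1 - t)) (hx : x ≠ 0) (h : x * y = z ^ 2)
    (hxy : ∀ q, Prime q → q ∣ x → q ∣ y → q ∣ 1 - t) :
    ∃ i < 2, ∃ j < 2, ∃ k < 2, ∃ l < 2, ∃ r : K, algebraMap (𝓞 K) K x =
      (-1) ^ i * (t : K) ^ j * (2 + 3 * t + t ^ 2 + t ^ 3) ^ k * (1 - t) ^ l * r ^ 2 := by
  obtain ⟨l, hl, u, r, rfl⟩ := exists_eq_unit_mul_prime_pow_mul_sq hp hx h hxy
  obtain ⟨i, hi, j, hj, k, hk, w, -, hw⟩ := hunit u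
  refine ⟨i, hi, j, hj, k, hk, l, hl, algebraMap (𝓞 K) K (w * r), ?_⟩
  rw [hw]
  simp only [map_mul, map_add, map_sub, map_pow, map_neg, map_one, map_ofNat]
  ring

variable [NumberField K]

theorem selmer_of_quartic (hunit : ∀ u : (𝓞 K)ˣ, ∃ i < 2, ∃ j < 2, ∃ k < 2, ∃ w : 𝓞 K, IsUnit w ∧
      u = (-1) ^ i * t ^ j * (2 + 3 * t + t ^ 2 + t ^ 3) ^ k * w ^ 2) [IsPrincipalIdealRing (𝓞 K)]
    (ht : t ^ 4 + 2 * t ^ 2 = 1) (hp : Prime (1 - t)) {A ε x y : K} {i j k : ℕ}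
    (hA : IsIntegral ℤ A) (hε : ε = 1 ∨ ε = -1) (hx : x ≠ 0)
    (h : x * (x ^ 2 + A * x + ε * (t : K)⁻¹ ^ i * (2 + 3 * t + t ^ 2 + t ^ 3) ^ j * (1 - t) ^ k) =
      y ^ 2) :
    ∃ i < 2, ∃ j < 2, ∃ k < 2, ∃ l < 2, ∃ r : K,
      x = (-1) ^ i * (t : K) ^ j * (2 + 3 * t + t ^ 2 + t ^ 3) ^ k * (1 - t) ^ l * r ^ 2 := by
  obtain ⟨A, rfl⟩ : ∃ a : 𝓞 K, algebraMap (𝓞 K) K a = A := ⟨⟨A, hA⟩, rfl⟩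
  obtain ⟨B, hB, hB'⟩ : ∃ B : 𝓞 K, algebraMap (𝓞 K) K B =
      ε * (t : K)⁻¹ ^ i * (2 + 3 * t + t ^ 2 + t ^ 3) ^ j * (1 - t) ^ k ∧
      Associated ((1 - t) ^ k) B := by
    obtain ⟨e, he, heu⟩ : ∃ e : 𝓞 K, algebraMap (𝓞 K) K e = ε ∧ IsUnit e := by
      rcases hε with rfl | rfl
      exacts [⟨1, by simp, isUnit_one⟩, ⟨-1, by simp, isUnit_one.neg⟩]
    obtain ⟨T, hT⟩ := isUnit_of_quartic ht
    refine ⟨(e * T⁻¹ ^ i * (2 + 3 * t + t ^ 2 + t ^ 3) ^ j : 𝓞 K) * (1 - t) ^ k, ?_,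
      associated_unit_mul_right _ _ ((heu.mul (T⁻¹.isUnit.pow i)).mul
        ((isUnit_η_of_quartic ht).pow j))⟩
    have : algebraMap (𝓞 K) K (T⁻¹ : (𝓞 K)ˣ) = (t : K)⁻¹ := by
      rw [← hT]
      simp
    simp only [map_mul, map_add, map_sub, map_pow, map_one, map_ofNat, he, this]
  rw [← hB] at h
  obtain ⟨a, ⟨b, hb⟩, hab, rfl⟩ := IsFractionRing.exists_reduced_fraction (A := 𝓞 K) x
  have hb0 : algebraMap (𝓞 K) K b ≠ 0 := by simpa using nonZeroDivisors.ne_zero hb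
  rw [IsFractionRing.mk'_eq_div] at *
  have ha0 : algebraMap (𝓞 K) K a ≠ 0 := fun h0 ↦ hx (by simp [h0])
  have h1 : algebraMap (𝓞 K) K ((a * b) * (a ^ 2 + A * a * b + B * b ^ 2)) =
      (y * (algebraMap (𝓞 K) K b) ^ 2) ^ 2 := by
    rw [mul_pow, ← h]
    simp only [map_mul, map_add, map_pow]
    field_simp
  obtain ⟨z, hz⟩ : ∃ z : 𝓞 K, algebraMap (𝓞 K) K z = y * (algebraMap (𝓞 K) K b) ^ 2 := by
    refine IsIntegrallyClosed.exists_algebraMap_eq_of_isIntegral_pow (n := 2) two_pos ?_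
    rw [← h1]
    exact isIntegral_algebraMap
  rw [← hz, ← map_pow] at h1
  obtain ⟨i, hi, j, hj, k, hk, l, hl, r, hr⟩ := exists_selmer_form hunit hp
    (x := a * b) (fun h0 ↦ mul_ne_zero ha0 hb0 (by rw [← map_mul, h0, map_zero]))
    (RingOfIntegers.coe_injective h1) (fun q hq hqx hqy ↦ by
      rcases hq.dvd_or_dvd hqx with hqa | hqb
      · have h2 : q ∣ B * b ^ 2 := by
          rw [show a ^ 2 + A * a * b + B * b ^ 2 = a * (a + A * b) + B * b ^ 2 by ring] at hqy
          exact (dvd_add_right (hqa.mul_right _)).1 hqy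
        rcases hq.dvd_or_dvd h2 with h3 | h3
        · exact hq.dvd_of_dvd_pow (h3.trans hB'.symm.dvd)
        · exact (hq.not_isUnit (hab hqa (hq.dvd_of_dvd_pow h3))).elim
      · rw [show a ^ 2 + A * a * b + B * b ^ 2 = b * (A * a + B * b) + a ^ 2 by ring] at hqy
        have h3 := (dvd_add_right (hqb.mul_right _)).1 hqy
        exact (hq.not_isUnit (hab (hq.dvd_of_dvd_pow h3) hqb)).elim)
  refine ⟨i, hi, j, hj, k, hk, l, hl, r / algebraMap (𝓞 K) K b, ?_⟩
  rw [map_mul] at hr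
  rw [div_pow, ← mul_div_assoc, ← hr]
  field_simp

theorem factor_of_quartic (hunit : ∀ u : (𝓞 K)ˣ, ∃ i < 2, ∃ j < 2, ∃ k < 2, ∃ w : 𝓞 K, IsUnit w ∧
      u = (-1) ^ i * t ^ j * (2 + 3 * t + t ^ 2 + t ^ 3) ^ k * w ^ 2) [IsPrincipalIdealRing (𝓞 K)]
    (ht : t ^ 4 + 2 * t ^ 2 = 1) (hp : Prime (1 - t)) {a b c : ℤ} {e : K} (he : e = 1 ∨ e = -1)
    (hab : IsCoprime a b) (hc : c ≠ 0) (h : -a ^ 8 + 2 * a ^ 4 * b ^ 2 + b ^ 4 = 2 * c ^ 2) :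
    ∃ i < 2, ∃ j < 2, ∃ k < 2, ∃ l < 2, ∃ r : K, b - e * t * a ^ 2 =
      (-1) ^ i * (t : K) ^ j * (2 + 3 * t + t ^ 2 + t ^ 3) ^ k * (1 - t) ^ l * r ^ 2 := by
  obtain ⟨e, rfl, he2, heu⟩ : ∃ f : 𝓞 K, algebraMap (𝓞 K) K f = e ∧ f ^ 2 = 1 ∧ IsUnit f := by
    rcases he with rfl | rfl
    exacts [⟨1, by simp, by simp, isUnit_one⟩, ⟨-1, by simp, by simp, isUnit_one.neg⟩]
  have h' : -(a : 𝓞 K) ^ 8 + 2 * a ^ 4 * b ^ 2 + b ^ 4 = 2 * c ^ 2 := by exact_mod_cast h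
  have hprod : (b - e * t * a ^ 2) * ((b + e * t * a ^ 2) * (b ^ 2 + (t ^ 2 + 2) * a ^ 4)) =
      ((1 + t ^ 2) * (c : 𝓞 K)) ^ 2 := by
    linear_combination h' - (a : 𝓞 K) ^ 4 * t ^ 2 * (b ^ 2 + (t ^ 2 + 2) * a ^ 4) * he2 -
      ((a : 𝓞 K) ^ 8 + c ^ 2) * ht
  have hx : (b - e * t * a ^ 2 : 𝓞 K) ≠ 0 := by
    intro h0
    rw [h0, zero_mul] at hprod
    have h1 : (1 + t ^ 2) ^ 2 = 2 := by linear_combination ht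
    rw [mul_pow, h1] at hprod
    have : (c : 𝓞 K) ≠ 0 := by exact_mod_cast hc
    simp_all
  have := exists_selmer_form hunit hp hx hprod fun q hq hqx hqy ↦ by
    have h2 : q ∣ 2 * (e * t) * (2 * (1 + t ^ 2)) * a ^ 6 := by
      refine (dvd_sub hqy (hqx.mul_right (b ^ 2 + b * (e * t * a ^ 2) + (e * t * a ^ 2) ^ 2 +
        e * t * a ^ 2 * (b + e * t * a ^ 2) + (t ^ 2 + 2) * a ^ 4))).trans (dvd_of_eq ?_)
      linear_combination 2 * e * t ^ 3 * (a : 𝓞 K) ^ 6 * he2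
    have h3 : q ∣ 2 → q ∣ 1 - t := fun h3 ↦
      hq.dvd_of_dvd_pow (h3.trans (associated_two_of_quartic ht).symm.dvd)
    have hunit' : ¬q ∣ e * t := fun h4 ↦
      hq.not_isUnit (isUnit_of_dvd_unit h4 (heu.mul (isUnit_of_quartic ht)))
    rcases hq.dvd_or_dvd h2 with h4 | h4
    · rcases hq.dvd_or_dvd h4 with h5 | h5
      · exact h3 ((hq.dvd_or_dvd h5).resolve_right hunit')
      · refine (hq.dvd_or_dvd h5).elim h3 fun h6 ↦ h3 ?_
        exact (h6.trans (Dvd.intro (1 + t ^ 2) (by linear_combination ht)))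
    · have h5 := hq.dvd_of_dvd_pow h4
      have h6 : q ∣ b := by
        refine (dvd_sub_left (b := (b : 𝓞 K)) ?_).1 hqx
        exact (h5.trans (dvd_pow_self _ two_ne_zero)).mul_left _
      have hcop : IsCoprime (a : 𝓞 K) b := hab.intCast
      exact (hq.not_isUnit (hcop.isUnit_of_dvd' h5 h6)).elim
  simpa using this

end NumberField

theorem exists_quarticData : ∃ (K : Type) (_ : Field K), Nonempty (QuarticData K) := by
  obtain ⟨K, _, _, θ, σ₁, σ₂, τ, hK, h, h₁, h₂, hτ⟩ := exists_quartic_field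
  have hplaces := NumberField.nrRealPlaces_eq_two_and_nrComplexPlaces_eq_one hK σ₁ τ hτ
  obtain ⟨t, rfl⟩ : ∃ t : NumberField.RingOfIntegers K, (t : K) = θ :=
    ⟨⟨θ, NumberField.isIntegral_of_quartic h⟩, rfl⟩
  have ht : t ^ 4 + 2 * t ^ 2 = 1 := NumberField.RingOfIntegers.coe_injective (by
    simpa only [map_mul, map_add, map_pow, map_one, map_ofNat] using h)
  have hp := NumberField.prime_one_sub hK ht
  have := NumberField.isPrincipalIdealRing_of_quartic hK ht hplaces.2
  have hr : NumberField.Units.rank K = 2 := by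
    rw [NumberField.Units.rank,
      NumberField.InfinitePlace.card_eq_nrRealPlaces_add_nrComplexPlaces, hplaces.1, hplaces.2]
  have hunit := NumberField.exists_unit_eq hK ht hr σ₁ σ₂ h₁ h₂
  obtain ⟨v, hv, hv'⟩ := NumberField.exists_valuation hK ht
  exact ⟨K, _, ⟨{
    θ := t
    θ_eq := h
    v := v
    v_uniformizer := hv
    v_sub_one := hv'
    σ₁ := σ₁
    σ₂ := σ₂
    σ₁_pos := h₁
    σ₂_neg := h₂
    selmer := fun _ _ _ _ _ _ _ hA hε hx h ↦
      NumberField.selmer_of_quartic hunit ht hp hA hε hx h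
    factor := fun _ _ _ _ he hab hc h ↦
      NumberField.factor_of_quartic hunit ht hp he hab hc h }⟩⟩

/-- If `a, b, c` are positive integers with `a, b` odd and `gcd (a, b) = 1`
satisfying `−a⁸ + 2a⁴b² + b⁴ = 2c²`, then `(a, b) = (1, 1)` or `(a, b) = (1, 3)`. -/
theorem diophantine_eq1 (a b c : ℤ) (ha : 0 < a) (hb : 0 < b) (hc : 0 < c)
    (hao : Odd a) (hbo : Odd b) (hcop : IsCoprime a b)
    (h : -a ^ 8 + 2 * a ^ 4 * b ^ 2 + b ^ 4 = 2 * c ^ 2) :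
    (a = 1 ∧ b = 1) ∨ (a = 1 ∧ b = 3) := by
  obtain ⟨_, _, ⟨D⟩⟩ := exists_quarticData
  exact D.solutions ha hao hbo hb hc.ne' hcop h
end

section
/- Let a, b, c be positive integers with a and b odd and gcd(a,b) = 1. If −a^8 − 2a^4b^2 + b^4 = −2c^2, then (a,b) = (1,1). -/
namespace ZsqrtTwo

theorem norm_eq_zero_iff (x : ℤ√2) : x.norm = 0 ↔ x = 0 := by
  refine Zsqrtd.norm_eq_zero (fun n h => ?_) x
  have h1 : n < 2 := by nlinarith
  have h2 : -2 < n := by nlinarith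
  interval_cases n <;> omega

instance : NoZeroDivisors (ℤ√2) where
  eq_zero_or_eq_zero_of_mul_eq_zero {x y} h := by
    have : x.norm * y.norm = 0 := by rw [← Zsqrtd.norm_mul, h, Zsqrtd.norm_zero]
    simpa [norm_eq_zero_iff] using this

instance : IsDomain (ℤ√2) := NoZeroDivisors.to_isDomain _

theorem exists_two_mul_abs_sub_le (a : ℤ) {n : ℤ} (hn : n ≠ 0) :
    ∃ q : ℤ, 4 * (a - q * n) ^ 2 ≤ n ^ 2 := by
  refine ⟨round ((a : ℚ) / n), ?_⟩
  have h := abs_sub_round ((a : ℚ) / n)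
  have hn' : (n : ℚ) ≠ 0 := by exact_mod_cast hn
  have h2 : ((a : ℚ) / n - round ((a : ℚ) / n)) ^ 2 ≤ (1 / 2) ^ 2 :=
    sq_le_sq' (by linarith [neg_abs_le ((a : ℚ) / n - round ((a : ℚ) / n))])
      ((le_abs_self _).trans h)
  have h3 : (a : ℚ) - round ((a : ℚ) / n) * n = ((a : ℚ) / n - round ((a : ℚ) / n)) * n := by
    field_simp
  have : 4 * ((a : ℚ) - round ((a : ℚ) / n) * n) ^ 2 ≤ (n : ℚ) ^ 2 := by
    rw [h3, mul_pow]
    nlinarith [sq_nonneg (n : ℚ)]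
  exact_mod_cast this

theorem exists_norm_sub_mul_lt (x : ℤ√2) {y : ℤ√2} (hy : y ≠ 0) :
    ∃ q : ℤ√2, (x - q * y).norm.natAbs < y.norm.natAbs := by
  have hn : y.norm ≠ 0 := (norm_eq_zero_iff y).not.mpr hy
  obtain ⟨q₁, h₁⟩ := exists_two_mul_abs_sub_le (x * star y).re hn
  obtain ⟨q₂, h₂⟩ := exists_two_mul_abs_sub_le (x * star y).im hn
  refine ⟨⟨q₁, q₂⟩, ?_⟩
  set r := x - ⟨q₁, q₂⟩ * y with hr
  have key : r.norm * y.norm = ((x * star y).re - q₁ * y.norm) ^ 2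
      - 2 * ((x * star y).im - q₂ * y.norm) ^ 2 := by
    simp only [hr, Zsqrtd.norm_def, Zsqrtd.re_sub, Zsqrtd.im_sub, Zsqrtd.re_mul, Zsqrtd.im_mul,
      Zsqrtd.re_star, Zsqrtd.im_star]
    ring
  have hpos : 0 < |y.norm| := abs_pos.mpr hn
  have hlt : |r.norm| * |y.norm| < |y.norm| * |y.norm| := by
    rw [← abs_mul, key, abs_mul_abs_self, abs_lt]
    constructor <;> nlinarith [sq_nonneg ((x * star y).re - q₁ * y.norm),
      sq_nonneg ((x * star y).im - q₂ * y.norm), mul_self_pos.mpr hn]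
  have := lt_of_mul_lt_mul_right hlt hpos.le
  rw [Int.abs_eq_natAbs, Int.abs_eq_natAbs] at this
  exact_mod_cast this

instance : IsPrincipalIdealRing (ℤ√2) where
  principal I := by
    by_cases hI : I = ⊥
    · exact ⟨0, by simp [hI]⟩
    obtain ⟨y₀, hy₀, hy₀0⟩ := Submodule.exists_mem_ne_zero_of_ne_bot hI
    obtain ⟨y, ⟨hyI, hy⟩, hmin⟩ := WellFounded.has_min
      (measure (fun z : ℤ√2 => z.norm.natAbs)).wf {z | z ∈ I ∧ z ≠ 0} ⟨y₀, hy₀, hy₀0⟩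
    refine ⟨y, le_antisymm (fun x hx => ?_) ?_⟩
    · obtain ⟨q, hq⟩ := exists_norm_sub_mul_lt x hy
      have hmem : x - q * y ∈ I := I.sub_mem hx (I.mul_mem_left q hyI)
      have : x - q * y = 0 := by
        by_contra h
        exact hmin _ ⟨hmem, h⟩ hq
      exact Ideal.mem_span_singleton'.mpr ⟨q, (sub_eq_zero.mp this).symm⟩
    · exact (Ideal.span_singleton_le_iff_mem I).mpr hyI

/-- The square root of two in `ℤ[√2]`. -/
abbrev rt : ℤ√2 := Zsqrtd.sqrtd

theorem rt_sq : rt ^ 2 = 2 := by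
  rw [sq, Zsqrtd.dmuld]; rfl

theorem rt_dvd_iff (x : ℤ√2) : rt ∣ x ↔ Even x.re := by
  constructor
  · rintro ⟨y, rfl⟩
    simp [Zsqrtd.re_mul, rt]
  · rintro ⟨k, hk⟩
    exact ⟨⟨x.im, k⟩, by ext <;> simp [rt, hk, two_mul]⟩

theorem not_rt_dvd_iff (x : ℤ√2) : ¬ rt ∣ x ↔ Odd x.re := by
  rw [rt_dvd_iff, Int.not_even_iff_odd]

theorem prime_rt : Prime rt := by
  refine ⟨fun h => ?_, fun h => ?_, fun x y h => ?_⟩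
  · simpa [rt] using congrArg Zsqrtd.im h
  · simpa [Zsqrtd.norm_def, rt] using (Zsqrtd.norm_eq_one_iff.mpr h)
  · simp only [rt_dvd_iff, Zsqrtd.re_mul] at h ⊢
    rw [mul_assoc, Int.even_add, Int.even_mul] at h
    simpa using h

theorem exists_sq_of_not_rt_dvd {x : ℤ√2} (hx : ¬ rt ∣ x) :
    ∃ t, x ^ 2 = 1 + 4 * t ∨ x ^ 2 = 3 + 2 * rt + 4 * t := by
  rw [not_rt_dvd_iff] at hx
  obtain ⟨a, b⟩ := x
  obtain ⟨k, hk⟩ := hx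
  simp only at hk
  subst hk
  have e : (⟨2 * k + 1, b⟩ : ℤ√2) = 2 * (k : ℤ√2) + 1 + b * rt := by
    ext <;> simp [rt]
  have h2 := rt_sq
  rcases Int.even_or_odd' b with ⟨c, rfl | rfl⟩
  · refine ⟨k ^ 2 + k + 2 * c ^ 2 + (2 * k + 1) * c * rt, Or.inl ?_⟩
    rw [e]; push_cast
    linear_combination (2 * (c : ℤ√2)) ^ 2 * h2
  · refine ⟨k ^ 2 + k + 2 * c ^ 2 + 2 * c + (2 * k * c + k + c) * rt, Or.inr ?_⟩
    rw [e]; push_cast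
    linear_combination (2 * (c : ℤ√2) + 1) ^ 2 * h2

theorem exists_sq_of_isUnit {u : ℤ√2} (hu : IsUnit u) :
    ∃ v w : ℤ√2, (v = 1 ∨ v = -1 ∨ v = 1 + rt ∨ v = -(1 + rt)) ∧ IsUnit w ∧ u = v * w ^ 2 := by
  have hε : (1 + rt) * (rt - 1) = 1 := by linear_combination rt_sq
  have hfund : Pell.IsFundamental (Pell.Solution₁.mk 3 2 (by norm_num) : Pell.Solution₁ 2) := by
    refine ⟨by simp, by simp, fun {b} hb => ?_⟩
    have hb' := b.prop
    simp only [Pell.Solution₁.x_mk]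
    by_contra! hlt
    have : b.x = 2 := by omega
    rw [this] at hb'
    omega
  let e : (ℤ√2)ˣ := ⟨1 + rt, rt - 1, hε, by rw [mul_comm]; exact hε⟩
  have he : (e : ℤ√2) = 1 + rt := rfl
  have hnorm_one : ∀ x : ℤ√2, x.norm = 1 → ∃ w : ℤ√2, IsUnit w ∧ (x = w ^ 2 ∨ x = -w ^ 2) := by
    intro x hx
    let s : Pell.Solution₁ 2 := Pell.Solution₁.mk x.re x.im (by
      rw [Zsqrtd.norm_def] at hx; linarith)
    have hs : (s : ℤ√2) = x := rfl
    obtain ⟨n, hn⟩ := hfund.eq_zpow_or_neg_zpow s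
    let f : Pell.Solution₁ 2 →* (ℤ√2)ˣ := Unitary.toUnits
    have hbase : f (Pell.Solution₁.mk 3 2 (by norm_num)) = e ^ 2 := by
      ext1
      rw [Units.val_pow_eq_pow_val, he]
      have : (f (Pell.Solution₁.mk 3 2 (by norm_num)) : ℤ√2) = ⟨3, 2⟩ := rfl
      rw [this]
      ext <;> simp [sq, rt]
    have hpow : (((Pell.Solution₁.mk 3 2 (by norm_num) : Pell.Solution₁ 2) ^ n :
        Pell.Solution₁ 2) : ℤ√2) = ((e ^ n : (ℤ√2)ˣ) : ℤ√2) ^ 2 := by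
      have h1 := map_zpow f (Pell.Solution₁.mk 3 2 (by norm_num)) n
      rw [hbase] at h1
      have h2 := congrArg (Units.val) h1
      have h3 : (e ^ 2) ^ n = (e ^ n) ^ 2 := by
        rw [← zpow_natCast, ← zpow_natCast, ← zpow_mul, ← zpow_mul, mul_comm]
      rw [h3, Units.val_pow_eq_pow_val] at h2
      exact h2
    refine ⟨_, (e ^ n).isUnit, ?_⟩
    rcases hn with hn | hn
    · left; rw [← hs, hn, hpow]
    · right; rw [← hs, hn, ← hpow]; rfl
  have hn := Zsqrtd.norm_eq_one_iff.mpr hu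
  rcases Int.natAbs_eq u.norm with h | h <;> rw [hn] at h
  · obtain ⟨w, hw, h | h⟩ := hnorm_one u h
    · exact ⟨1, w, by simp, hw, by rw [h]; ring⟩
    · exact ⟨-1, w, by simp, hw, by rw [h]; ring⟩
  · have hr : (rt - 1).norm = -1 := by simp [Zsqrtd.norm_def, rt]
    obtain ⟨w, hw, h | h⟩ := hnorm_one (u * (rt - 1)) (by
      rw [Zsqrtd.norm_mul, h, hr]; norm_num)
    · exact ⟨1 + rt, w, by simp, hw, by rw [← h]; linear_combination -u * hε⟩
    · refine ⟨-(1 + rt), w, by simp, hw, ?_⟩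
      linear_combination (1 + rt) * h - u * hε

theorem exists_sq_of_isCoprime_mul_eq_sq {a b c : ℤ√2} (hab : IsCoprime a b)
    (h : a * b = c ^ 2) (ha : a ≠ 0) :
    ∃ v x y : ℤ√2, (v = 1 ∨ v = -1 ∨ v = 1 + rt ∨ v = -(1 + rt)) ∧
      a = v * x ^ 2 ∧ v * b = y ^ 2 ∧ c = x * y := by
  obtain ⟨d, u, hu⟩ := exists_associated_pow_of_mul_eq_pow' hab h
  obtain ⟨v, w, hv, -, huv⟩ := exists_sq_of_isUnit u.isUnit
  have hax : a = v * (d * w) ^ 2 := by rw [← hu, huv]; ring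
  have hx : d * w ≠ 0 := by
    intro h0
    rw [h0] at hax
    exact ha (by simpa using hax)
  have hdvd : (d * w) ^ 2 ∣ c ^ 2 := ⟨v * b, by rw [← h, hax]; ring⟩
  obtain ⟨y, rfl⟩ := (IsIntegrallyClosed.pow_dvd_pow_iff two_ne_zero).mp hdvd
  refine ⟨v, d * w, y, hv, hax, ?_, rfl⟩
  refine mul_left_cancel₀ (pow_ne_zero 2 hx) ?_
  rw [hax] at h
  linear_combination h

theorem isUnit_one_add_rt : IsUnit (1 + rt) :=
  isUnit_iff_exists_inv.mpr ⟨rt - 1, by linear_combination rt_sq⟩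

theorem isUnit_of_eq {v : ℤ√2} (hv : v = 1 ∨ v = -1 ∨ v = 1 + rt ∨ v = -(1 + rt)) : IsUnit v := by
  rcases hv with rfl | rfl | rfl | rfl
  · exact isUnit_one
  · exact isUnit_one.neg
  · exact isUnit_one_add_rt
  · exact isUnit_one_add_rt.neg

theorem not_rt_dvd_of_isUnit {v : ℤ√2} (hv : IsUnit v) : ¬ rt ∣ v :=
  fun h => prime_rt.not_isUnit (isUnit_of_dvd_unit h hv)

theorem not_rt_dvd_add {x y : ℤ√2} (hx : ¬ rt ∣ x) (hy : rt ∣ y) : ¬ rt ∣ x + y :=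
  fun h => hx ((dvd_add_left hy).mp h)

theorem rt_dvd_add {x y : ℤ√2} (hx : ¬ rt ∣ x) (hy : ¬ rt ∣ y) : rt ∣ x + y := by
  rw [not_rt_dvd_iff] at hx hy
  rw [rt_dvd_iff, Zsqrtd.re_add]
  exact hx.add_odd hy

theorem rt_dvd_two : rt ∣ 2 := ⟨rt, by rw [← sq, rt_sq]⟩

theorem exists_eq_two_mul_of_sq_add_sq {x y z : ℤ√2} (hx : ¬ rt ∣ x) (hz : ¬ rt ∣ z)
    (h : x ^ 2 + y ^ 2 = z ^ 2) : ∃ w, y = 2 * w := by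
  have h2 := rt_sq
  obtain ⟨s, hs⟩ := exists_sq_of_not_rt_dvd hx
  obtain ⟨t, ht⟩ := exists_sq_of_not_rt_dvd hz
  have hy : rt ∣ y := by
    by_contra hy
    obtain ⟨r, hr⟩ := exists_sq_of_not_rt_dvd hy
    rcases hs with hs | hs <;> rcases ht with ht | ht <;> rcases hr with hr | hr <;>
    · rw [hs, ht, hr, Zsqrtd.ext_iff] at h
      simp [rt] at h
      omega
  obtain ⟨y₁, rfl⟩ := hy
  by_cases hy₁ : rt ∣ y₁
  · obtain ⟨w, rfl⟩ := hy₁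
    exact ⟨w, by linear_combination w * h2⟩
  · obtain ⟨r, hr⟩ := exists_sq_of_not_rt_dvd hy₁
    exfalso
    rw [mul_pow, h2] at h
    rcases hs with hs | hs <;> rcases ht with ht | ht <;> rcases hr with hr | hr <;>
    · rw [hs, ht, hr, Zsqrtd.ext_iff] at h
      simp [rt] at h
      omega

theorem two_dvd_add_of_two_dvd_mul {x z w : ℤ√2} (h : (z + x) * (z - x) = 2 ^ 2 * w) :
    ∃ a, z + x = 2 * a := by
  have h2 := rt_sq
  have h₁ : rt ∣ z + x := by
    have : rt ∣ (z + x) * (z - x) := by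
      rw [h]; exact Dvd.dvd.mul_right (dvd_pow rt_dvd_two two_ne_zero) _
    rcases prime_rt.dvd_or_dvd this with h' | h'
    · exact h'
    · have := dvd_add h' (rt_dvd_two.mul_right x)
      rwa [show z - x + 2 * x = z + x by ring] at this
  obtain ⟨a, ha⟩ := h₁
  have h₃ : a * (a - rt * x) = 2 * w := by
    refine mul_left_cancel₀ (two_ne_zero : (2 : ℤ√2) ≠ 0) ?_
    linear_combination h - (z - x) * ha - rt * a * ha - a ^ 2 * h2
  have h₄ : rt ∣ a := by
    have : rt ∣ a * (a - rt * x) := by rw [h₃]; exact rt_dvd_two.mul_right _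
    rcases prime_rt.dvd_or_dvd this with h' | h'
    · exact h'
    · exact (dvd_sub_left (dvd_mul_right rt x)).mp h'
  obtain ⟨b, rfl⟩ := h₄
  exact ⟨b, by linear_combination ha + b * h2⟩

theorem exists_of_sq_add_sq {x y z : ℤ√2} (hx : ¬ rt ∣ x) (hz : ¬ rt ∣ z) (hxz : IsCoprime x z)
    (h : x ^ 2 + y ^ 2 = z ^ 2) :
    ∃ v p q : ℤ√2, IsUnit v ∧ ¬ rt ∣ p ∧ IsCoprime p q ∧ x = v * (p ^ 2 - q ^ 2) ∧
      y = 2 * v * (p * q) ∧ (z = v * (p ^ 2 + q ^ 2) ∨ z = -(v * (p ^ 2 + q ^ 2))) := by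
  obtain ⟨y', rfl⟩ := exists_eq_two_mul_of_sq_add_sq hx hz h
  obtain ⟨a, ha⟩ := two_dvd_add_of_two_dvd_mul (x := x) (z := z) (w := y' ^ 2)
    (by linear_combination -h)
  obtain ⟨b, hb⟩ : ∃ b, b = z - a := ⟨_, rfl⟩
  have hz' : z = a + b := by linear_combination -hb
  have hx' : x = a - b := by linear_combination ha - hz'
  have hab : a * b = y' ^ 2 := by
    refine mul_left_cancel₀ (pow_ne_zero 2 two_ne_zero : (2 : ℤ√2) ^ 2 ≠ 0) ?_
    rw [hz', hx'] at h
    linear_combination -h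
  have hcop : IsCoprime a b := by
    obtain ⟨c, d, hcd⟩ := hxz
    exact ⟨c + d, d - c, by rw [← hcd, hz', hx']; ring⟩
  by_cases ha0 : a = 0
  · have hxu : IsUnit x := by
      have hzx : z = -x := by rw [hz', hx', ha0]; ring
      rw [hzx, IsCoprime.neg_right_iff] at hxz
      exact isCoprime_self.mp hxz
    have hy0 : y' = 0 := by
      rw [ha0, zero_mul] at hab
      exact pow_eq_zero_iff two_ne_zero |>.mp hab.symm
    refine ⟨x, 1, 0, hxu, fun h1 => prime_rt.not_isUnit (isUnit_of_dvd_one h1), isCoprime_one_left,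
      by ring, by rw [hy0]; ring, Or.inr ?_⟩
    rw [hz', hx', ha0]; ring
  obtain ⟨v, p, q, hv, hap, hbq, hy⟩ := exists_sq_of_isCoprime_mul_eq_sq hcop hab ha0
  have hvu := isUnit_of_eq hv
  obtain ⟨w, hw⟩ := isUnit_iff_exists_inv.mp hvu
  have hwu : IsUnit w := isUnit_iff_exists_inv.mpr ⟨v, by rw [mul_comm]; exact hw⟩
  have hpq : IsCoprime p q := by
    have h1 : IsCoprime a (v * b) := (isCoprime_mul_unit_left_right hvu a b).mpr hcop
    rw [hbq, hap] at h1
    exact (IsCoprime.pow_iff two_pos two_pos).mp h1.of_mul_left_right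
  have hb' : b = w * q ^ 2 := by linear_combination w * hbq - b * hw
  by_cases hp : rt ∣ p
  · have hq : ¬ rt ∣ q := by
      intro hq
      refine hx ?_
      rw [hx', hap, hb']
      exact dvd_sub ((dvd_pow hp two_ne_zero).mul_left _) ((dvd_pow hq two_ne_zero).mul_left _)
    refine ⟨-w, q, -(v * p), hwu.neg, hq, ?_, ?_, ?_, Or.inr ?_⟩
    · rw [IsCoprime.neg_right_iff]
      exact (isCoprime_mul_unit_left_right hvu q p).mpr hpq.symm
    · rw [hx', hap, hb']; linear_combination -(v * p ^ 2) * hw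
    · rw [hy]; linear_combination -2 * p * q * hw
    · rw [hz', hap, hb']; linear_combination -(v * p ^ 2) * hw
  · refine ⟨v, p, w * q, hvu, hp, ?_, ?_, ?_, Or.inl ?_⟩
    · exact (isCoprime_mul_unit_left_right hwu p q).mpr hpq
    · rw [hx', hap, hb']; linear_combination w * q ^ 2 * hw
    · rw [hy]; linear_combination -2 * p * q * hw
    · rw [hz', hap, hb']; linear_combination -w * q ^ 2 * hw

theorem exists_eq_one_add_two_mul_of_not_rt_dvd {x : ℤ√2} (hx : ¬ rt ∣ x) :
    ∃ t, x ^ 2 = 1 + 2 * t := by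
  obtain ⟨t, h | h⟩ := exists_sq_of_not_rt_dvd hx
  · exact ⟨2 * t, by rw [h]; ring⟩
  · exact ⟨1 + rt + 2 * t, by rw [h]; ring⟩

theorem eq_zero_of_sq_add_sq_add_sq {x y z : ℤ√2} (h : x ^ 2 + y ^ 2 + z ^ 2 = 0) : x = 0 := by
  have h1 := congrArg Zsqrtd.re h
  simp [sq, Zsqrtd.re_mul] at h1
  ext
  · simp only [Zsqrtd.re_zero]
    nlinarith [mul_self_nonneg x.re, mul_self_nonneg x.im, mul_self_nonneg y.re,
      mul_self_nonneg y.im, mul_self_nonneg z.re, mul_self_nonneg z.im]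
  · simp only [Zsqrtd.im_zero]
    nlinarith [mul_self_nonneg x.re, mul_self_nonneg x.im, mul_self_nonneg y.re,
      mul_self_nonneg y.im, mul_self_nonneg z.re, mul_self_nonneg z.im]

theorem exists_rt_pow_three_mul {X K y : ℤ√2} (h : X * (X - 2 * K) = rt ^ 5 * y) :
    ∃ x, X = rt ^ 3 * x ∨ X - 2 * K = rt ^ 3 * x := by
  have h2 := rt_sq
  have hrt0 : rt ≠ 0 := prime_rt.ne_zero
  obtain ⟨X₁, rfl⟩ : rt ∣ X := by
    have : rt ∣ X * (X - 2 * K) := by rw [h]; exact (dvd_pow_self _ (by norm_num)).mul_right _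
    rcases prime_rt.dvd_or_dvd this with h' | h'
    · exact h'
    · exact (dvd_sub_left (rt_dvd_two.mul_right K)).mp h'
  have h₁ : X₁ * (X₁ - rt * K) = rt ^ 3 * y := by
    refine mul_left_cancel₀ (pow_ne_zero 2 hrt0) ?_
    linear_combination h - rt * X₁ * K * h2
  obtain ⟨X₂, rfl⟩ : rt ∣ X₁ := by
    have : rt ∣ X₁ * (X₁ - rt * K) := by
      rw [h₁]; exact (dvd_pow_self _ (by norm_num)).mul_right _
    rcases prime_rt.dvd_or_dvd this with h' | h'
    · exact h'
    · exact (dvd_sub_left (dvd_mul_right rt K)).mp h'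
  have h₃ : X₂ * (X₂ - K) = rt * y := by
    refine mul_left_cancel₀ (pow_ne_zero 2 hrt0) ?_
    linear_combination h₁
  rcases prime_rt.dvd_or_dvd (Dvd.intro _ h₃.symm) with ⟨x, hx⟩ | ⟨x, hx⟩
  · exact ⟨x, Or.inl (by rw [hx]; ring)⟩
  · exact ⟨x, Or.inr (by linear_combination rt ^ 2 * hx + K * h2)⟩

theorem exists_sq_add_sq_of_sq_add_pow_four {h k τ : ℤ√2} (hh : ¬ rt ∣ h) (hk : ¬ rt ∣ k)
    (hhk : IsCoprime h k) (heq : τ ^ 2 + k ^ 4 = 2 * (2 + rt) * h ^ 4) :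
    ∃ S T : ℤ√2, ¬ rt ∣ S ∧ IsCoprime S (h ^ 2) ∧ S ^ 2 + T ^ 2 = (h ^ 2) ^ 2 ∧
      k ^ 2 = S + (1 + rt) * T := by
  have h2 := rt_sq
  obtain ⟨s, hs⟩ := exists_eq_one_add_two_mul_of_not_rt_dvd hh
  obtain ⟨t, ht⟩ := exists_eq_one_add_two_mul_of_not_rt_dvd hk
  have hprod : ((1 + rt) * τ + k ^ 2) * (((1 + rt) * τ + k ^ 2) - 2 * k ^ 2) =
      rt ^ 5 * ((1 + rt) *
      (1 + rt * ((1 + rt) * s - t)) * (1 + rt + rt * ((1 + rt) * s + t))) := by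
    have e1 : (1 + rt) * h ^ 2 - k ^ 2 = rt * (1 + rt * ((1 + rt) * s - t)) := by
      rw [hs, ht]; linear_combination -((1 + rt) * s - t) * h2
    have e2 : (1 + rt) * h ^ 2 + k ^ 2 = rt * (1 + rt + rt * ((1 + rt) * s + t)) := by
      rw [hs, ht]; linear_combination -(1 + (1 + rt) * s + t) * h2
    have e3 : ((1 + rt) * τ + k ^ 2) * (((1 + rt) * τ + k ^ 2) - 2 * k ^ 2) =
        rt ^ 3 * (1 + rt) * (((1 + rt) * h ^ 2 - k ^ 2) * ((1 + rt) * h ^ 2 + k ^ 2)) := by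
      have h3 : rt ^ 3 = 2 * rt := by linear_combination rt * h2
      rw [h3]
      linear_combination (1 + rt) ^ 2 * heq + (-k ^ 4 + 2 * k ^ 4 - 2 * (1 + rt) ^ 2 * h ^ 4) * h2
    rw [e3, e1, e2]; ring
  obtain ⟨τ', x, hτ', hx⟩ : ∃ τ' x, τ' ^ 2 = τ ^ 2 ∧ (1 + rt) * τ' + k ^ 2 = rt ^ 3 * x := by
    obtain ⟨x, hx | hx⟩ := exists_rt_pow_three_mul hprod
    · exact ⟨τ, x, rfl, hx⟩
    · exact ⟨-τ, -x, by ring, by linear_combination -hx⟩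
  rw [← hτ'] at heq
  obtain ⟨S, hS⟩ : ∃ S, S = (rt - 1) * x := ⟨_, rfl⟩
  obtain ⟨T, hT⟩ : ∃ T, T = (rt - 1) * (k ^ 2 - S) := ⟨_, rfl⟩
  have hK : k ^ 2 = S + (1 + rt) * T := by rw [hT]; linear_combination -(k ^ 2 - S) * h2
  have hSτ : (1 + rt) * τ' + k ^ 2 = 2 * (2 + rt) * S := by
    rw [hx, hS]; linear_combination (rt - 2) * x * h2
  have hST : S ^ 2 + T ^ 2 = (h ^ 2) ^ 2 := by
    have hτ : τ' = (1 + rt) * S - T := by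
      linear_combination (rt - 1) * hSτ - (rt - 1) * hK + (2 * S - T - τ') * h2
    refine mul_left_cancel₀ (?_ : 2 * (2 + rt) ≠ 0) ?_
    · rw [Ne, Zsqrtd.ext_iff]; simp [rt]
    · rw [hτ, show k ^ 4 = (k ^ 2) ^ 2 by ring, hK] at heq
      linear_combination heq - (S ^ 2 + T ^ 2) * h2
  have hcop : IsCoprime S (h ^ 2) := by
    have hh0 : h ≠ 0 := fun h0 => hh (h0 ▸ dvd_zero rt)
    refine isCoprime_of_prime_dvd (fun h0 => hh0 (pow_eq_zero_iff two_ne_zero |>.mp h0.2)) ?_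
    intro p hp hpS hph
    have hpT : p ∣ T := hp.dvd_of_dvd_pow (n := 2) <| by
      rw [show T ^ 2 = (h ^ 2) ^ 2 - S ^ 2 by linear_combination hST]
      exact dvd_sub (dvd_pow hph two_ne_zero) (dvd_pow hpS two_ne_zero)
    have hpk : p ∣ k := hp.dvd_of_dvd_pow (n := 2) <| by
      rw [hK]; exact dvd_add hpS (hpT.mul_left _)
    exact hp.not_isUnit (hhk.isUnit_of_dvd' (hp.dvd_of_dvd_pow hph) hpk)
  refine ⟨S, T, fun hSe => ?_, hcop, hST, hK⟩
  have hTo : ¬ rt ∣ T := fun hTe => hh <| prime_rt.dvd_of_dvd_pow (n := 2) <|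
    prime_rt.dvd_of_dvd_pow (n := 2) <| by
      rw [← hST]; exact dvd_add (dvd_pow hSe two_ne_zero) (dvd_pow hTe two_ne_zero)
  obtain ⟨w, rfl⟩ := exists_eq_two_mul_of_sq_add_sq (x := T) (y := S) (z := h ^ 2) hTo
    (fun h' => hh (prime_rt.dvd_of_dvd_pow h')) (by rw [← hST, add_comm])
  rw [not_rt_dvd_iff] at hTo
  have him := congrArg Zsqrtd.im hK
  rw [ht] at him
  have hsq : T ^ 2 = 1 + 4 * (s + s ^ 2 - w ^ 2) := by rw [hs] at hST; linear_combination hST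
  have hsq' := congrArg Zsqrtd.im hsq
  obtain ⟨j, hj⟩ := hTo
  simp [sq, rt, hj] at him hsq'
  have : 2 ∣ T.im := by
    have h' : 2 ∣ (2 * j + 1) * T.im := by
      exact ⟨s.im + (s.re * s.im + s.im * s.re) - (w.re * w.im + w.im * w.re), by linarith⟩
    exact (Int.isCoprime_iff_gcd_eq_one.mpr (by simp)).dvd_of_dvd_mul_left h'
  omega

theorem exists_sq_sub_sq_of_sq_add_sq {h k S T : ℤ√2} (hh : ¬ rt ∣ h) (hk : ¬ rt ∣ k)
    (hS : ¬ rt ∣ S) (hSh : IsCoprime S (h ^ 2)) (hST : S ^ 2 + T ^ 2 = (h ^ 2) ^ 2)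
    (hK : k ^ 2 = S + (1 + rt) * T) :
    ∃ p q : ℤ√2, ¬ rt ∣ p ∧ IsCoprime p h ∧ p ^ 2 + q ^ 2 = h ^ 2 ∧
      k ^ 2 = p ^ 2 - q ^ 2 + 2 * (1 + rt) * (p * q) := by
  have h2 := rt_sq
  have hh2 : ¬ rt ∣ h ^ 2 := fun h' => hh (prime_rt.dvd_of_dvd_pow h')
  obtain ⟨v', p', q', hv', hp', hpq', hSe', hTe', hHe'⟩ := exists_of_sq_add_sq hS hh2 hSh hST
  obtain ⟨v, w, hv, hw, rfl⟩ := exists_sq_of_isUnit hv'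
  obtain ⟨p, hpe⟩ : ∃ p, p = w * p' := ⟨_, rfl⟩
  obtain ⟨q, hqe⟩ : ∃ q, q = w * q' := ⟨_, rfl⟩
  have hSe : S = v * (p ^ 2 - q ^ 2) := by rw [hSe', hpe, hqe]; ring
  have hTe : T = 2 * v * (p * q) := by rw [hTe', hpe, hqe]; ring
  have hHe : h ^ 2 = v * (p ^ 2 + q ^ 2) ∨ h ^ 2 = -(v * (p ^ 2 + q ^ 2)) := by
    rw [hpe, hqe]
    exact hHe'.imp (fun e => by rw [e]; ring) (fun e => by rw [e]; ring)
  have hp : ¬ rt ∣ p := fun h' => by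
    rcases prime_rt.dvd_or_dvd (hpe ▸ h') with h' | h'
    · exact not_rt_dvd_of_isUnit hw h'
    · exact hp' h'
  have hpq : IsCoprime p q := by
    rw [hpe, hqe]
    exact (isCoprime_mul_unit_left hw p' q').mpr hpq'
  have hk' : k ^ 2 = v * (p ^ 2 - q ^ 2 + 2 * (1 + rt) * (p * q)) := by
    rw [hK, hSe, hTe]; ring
  obtain ⟨q₁, hq₁⟩ : rt ∣ q := by
    by_contra hq
    refine hS (hSe ▸ Dvd.dvd.mul_left ?_ v)
    rw [show p ^ 2 - q ^ 2 = (p + q) * (p - q) by ring]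
    exact (rt_dvd_add hp hq).mul_right _
  obtain ⟨s, hs⟩ := exists_eq_one_add_two_mul_of_not_rt_dvd hp
  obtain ⟨t, ht⟩ := exists_eq_one_add_two_mul_of_not_rt_dvd hk
  have hmod : 1 + 2 * t = v + 2 * (v * (s - q₁ ^ 2 + (1 + rt) * (p * q))) := by
    rw [← ht, hk', hs]
    nth_rewrite 1 [hq₁]
    linear_combination -v * q₁ ^ 2 * h2
  have hv1 : v = 1 ∨ v = -1 := by
    rcases hv with hv | hv | hv | hv
    · exact Or.inl hv
    · exact Or.inr hv
    all_goals
      exfalso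
      generalize v * (s - q₁ ^ 2 + (1 + rt) * (p * q)) = e at hmod
      rw [hv] at hmod
      have := congrArg Zsqrtd.im hmod
      simp [rt] at this
      omega
  have hpqh : p ^ 2 + q ^ 2 = h ^ 2 := by
    have hh0 : h ≠ 0 := fun h0 => hh (h0 ▸ dvd_zero rt)
    have hneg : h ^ 2 ≠ -(p ^ 2 + q ^ 2) := fun h' =>
      hh0 (eq_zero_of_sq_add_sq_add_sq (by linear_combination h' : h ^ 2 + p ^ 2 + q ^ 2 = 0))
    rcases hv1 with rfl | rfl <;> rcases hHe with h' | h'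
    · rw [h', one_mul]
    · rw [one_mul] at h'; exact absurd h' hneg
    · rw [neg_one_mul] at h'; exact absurd h' hneg
    · rw [h']; ring
  obtain ⟨q₂, rfl⟩ := exists_eq_two_mul_of_sq_add_sq hp hh hpqh
  refine ⟨p, 2 * q₂, hp, ?_, hpqh, ?_⟩
  · have : IsCoprime p (h ^ 2) := by
      rw [← hpqh, sq p]
      exact (IsCoprime.mul_add_left_right_iff).mpr hpq.pow_right
    exact (IsCoprime.pow_right_iff two_pos).mp this
  · rcases hv1 with rfl | rfl
    · rw [hk', one_mul]
    · exfalso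
      have hmod4 : k ^ 2 + p ^ 2 = 4 * (q₂ ^ 2 - (1 + rt) * (p * q₂)) := by
        rw [hk']; ring
      generalize q₂ ^ 2 - (1 + rt) * (p * q₂) = e at hmod4
      obtain ⟨r, hr⟩ := exists_sq_of_not_rt_dvd hp
      obtain ⟨r', hr'⟩ := exists_sq_of_not_rt_dvd hk
      rcases hr with hr | hr <;> rcases hr' with hr' | hr' <;>
      · rw [hr, hr', Zsqrtd.ext_iff] at hmod4
        simp [rt] at hmod4
        omega

/-- Points of `τ² + k⁴ = 2(2+√2)h⁴` with odd coordinates come from points of a quartic curve. -/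
theorem exists_quartic_of_sq_add_pow_four {h k τ : ℤ√2} (hh : ¬ rt ∣ h) (hk : ¬ rt ∣ k)
    (hhk : IsCoprime h k) (heq : τ ^ 2 + k ^ 4 = 2 * (2 + rt) * h ^ 4) :
    ∃ u m n α : ℤ√2, IsUnit u ∧ ¬ rt ∣ m ∧ IsCoprime m n ∧
      α ^ 2 = m ^ 4 + 4 * (2 + rt) * m ^ 3 * n - 12 * m ^ 2 * n ^ 2 - 8 * (2 + rt) * m * n ^ 3
        + 4 * n ^ 4 ∧ k = u * α ∧ h ^ 2 = (u * (m ^ 2 + 2 * n ^ 2)) ^ 2 := by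
  have h2 := rt_sq
  obtain ⟨S, T, hS, hSh, hST, hK⟩ := exists_sq_add_sq_of_sq_add_pow_four hh hk hhk heq
  obtain ⟨p, q, hp, hph, hpq, hk2⟩ := exists_sq_sub_sq_of_sq_add_sq hh hk hS hSh hST hK
  obtain ⟨u, m, n', hu, hm, hmn, rfl, rfl, hhe⟩ := exists_of_sq_add_sq hp hh hph hpq
  obtain ⟨n, rfl⟩ : rt ∣ n' := by
    by_contra hn
    refine hp (Dvd.dvd.mul_left ?_ u)
    rw [show m ^ 2 - n' ^ 2 = (m + n') * (m - n') by ring]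
    exact (rt_dvd_add hm hn).mul_right _
  obtain ⟨w, hw⟩ := isUnit_iff_exists_inv.mp hu
  refine ⟨u, m, n, w * k, hu, hm, hmn.of_mul_right_right, ?_, ?_, ?_⟩
  · have hw2 : w ^ 2 * u ^ 2 = 1 := by rw [← mul_pow, mul_comm, hw, one_pow]
    have hn4 : rt ^ 4 = 4 := by rw [show rt ^ 4 = (rt ^ 2) ^ 2 by ring, h2]; norm_num
    have hn3 : rt ^ 3 = 2 * rt := by linear_combination rt * h2
    have hkq : k ^ 2 = u ^ 2 * (m ^ 4 + 4 * (2 + rt) * m ^ 3 * n - 12 * m ^ 2 * n ^ 2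
        - 8 * (2 + rt) * m * n ^ 3 + 4 * n ^ 4) := by
      rw [hk2]
      linear_combination u ^ 2 * n ^ 4 * hn4 - 4 * u ^ 2 * m * n ^ 3 * (1 + rt) * hn3 + u ^ 2 *
        (4 * m ^ 3 * n - 6 * m ^ 2 * n ^ 2 - 8 * m * n ^ 3) * h2
    rw [mul_pow, hkq, ← mul_assoc, hw2, one_mul]
  · rw [← mul_assoc, hw, one_mul]
  · rcases hhe with e | e
    · rw [e]; linear_combination (u ^ 2 * n ^ 2) * (2 * m ^ 2 + rt ^ 2 * n ^ 2 + 2 * n ^ 2) * h2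
    · rw [e]; linear_combination (u ^ 2 * n ^ 2) * (2 * m ^ 2 + rt ^ 2 * n ^ 2 + 2 * n ^ 2) * h2

theorem exists_add_eq_and_mul_eq {m n α : ℤ√2} (hm : ¬ rt ∣ m)
    (hα : α ^ 2 = m ^ 4 + 4 * (2 + rt) * m ^ 3 * n - 12 * m ^ 2 * n ^ 2
      - 8 * (2 + rt) * m * n ^ 3 + 4 * n ^ 4) :
    ∃ X Y : ℤ√2, ¬ rt ∣ X ∧ X + 4 * (2 + rt) * Y = m ^ 2 + 2 * (2 + rt) * m * n - 2 * n ^ 2 ∧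
      X * Y = (m * n) ^ 2 := by
  have h2 := rt_sq
  have hB : (m ^ 2 + 2 * (2 + rt) * m * n - 2 * n ^ 2 + α) *
      (m ^ 2 + 2 * (2 + rt) * m * n - 2 * n ^ 2 - α) = 2 ^ 2 * (4 * (2 + rt) * (m * n) ^ 2) := by
    linear_combination 4 * m ^ 2 * n ^ 2 * h2 - hα
  obtain ⟨a, ha⟩ := two_dvd_add_of_two_dvd_mul hB
  have hprod : a * (a - α) = 4 * (2 + rt) * (m * n) ^ 2 := by
    refine mul_left_cancel₀ (pow_ne_zero 2 two_ne_zero : (2 : ℤ√2) ^ 2 ≠ 0) ?_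
    rw [← hB, show m ^ 2 + 2 * (2 + rt) * m * n - 2 * n ^ 2 - α = 2 * a - 2 * α by
      linear_combination ha, ha]
    ring
  have hodd : ¬ rt ∣ m ^ 2 + 2 * (2 + rt) * m * n - 2 * n ^ 2 := by
    rw [show m ^ 2 + 2 * (2 + rt) * m * n - 2 * n ^ 2 = m ^ 2 + 2 * ((2 + rt) * m * n - n ^ 2) by
      ring]
    exact not_rt_dvd_add (fun h' => hm (prime_rt.dvd_of_dvd_pow h')) (rt_dvd_two.mul_right _)
  obtain ⟨X, Y, hX, hXY, hXY'⟩ : ∃ X Y, ¬ rt ∣ X ∧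
      X + Y = m ^ 2 + 2 * (2 + rt) * m * n - 2 * n ^ 2 ∧
      X * Y = 4 * (2 + rt) * (m * n) ^ 2 := by
    by_cases hae : rt ∣ a
    · refine ⟨a - α, a, fun h' => hodd ?_, by linear_combination -ha, by rw [← hprod, mul_comm]⟩
      rw [show m ^ 2 + 2 * (2 + rt) * m * n - 2 * n ^ 2 = (a - α) + a by linear_combination ha]
      exact dvd_add h' hae
    · exact ⟨a, a - α, hae, by linear_combination -ha, hprod⟩
  have hdvd : rt ^ 5 ∣ X * Y := ⟨(1 + rt) * (m * n) ^ 2, by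
    rw [hXY']
    linear_combination -(m * n) ^ 2 * (1 + rt) * rt * (rt ^ 2 + 2) * h2 - 4 * (m * n) ^ 2 * h2⟩
  obtain ⟨Y₁, rfl⟩ := prime_rt.pow_dvd_of_dvd_mul_left 5 hX hdvd
  have h5 : rt ^ 5 = 4 * rt := by linear_combination rt * (rt ^ 2 + 2) * h2
  refine ⟨X, (rt - 1) * Y₁, hX, ?_, ?_⟩
  · rw [← hXY, h5]; linear_combination 4 * Y₁ * h2
  · have hXY₁ : X * Y₁ = (1 + rt) * (m * n) ^ 2 := by
      refine mul_left_cancel₀ (pow_ne_zero 5 prime_rt.ne_zero) ?_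
      rw [mul_left_comm, hXY', h5]
      linear_combination -4 * (m * n) ^ 2 * h2
    linear_combination (rt - 1) * hXY₁ + (m * n) ^ 2 * h2

theorem exists_factor_of_quartic {m n α : ℤ√2} (hm : ¬ rt ∣ m) (hmn : IsCoprime m n)
    (hα : α ^ 2 = m ^ 4 + 4 * (2 + rt) * m ^ 3 * n - 12 * m ^ 2 * n ^ 2
      - 8 * (2 + rt) * m * n ^ 3 + 4 * n ^ 4) :
    ∃ g h k l : ℤ√2, ¬ rt ∣ g ∧ ¬ rt ∣ h ∧ ¬ rt ∣ k ∧ IsCoprime h k ∧ n = k * l ∧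
      g ^ 2 * (h ^ 2 - k ^ 2) + 2 * (2 + rt) * (g * h * k * l)
        = 2 * l ^ 2 * (k ^ 2 + 2 * (2 + rt) * h ^ 2) := by
  have h2 := rt_sq
  obtain ⟨X, Y, hX, hXY, hprod⟩ := exists_add_eq_and_mul_eq hm hα
  have hX0 : X ≠ 0 := fun h0 => hX (h0 ▸ dvd_zero rt)
  have hcop : IsCoprime X Y := by
    refine isCoprime_of_prime_dvd (fun h0 => hX0 h0.1) fun p hp hpX hpY => ?_
    have hpB : p ∣ m ^ 2 + 2 * (2 + rt) * m * n - 2 * n ^ 2 := by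
      rw [← hXY]; exact dvd_add hpX (hpY.mul_left _)
    have hpmn : p ∣ m * n := hp.dvd_of_dvd_pow (n := 2) (hprod ▸ hpX.mul_right Y)
    rcases hp.dvd_or_dvd hpmn with hpm | hpn
    · have h' : p ∣ rt ^ 2 * n ^ 2 := by
        rw [show rt ^ 2 * n ^ 2 = m * (m + 2 * (2 + rt) * n)
          - (m ^ 2 + 2 * (2 + rt) * m * n - 2 * n ^ 2) by linear_combination n ^ 2 * h2]
        exact dvd_sub (hpm.mul_right _) hpB
      rcases hp.dvd_or_dvd h' with h' | h'
      · exact hX ((hp.irreducible.dvd_symm prime_rt.irreducible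
          (hp.dvd_of_dvd_pow h')).trans hpX)
      · exact hp.not_isUnit (hmn.isUnit_of_dvd' hpm (hp.dvd_of_dvd_pow h'))
    · have h' : p ∣ m ^ 2 := by
        rw [show m ^ 2 = (m ^ 2 + 2 * (2 + rt) * m * n - 2 * n ^ 2)
          - n * (2 * (2 + rt) * m - 2 * n) by ring]
        exact dvd_sub hpB (hpn.mul_right _)
      exact hp.not_isUnit (hmn.isUnit_of_dvd' (hp.dvd_of_dvd_pow h') hpn)
  obtain ⟨v, r, s, hv, rfl, hY, hrs⟩ := exists_sq_of_isCoprime_mul_eq_sq hcop hprod hX0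
  have hr : ¬ rt ∣ r := fun h' => hX ((dvd_pow h' two_ne_zero).mul_left v)
  obtain rfl : v = 1 := by
    rcases hv with hv | hv | hv | hv
    · exact hv
    · exfalso
      rw [hv] at hXY
      have hmod : m ^ 2 + r ^ 2 + (4 + 2 * rt) * (m * n) - 2 * n ^ 2 = 4 * ((2 + rt) * Y) := by
        linear_combination -hXY
      obtain ⟨x, hx⟩ := exists_sq_of_not_rt_dvd hm
      obtain ⟨y, hy⟩ := exists_sq_of_not_rt_dvd hr
      generalize (2 + rt) * Y = e at hmod
      by_cases hn : rt ∣ n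
      · obtain ⟨n₁, rfl⟩ := hn
        have hmod' : m ^ 2 + r ^ 2 = 4 * (e - (1 + rt) * (m * n₁) + n₁ ^ 2) := by
          linear_combination hmod + (2 * n₁ ^ 2 - 2 * m * n₁) * h2
        generalize e - (1 + rt) * (m * n₁) + n₁ ^ 2 = e' at hmod'
        rcases hx with hx | hx <;> rcases hy with hy | hy <;>
        · rw [hx, hy, Zsqrtd.ext_iff] at hmod'
          simp [rt] at hmod'
          omega
      · obtain ⟨z, hz⟩ := exists_eq_one_add_two_mul_of_not_rt_dvd hn
        have hmn' : ¬ rt ∣ m * n := fun h' => (prime_rt.dvd_or_dvd h').elim hm hn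
        obtain ⟨o, ho⟩ := (not_rt_dvd_iff _).mp hmn'
        generalize m * n = f at hmod ho
        rcases hx with hx | hx <;> rcases hy with hy | hy <;>
        · rw [hx, hy, hz, Zsqrtd.ext_iff] at hmod
          simp [rt, ho] at hmod
          omega
    all_goals
      exfalso
      obtain ⟨x, hx⟩ := exists_eq_one_add_two_mul_of_not_rt_dvd hm
      obtain ⟨y, hy⟩ := exists_eq_one_add_two_mul_of_not_rt_dvd hr
      have hmod : 1 + 2 * (x + (2 + rt) * m * n - n ^ 2)
          = v + 2 * (v * y + 2 * (2 + rt) * Y) := by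
        linear_combination v * hy - hx - hXY
      generalize x + (2 + rt) * m * n - n ^ 2 = e at hmod
      generalize v * y + 2 * (2 + rt) * Y = f at hmod
      rw [hv] at hmod
      have := congrArg Zsqrtd.im hmod
      simp [rt] at this
      omega
  obtain ⟨g, k, ⟨h, rfl⟩, ⟨l, rfl⟩, rfl⟩ := exists_dvd_and_dvd_of_dvd_mul (Dvd.intro s hrs.symm)
  have hgk : g * k ≠ 0 := fun h0 => hr (h0 ▸ dvd_zero rt)
  obtain rfl : s = h * l := mul_left_cancel₀ hgk (by rw [← hrs]; ring)
  refine ⟨g, h, k, l, fun h' => hm (h'.mul_right _), fun h' => hm (h'.mul_left _),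
    fun h' => hr (h'.mul_left _), hmn.of_mul_left_right.of_mul_right_left, rfl, ?_⟩
  linear_combination 4 * (2 + rt) * hY - hXY

theorem exists_sq_add_pow_four_of_factor {g h k l : ℤ√2} (hl : l ≠ 0)
    (heq : g ^ 2 * (h ^ 2 - k ^ 2) + 2 * (2 + rt) * (g * h * k * l)
      = 2 * l ^ 2 * (k ^ 2 + 2 * (2 + rt) * h ^ 2)) :
    ∃ τ : ℤ√2, τ ^ 2 + k ^ 4 = 2 * (2 + rt) * h ^ 4 := by
  have h2 := rt_sq
  have hW : (g * (h ^ 2 - k ^ 2) + (2 + rt) * (h * k * l)) ^ 2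
      = l ^ 2 * (2 * (2 * (2 + rt) * h ^ 4 - k ^ 4)) := by
    linear_combination (h ^ 2 - k ^ 2) * heq + l ^ 2 * h ^ 2 * k ^ 2 * h2
  obtain ⟨w, hw⟩ := (IsIntegrallyClosed.pow_dvd_pow_iff two_ne_zero).mp (Dvd.intro _ hW.symm)
  rw [hw, mul_pow] at hW
  have hw2 := mul_left_cancel₀ (pow_ne_zero 2 hl) hW
  obtain ⟨τ, rfl⟩ : rt ∣ w :=
    prime_rt.dvd_of_dvd_pow (n := 2) (by rw [hw2]; exact rt_dvd_two.mul_right _)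
  refine ⟨τ, mul_left_cancel₀ (two_ne_zero : (2 : ℤ√2) ≠ 0) ?_⟩
  linear_combination hw2 - τ ^ 2 * h2

theorem exists_quartic_of_quartic {m n α : ℤ√2} (hm : ¬ rt ∣ m) (hmn : IsCoprime m n)
    (hn : n ≠ 0) (hα : α ^ 2 = m ^ 4 + 4 * (2 + rt) * m ^ 3 * n - 12 * m ^ 2 * n ^ 2
      - 8 * (2 + rt) * m * n ^ 3 + 4 * n ^ 4) :
    ∃ m' n' α' a b c k l : ℤ√2, ¬ rt ∣ m' ∧ IsCoprime m' n' ∧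
      α' ^ 2 = m' ^ 4 + 4 * (2 + rt) * m' ^ 3 * n' - 12 * m' ^ 2 * n' ^ 2
        - 8 * (2 + rt) * m' * n' ^ 3 + 4 * n' ^ 4 ∧
      ¬ rt ∣ a ∧ ¬ rt ∣ b ∧ ¬ rt ∣ c ∧ ¬ rt ∣ k ∧ n = k * l ∧
      rt ^ 3 * n' * a + rt * l * b = l ^ 2 * c := by
  have h2 := rt_sq
  obtain ⟨g, h, k, l, hg, hh, hk, hhk, rfl, heq⟩ := exists_factor_of_quartic hm hmn hα
  obtain ⟨τ, hτ⟩ := exists_sq_add_pow_four_of_factor (right_ne_zero_of_mul hn) heq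
  obtain ⟨u, m', n', α', hu, hm', hmn', hα', hku, hhu⟩ :=
    exists_quartic_of_sq_add_pow_four hh hk hhk hτ
  refine ⟨m', n', α', -((1 + rt) * (g * u) ^ 2 * m' *
    (m' ^ 2 + 2 * (-((2 - rt) * m' * n') - n' ^ 2))), (1 + rt) * (g * h * k),
    k ^ 2 + 2 * ((2 + rt) * h ^ 2), k, l, hm', hmn', hα', ?_, ?_, ?_, hk, rfl, ?_⟩
  · rw [dvd_neg]
    refine prime_rt.not_dvd_mul (prime_rt.not_dvd_mul (prime_rt.not_dvd_mul
      (not_rt_dvd_of_isUnit isUnit_one_add_rt) fun h' => ?_) hm') ?_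
    · exact prime_rt.not_dvd_mul hg (not_rt_dvd_of_isUnit hu) (prime_rt.dvd_of_dvd_pow h')
    · exact not_rt_dvd_add (fun h' => hm' (prime_rt.dvd_of_dvd_pow h')) (rt_dvd_two.mul_right _)
  · exact prime_rt.not_dvd_mul (not_rt_dvd_of_isUnit isUnit_one_add_rt)
      (prime_rt.not_dvd_mul (prime_rt.not_dvd_mul hg hh) hk)
  · exact not_rt_dvd_add (fun h' => hk (prime_rt.dvd_of_dvd_pow h')) (rt_dvd_two.mul_right _)
  · refine mul_left_cancel₀ (two_ne_zero : (2 : ℤ√2) ≠ 0) ?_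
    have h3 : rt ^ 3 = 2 * rt := by linear_combination rt * h2
    have hdiff : h ^ 2 - k ^ 2 = -(4 * (2 + rt) * u ^ 2 * m' * n' *
        (m' ^ 2 - 2 * (2 - rt) * m' * n' - 2 * n' ^ 2)) := by
      rw [hhu, hku, mul_pow u α', hα']
      linear_combination 8 * u ^ 2 * m' ^ 2 * n' ^ 2 * h2
    rw [hdiff] at heq
    rw [h3]
    linear_combination heq + (2 * (g * h * k * l) + (g * u) ^ 2 * m' * n' *
      (8 * n' ^ 2 - 4 * m' ^ 2 + (16 - 8 * rt) * (m' * n'))) * h2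

theorem false_of_rt_pow_add_eq_zero {a b c : ℕ} {x y z : ℤ√2} (hab : a < b) (hac : a < c)
    (hx : ¬ rt ∣ x) (h : rt ^ a * x + rt ^ b * y = rt ^ c * z) : False := by
  obtain ⟨i, rfl⟩ := Nat.exists_eq_add_of_lt hab
  obtain ⟨j, rfl⟩ := Nat.exists_eq_add_of_lt hac
  refine hx ⟨rt ^ j * z - rt ^ i * y, mul_left_cancel₀ (pow_ne_zero a prime_rt.ne_zero) ?_⟩
  linear_combination h

theorem odd_of_quartic (L : ℕ) : ∀ {m n α z : ℤ√2}, ¬ rt ∣ m → IsCoprime m n →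
    α ^ 2 = m ^ 4 + 4 * (2 + rt) * m ^ 3 * n - 12 * m ^ 2 * n ^ 2
      - 8 * (2 + rt) * m * n ^ 3 + 4 * n ^ 4 → n = rt ^ L * z → ¬ rt ∣ z → Odd L := by
  induction L using Nat.strong_induction_on with
  | _ L ih =>
  intro m n α z hm hmn hα hnz hz
  have hrt0 := prime_rt.ne_zero
  have hn0 : n ≠ 0 := by
    rw [hnz]
    exact mul_ne_zero (pow_ne_zero L hrt0) fun h0 => hz (h0 ▸ dvd_zero rt)
  obtain ⟨m', n', α', a, b, c, k, l, hm', hmn', hα', ha, hb, hc, hk, hnkl, heq⟩ :=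
    exists_quartic_of_quartic hm hmn hn0 hα
  obtain ⟨l₀, rfl⟩ := prime_rt.pow_dvd_of_dvd_mul_left L hk (hnkl ▸ hnz ▸ dvd_mul_right _ _)
  have hl₀ : ¬ rt ∣ l₀ := fun h' => hz <| by
    have : z = k * l₀ := mul_left_cancel₀ (pow_ne_zero L hrt0) (by rw [← hnz, hnkl]; ring)
    exact this ▸ h'.mul_left k
  have hlb := prime_rt.not_dvd_mul hl₀ hb
  have hlc := prime_rt.not_dvd_mul (fun h' => hl₀ (prime_rt.dvd_of_dvd_pow (n := 2) h')) hc
  obtain ⟨L', z', rfl, hz'⟩ : ∃ L' z', n' = rt ^ L' * z' ∧ (¬ rt ∣ z' ∨ L < L') := by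
    by_cases hn' : n' = 0
    · exact ⟨L + 1, 0, by simp [hn'], Or.inr (Nat.lt_succ_self L)⟩
    · obtain ⟨L', z', h1, h2⟩ := WfDvdMonoid.max_power_factor hn' prime_rt.irreducible
      exact ⟨L', z', h2, Or.inl h1⟩
  have heq' : rt ^ (L + 1) * (l₀ * b) + rt ^ (L' + 3) * (z' * a)
      = rt ^ (2 * L) * (l₀ ^ 2 * c) := by
    linear_combination heq
  rcases lt_trichotomy L 1 with hL | rfl | hL
  · obtain rfl : L = 0 := by omega
    exact (false_of_rt_pow_add_eq_zero (a := 2 * 0) (b := 0 + 1) (c := L' + 3) (by omega) (by omega)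
      hlc (y := -(l₀ * b)) (z := z' * a) (by linear_combination -heq')).elim
  · exact odd_one
  · rcases lt_trichotomy (L + 1) (L' + 3) with h | h | h
    · exact (false_of_rt_pow_add_eq_zero h (by omega) hlb heq').elim
    · have hodd := ih L' (by omega) hm' hmn' hα' rfl (hz'.resolve_right (by omega))
      rw [show L = L' + 2 by omega]
      exact hodd.add_even even_two
    · exact (false_of_rt_pow_add_eq_zero h (c := 2 * L) (by omega)
        (prime_rt.not_dvd_mul (hz'.resolve_right (by omega)) ha)
        (by rw [add_comm]; exact heq')).elim

theorem eq_zero_of_quartic {m n : ℤ} (hm : Odd m) (hmn : IsCoprime m n) {α : ℤ√2}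
    (hα : α ^ 2 = (m : ℤ√2) ^ 4 + 4 * (2 + rt) * m ^ 3 * n - 12 * m ^ 2 * n ^ 2
      - 8 * (2 + rt) * m * n ^ 3 + 4 * n ^ 4) : n = 0 := by
  by_contra hn
  obtain ⟨j, c, hc, rfl⟩ := WfDvdMonoid.max_power_factor hn Int.prime_two.irreducible
  have hodd : Odd (2 * j) := odd_of_quartic (2 * j) (z := c) ((not_rt_dvd_iff _).mpr (by simpa))
    (hmn.map (Int.castRingHom (ℤ√2))) hα (by rw [pow_mul, rt_sq]; simp)
    ((not_rt_dvd_iff _).mpr (by simpa [← Int.not_even_iff_odd, even_iff_two_dvd] using hc))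
  exact Nat.not_odd_iff_even.mpr (even_two_mul j) hodd

end ZsqrtTwo

theorem Int.exists_sq_of_isCoprime_of_odd {x y z : ℤ} (hxy : IsCoprime x y) (hy : Odd y)
    (h : x * y = z ^ 2) :
    ∃ p q : ℤ, Odd p ∧ IsCoprime p q ∧ z = p * q ∧
      (y = p ^ 2 ∧ x = q ^ 2 ∨ y = -p ^ 2 ∧ x = -q ^ 2) := by
  obtain ⟨p, hp⟩ := Int.sq_of_isCoprime hxy.symm (by rw [mul_comm]; exact h)
  have hpo : Odd p := by
    rcases hp with rfl | rfl
    · exact (Int.odd_pow' two_ne_zero).mp hy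
    · exact (Int.odd_pow' two_ne_zero).mp (by simpa using hy.neg)
  have hp0 : p ≠ 0 := by rintro rfl; simp at hpo
  have hdvd : p ^ 2 ∣ z ^ 2 := by
    rw [← h]
    rcases hp with rfl | rfl
    · exact dvd_mul_left _ _
    · exact (dvd_neg.mpr dvd_rfl).mul_left _
  obtain ⟨q, rfl⟩ := (Int.pow_dvd_pow_iff two_ne_zero).mp hdvd
  refine ⟨p, q, hpo, ?_, rfl, hp.imp (fun e => ⟨e, ?_⟩) (fun e => ⟨e, ?_⟩)⟩
  · have hx : x = q ^ 2 ∨ x = -q ^ 2 := by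
      refine hp.imp (fun e => ?_) (fun e => ?_) <;>
      · rw [e] at h
        refine mul_right_cancel₀ (pow_ne_zero 2 hp0) ?_
        linarith
    have : IsCoprime (p ^ 2) (q ^ 2) := by
      rcases hp with rfl | rfl <;> rcases hx with rfl | rfl <;>
        simpa [IsCoprime.neg_left_iff, IsCoprime.neg_right_iff] using hxy.symm
    exact (IsCoprime.pow_iff two_pos two_pos).mp this
  all_goals
    rw [e] at h
    refine mul_right_cancel₀ (pow_ne_zero 2 hp0) ?_
    linarith

theorem Int.exists_of_sq_eq_sq_add_two_mul_sq {x y z : ℤ} (hx : Odd x) (hxz : IsCoprime x z)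
    (h : x ^ 2 = y ^ 2 + 2 * z ^ 2) :
    ∃ p q : ℤ, Odd p ∧ IsCoprime p q ∧ z = 2 * (p * q) ∧
      (x = p ^ 2 + 2 * q ^ 2 ∨ x = -(p ^ 2 + 2 * q ^ 2)) ∧
      (y = p ^ 2 - 2 * q ^ 2 ∨ y = -(p ^ 2 - 2 * q ^ 2)) := by
  have hy : Odd y := by
    have : Odd (y ^ 2) := by
      have := (hx.pow (n := 2)).sub_even (even_two_mul (z ^ 2))
      rwa [h, add_sub_cancel_right] at this
    exact (Int.odd_pow' two_ne_zero).mp this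
  obtain ⟨z, rfl⟩ : ∃ w, z = 2 * w := by
    have hz : Even (z ^ 2) := by
      have h1 := Int.sq_mod_four_eq_one_of_odd hx
      have h2 := Int.sq_mod_four_eq_one_of_odd hy
      rw [Int.even_iff]
      omega
    exact even_iff_two_dvd.mp ((Int.even_pow' two_ne_zero).mp hz)
  obtain ⟨s, hs⟩ := even_iff_two_dvd.mp (hx.sub_odd hy)
  obtain ⟨t, ht⟩ : ∃ t, t = x - s := ⟨_, rfl⟩
  obtain rfl : x = s + t := by linarith
  obtain rfl : y = t - s := by linarith
  have hst : s * t = 2 * z ^ 2 := by linarith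
  have hcop : IsCoprime s t := by
    have h2 : IsCoprime (s + t) (2 * z) := hxz
    have h3 : IsCoprime (s + t) (s * t) := by
      rw [hst, sq, ← mul_assoc]
      exact h2.mul_right h2.of_mul_right_right
    have h4 : IsCoprime (t + s * 1) s := by
      rw [mul_one, add_comm]; exact h3.of_mul_right_left
    exact h4.of_add_mul_left_left.symm
  rcases Int.even_or_odd s with hse | hso
  · have hto : Odd t := (Int.odd_add'.mp hx).mpr hse
    obtain ⟨s, rfl⟩ := even_iff_two_dvd.mp hse
    obtain ⟨p, q, hp, hpq, rfl, ⟨rfl, rfl⟩ | ⟨rfl, rfl⟩⟩ :=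
      Int.exists_sq_of_isCoprime_of_odd hcop.of_mul_left_right hto (z := z) (by linarith)
    · exact ⟨p, q, hp, hpq, rfl, Or.inl (by ring), Or.inl (by ring)⟩
    · exact ⟨p, q, hp, hpq, rfl, Or.inr (by ring), Or.inr (by ring)⟩
  · obtain ⟨t, rfl⟩ := even_iff_two_dvd.mp ((Int.odd_add.mp hx).mp hso)
    obtain ⟨p, q, hp, hpq, rfl, ⟨rfl, rfl⟩ | ⟨rfl, rfl⟩⟩ :=
      Int.exists_sq_of_isCoprime_of_odd hcop.symm.of_mul_left_right hso (z := z) (by linarith)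
    · exact ⟨p, q, hp, hpq, rfl, Or.inl (by ring), Or.inr (by ring)⟩
    · exact ⟨p, q, hp, hpq, rfl, Or.inr (by ring), Or.inl (by ring)⟩

theorem Int.exists_of_pow_eight {a c d : ℤ} (ha : 0 < a) (hao : Odd a) (had : IsCoprime a d)
    (h : a ^ 8 = c ^ 2 + 2 * d ^ 2) :
    ∃ m n : ℤ, Odd m ∧ IsCoprime m n ∧ a = m ^ 2 + 2 * n ^ 2 ∧
      d = 8 * (m * n) * (m ^ 2 - 2 * n ^ 2) * ((m ^ 2 - 2 * n ^ 2) ^ 2 - 2 * (2 * m * n) ^ 2) := by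
  obtain ⟨p, q, hp, hpq, hd, ha4, -⟩ :=
    Int.exists_of_sq_eq_sq_add_two_mul_sq (x := a ^ 4) (y := c) hao.pow had.pow_left (by linarith)
  replace ha4 : a ^ 4 = p ^ 2 + 2 * q ^ 2 := ha4.resolve_right fun e => by
    nlinarith [pow_pos ha 4, sq_nonneg p, sq_nonneg q]
  have hcop {x y z : ℤ} {k : ℕ} (hk : 0 < k) (hyz : IsCoprime y z)
      (e : x ^ k = y ^ 2 + 2 * z ^ 2) : IsCoprime x z := by
    have : IsCoprime (x ^ k) z := by
      rw [e, show y ^ 2 + 2 * z ^ 2 = y ^ 2 + z * (2 * z) by ring]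
      exact hyz.pow_left.add_mul_left_left _
    exact (IsCoprime.pow_left_iff hk).mp this
  have haq : IsCoprime a q := hcop (by norm_num) hpq ha4
  obtain ⟨u, v, hu, huv, rfl, ha2, hpe⟩ :=
    Int.exists_of_sq_eq_sq_add_two_mul_sq (x := a ^ 2) (y := p) hao.pow haq.pow_left (by linarith)
  replace ha2 : a ^ 2 = u ^ 2 + 2 * v ^ 2 := ha2.resolve_right fun e => by
    nlinarith [pow_pos ha 2, sq_nonneg u, sq_nonneg v]
  obtain ⟨m, n, hm, hmn, rfl, ha1, hue⟩ :=
    Int.exists_of_sq_eq_sq_add_two_mul_sq hao (hcop (by norm_num) huv ha2) ha2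
  replace ha1 : a = m ^ 2 + 2 * n ^ 2 := ha1.resolve_right fun e => by
    nlinarith [sq_nonneg m, sq_nonneg n]
  rcases hpe with rfl | rfl <;> rcases hue with rfl | rfl
  · exact ⟨m, n, hm, hmn, ha1, by rw [hd]; ring⟩
  · exact ⟨m, -n, hm, hmn.neg_right, by rw [ha1]; ring, by rw [hd]; ring⟩
  · exact ⟨m, -n, hm, hmn.neg_right, by rw [ha1]; ring, by rw [hd]; ring⟩
  · exact ⟨m, n, hm, hmn, ha1, by rw [hd]; ring⟩

open ZsqrtTwo in
theorem Int.eq_zero_of_sq_eq {b m n : ℤ} (hmo : Odd m) (hmn : IsCoprime m n)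
    (h : b ^ 2 = (m ^ 2 + 2 * n ^ 2) ^ 4 + 2 * (8 * (m * n) * (m ^ 2 - 2 * n ^ 2) *
      ((m ^ 2 - 2 * n ^ 2) ^ 2 - 2 * (2 * m * n) ^ 2))) : n = 0 := by
  obtain ⟨u, hu⟩ : ∃ u, u = m ^ 2 - 2 * n ^ 2 := ⟨_, rfl⟩
  obtain ⟨v, hv⟩ : ∃ v, v = 2 * (m * n) := ⟨_, rfl⟩
  have hu_odd : Odd u := by
    rw [hu]; exact hmo.pow.sub_even (even_two_mul _)
  have huv : IsCoprime u v := by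
    have h2 : IsCoprime u 2 := Int.isCoprime_two_right.mpr hu_odd
    have h2m : IsCoprime 2 m := (Int.isCoprime_two_left).mpr hmo
    have hm : IsCoprime u m := by
      rw [hu, show m ^ 2 - 2 * n ^ 2 = -(2 * n ^ 2) + m * m by ring]
      exact (h2m.mul_left hmn.symm.pow_left).neg_left.add_mul_left_left m
    have hn : IsCoprime u n := by
      rw [hu, show m ^ 2 - 2 * n ^ 2 = m ^ 2 + n * (-2 * n) by ring]
      exact hmn.pow_left.add_mul_left_left _
    rw [hv]
    exact h2.mul_right (hm.mul_right hn)
  have hx : Odd (u ^ 2 + 4 * (u * v) - 2 * v ^ 2) := by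
    rw [show u ^ 2 + 4 * (u * v) - 2 * v ^ 2 = u ^ 2 + 2 * (2 * (u * v) - v ^ 2) by ring]
    exact hu_odd.pow.add_even (even_two_mul _)
  have hcop : IsCoprime (u ^ 2 + 4 * (u * v) - 2 * v ^ 2) (2 * (u * v)) := by
    refine (Int.isCoprime_two_right.mpr hx).mul_right (IsCoprime.mul_right ?_ ?_)
    · rw [show u ^ 2 + 4 * (u * v) - 2 * v ^ 2 = -(2 * v ^ 2) + u * (u + 4 * v) by ring]
      exact ((Int.isCoprime_two_left.mpr hu_odd).mul_left
        huv.symm.pow_left).neg_left.add_mul_left_left _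
    · rw [show u ^ 2 + 4 * (u * v) - 2 * v ^ 2 = u ^ 2 + v * (4 * u - 2 * v) by ring]
      exact huv.pow_left.add_mul_left_left _
  obtain ⟨e, f, he, -, hef, hxe, -⟩ := Int.exists_of_sq_eq_sq_add_two_mul_sq (y := b) hx hcop
    (by rw [h, hu, hv]; ring)
  replace hxe : u ^ 2 + 4 * (u * v) - 2 * v ^ 2 = e ^ 2 + 2 * f ^ 2 :=
      hxe.resolve_right fun hxe => by
    have h8 : u ^ 2 + e ^ 2 + 2 * f ^ 2 = 8 * ((m * n) ^ 2 - u * (m * n)) := by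
      rw [hv] at hxe; linarith
    generalize (m * n) ^ 2 - u * (m * n) = w at h8
    have h1 := Int.eight_dvd_sq_sub_one_of_odd hu_odd
    have h2 := Int.eight_dvd_sq_sub_one_of_odd he
    have h3 : f ^ 2 % 4 = 0 ∨ f ^ 2 % 4 = 1 := by
      rcases Int.even_or_odd' f with ⟨g, rfl | rfl⟩
      · left; ring_nf; omega
      · right; exact Int.sq_mod_four_eq_one_of_odd (odd_two_mul_add_one g)
    omega
  refine eq_zero_of_quartic hmo hmn (α := e + f * rt) ?_
  have hxe' := congrArg (Int.cast : ℤ → ℤ√2) hxe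
  have hef' := congrArg (Int.cast : ℤ → ℤ√2) hef
  rw [hu, hv] at hxe' hef'
  push_cast at hxe' hef'
  linear_combination (f : ℤ√2) ^ 2 * rt_sq - hxe' - rt * hef'

/-- If `a, b, c` are positive integers with `a, b` odd and `gcd (a, b) = 1`
satisfying `−a⁸ − 2a⁴b² + b⁴ = −2c²`, then `(a, b) = (1, 1)`. -/
theorem diophantine_eq2 (a b c : ℤ) (ha : 0 < a) (hb : 0 < b) (hc : 0 < c)
    (hao : Odd a) (hbo : Odd b) (hcop : IsCoprime a b)
    (h : -a ^ 8 - 2 * a ^ 4 * b ^ 2 + b ^ 4 = -2 * c ^ 2) :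
    a = 1 ∧ b = 1 := by
  obtain ⟨d, hd⟩ : ∃ d, b ^ 2 - a ^ 4 = 2 * d := even_iff_two_dvd.mp (hbo.pow.sub_odd hao.pow)
  have had : IsCoprime a d := by
    have h1 : IsCoprime a (2 * d + a * a ^ 3) := by
      rw [show 2 * d + a * a ^ 3 = b ^ 2 by linarith]; exact hcop.pow_right
    exact h1.of_add_mul_left_right.of_mul_right_right
  have h8 : a ^ 8 = c ^ 2 + 2 * d ^ 2 := by
    have h2 : (b ^ 2 - a ^ 4) ^ 2 = (2 * d) ^ 2 := by rw [hd]
    linarith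
  obtain ⟨m, n, hm, hmn, rfl, rfl⟩ := Int.exists_of_pow_eight ha hao had h8
  obtain rfl : n = 0 := Int.eq_zero_of_sq_eq hm hmn (b := b) (by linarith)
  have hm2 : m ^ 2 = 1 := by
    rcases Int.isUnit_iff.mp (isCoprime_zero_right.mp hmn) with rfl | rfl <;> norm_num
  have ha1 : m ^ 2 + 2 * 0 ^ 2 = 1 := by rw [hm2]; norm_num
  rw [ha1] at hd
  exact ⟨ha1, by nlinarith⟩
end

section
/- Let a, b, c be positive integers with b odd and gcd(a,b) = 1. If −64a^8 + 16a^4b^2 + b^4 = c^2, then (a,b) = (1,5) (and c = 31). -/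
/-- If `A`, `B` are coprime positive integers with `A` odd and `A * B = 2 ^ j * c ^ n`, then `A` is
an `n`-th power and `B` is `2 ^ j` times an `n`-th power. -/
lemma exists_pow_of_mul_eq_two_pow_mul_pow {A B c : ℤ} {j n : ℕ} (hn : n ≠ 0) (hA : 0 < A)
    (hB : 0 < B) (hc : 0 < c) (hco : IsCoprime A B) (hodd : Odd A) (h : A * B = 2 ^ j * c ^ n) :
    ∃ u v : ℤ, 0 < u ∧ 0 < v ∧ A = u ^ n ∧ B = 2 ^ j * v ^ n ∧ c = u * v := by
  have h2 : IsCoprime ((2 : ℤ) ^ j) A := (Int.isCoprime_two_left.mpr hodd).pow_left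
  obtain ⟨B', rfl⟩ : (2 : ℤ) ^ j ∣ B := h2.dvd_of_dvd_mul_left ⟨_, h⟩
  have hB' : 0 < B' := pos_of_mul_pos_right hB (by positivity)
  have hco' : IsCoprime A B' := hco.of_mul_right_right
  have h' : A * B' = c ^ n := by
    apply mul_left_cancel₀ (pow_ne_zero j (two_ne_zero (α := ℤ)))
    linarith
  lift A to ℕ using hA.le
  lift B' to ℕ using hB'.le
  lift c to ℕ using hc.le
  obtain ⟨u, hu⟩ := exists_eq_pow_of_mul_eq_pow (Nat.isUnit_iff.mpr
    (Nat.isCoprime_iff_coprime.mp hco')) (by exact_mod_cast h' : A * B' = c ^ n)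
  obtain ⟨v, hv⟩ := exists_eq_pow_of_mul_eq_pow (Nat.isUnit_iff.mpr
    (Nat.isCoprime_iff_coprime.mp hco'.symm)) (by rw [mul_comm]; exact_mod_cast h' : B' * A = c ^ n)
  have hu0 : 0 < u := by
    rcases Nat.eq_zero_or_pos u with rfl | h0
    · simp [hu, hn] at hA
    · exact h0
  have hv0 : 0 < v := by
    rcases Nat.eq_zero_or_pos v with rfl | h0
    · simp [hv, hn] at hB'
    · exact h0
  refine ⟨u, v, by exact_mod_cast hu0, by exact_mod_cast hv0, by exact_mod_cast hu,
    by rw [hv]; push_cast; ring, ?_⟩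
  have : (u * v) ^ n = c ^ n := by
    rw [mul_pow, ← hu, ← hv]; exact_mod_cast h'
  exact_mod_cast (Nat.pow_left_injective hn this).symm

/-- Primitive Pythagorean triples with positive even leg, parametrised by positive integers. -/
lemma exists_pos_of_sq_add_sq_eq_sq {x y z : ℤ} (hx : Odd x) (hy : 0 < y) (hz : 0 < z)
    (hco : IsCoprime x y) (h : x ^ 2 + y ^ 2 = z ^ 2) :
    ∃ m n : ℤ, 0 < m ∧ 0 < n ∧ x = m ^ 2 - n ^ 2 ∧ y = 2 * m * n ∧ z = m ^ 2 + n ^ 2 ∧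
      IsCoprime m n ∧ (Odd m ∧ Even n ∨ Even m ∧ Odd n) := by
  have hp : PythagoreanTriple x y z := by unfold PythagoreanTriple; linarith
  obtain ⟨m, n, h1, h2, h3, h4, h5, h6⟩ := hp.coprime_classification'
    (Int.isCoprime_iff_gcd_eq_one.mp hco) (Int.odd_iff.mp hx) hz
  have hm : 0 < m := by
    rcases h6.eq_or_lt with rfl | h0
    · simp [h2] at hy
    · exact h0
  refine ⟨m, n, hm, ?_, h1, h2, h3, Int.isCoprime_iff_gcd_eq_one.mpr h4, ?_⟩
  · rw [h2] at hy
    exact pos_of_mul_pos_right hy (by positivity)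
  · rw [Int.odd_iff, Int.even_iff, Int.odd_iff, Int.even_iff]
    tauto

/-- The equation `x ^ 4 + 4 * y ^ 4 = z ^ 2` has no primitive solution with `x` odd and `y ≠ 0`. -/
lemma pow_four_add_four_mul_pow_four_ne_sq {x y z : ℤ} (hx : Odd x) (hy : 0 < y) (hz : 0 < z)
    (hco : IsCoprime x y) : x ^ 4 + 4 * y ^ 4 ≠ z ^ 2 := by
  intro h
  induction hN : z.toNat using Nat.strong_induction_on generalizing x y z with
  | _ N ih =>
  have hx2 : IsCoprime x 2 := Int.isCoprime_two_right.mpr hx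
  obtain ⟨m, n, hm, hn, h1, h2, h3, hmn, hpar⟩ :=
    exists_pos_of_sq_add_sq_eq_sq (x := x ^ 2) (y := 2 * y ^ 2) hx.pow (by positivity) hz
      ((hx2.pow_left).mul_right hco.pow) (by linarith)
  have hmo : Odd m := by
    rcases hpar with h0 | ⟨⟨k, rfl⟩, ⟨l, rfl⟩⟩
    · exact h0.1
    · obtain ⟨j, rfl⟩ := hx
      ring_nf at h1
      omega
  obtain ⟨A, B, hA, hB, rfl, hB2, rfl⟩ := exists_pow_of_mul_eq_two_pow_mul_pow (j := 0) (n := 2)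
    two_ne_zero hm hn hy hmn hmo (by linarith)
  rw [pow_zero, one_mul] at hB2
  subst hB2
  have hBe : Even B := by
    rcases hpar with h0 | h0
    · exact (Int.even_pow.mp h0.2).1
    · exact absurd hmo (Int.not_odd_iff_even.mpr h0.1)
  obtain ⟨D, rfl⟩ := hBe
  have hxB : IsCoprime x ((D + D) ^ 2) := hco.of_mul_right_right.pow_right
  obtain ⟨m, n, hm, hn, h4, h5, h6, hmn', hpar'⟩ := exists_pos_of_sq_add_sq_eq_sq
    (z := A ^ 2) hx (by positivity) (by positivity) hxB (by linarith)
  have hD : 0 < D := by omega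
  have key : ∃ k l : ℤ, 0 < l ∧ Odd k ∧ IsCoprime k l ∧ k ^ 4 + 4 * l ^ 4 = A ^ 2 := by
    rcases hpar' with h0 | h0
    · obtain ⟨k, l, hk, hl, rfl, rfl, -⟩ := exists_pow_of_mul_eq_two_pow_mul_pow (j := 1) (n := 2)
        two_ne_zero hm hn hD hmn' h0.1 (by linarith)
      refine ⟨k, l, hl, (Int.odd_pow.mp h0.1).resolve_right two_ne_zero, ?_, by rw [h6]; ring⟩
      exact (IsCoprime.pow_iff two_pos two_pos).mp hmn'.of_mul_right_right
    · obtain ⟨k, l, hk, hl, rfl, rfl, -⟩ := exists_pow_of_mul_eq_two_pow_mul_pow (j := 1) (n := 2)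
        two_ne_zero hn hm hD hmn'.symm h0.2 (by linarith)
      refine ⟨k, l, hl, (Int.odd_pow.mp h0.2).resolve_right two_ne_zero, ?_, by rw [h6]; ring⟩
      exact (IsCoprime.pow_iff two_pos two_pos).mp hmn'.symm.of_mul_right_right
  obtain ⟨k, l, hl, hk, hkl, hkA⟩ := key
  have hlt : A < z := by
    have h7 : A ≤ (A ^ 2) ^ 2 := by
      rw [← pow_mul]; exact le_self_pow₀ hA (by norm_num)
    have h8 : 0 < ((D + D) ^ 2) ^ 2 := by positivity
    linarith
  exact ih A.toNat (by omega) hk hl hA hkl hkA rfl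

/-- A primitive solution of `x ^ 4 = y ^ 4 + z ^ 2` with `z` odd is trivial. -/
lemma pow_four_ne_pow_four_add_sq_of_odd {x y z : ℤ} (hx : 0 < x) (hy : 0 < y) (hz : Odd z)
    (hco : IsCoprime x y) : x ^ 4 ≠ y ^ 4 + z ^ 2 := by
  intro h
  have hzx : IsCoprime z x := by
    have h1 : IsCoprime (x ^ 4) (z ^ 2 + x ^ 4 * (-1)) := by
      rw [show z ^ 2 + x ^ 4 * (-1) = -(y ^ 4) by linarith]
      exact hco.pow.neg_right
    exact ((IsCoprime.pow_iff (by norm_num) two_pos).mp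
      (IsCoprime.of_add_mul_left_right h1)).symm
  have hzy : IsCoprime z y := by
    have h1 : IsCoprime (y ^ 4) (z ^ 2 + y ^ 4 * 1) := by
      rw [show z ^ 2 + y ^ 4 * 1 = x ^ 4 by linarith]
      exact hco.symm.pow
    exact ((IsCoprime.pow_iff (by norm_num) two_pos).mp
      (IsCoprime.of_add_mul_left_right h1)).symm
  refine pow_four_add_four_mul_pow_four_ne_sq hz (mul_pos hx hy)
    (by positivity : 0 < x ^ 4 + y ^ 4) (hzx.mul_right hzy) ?_
  linear_combination (-(x ^ 4) + y ^ 4 - z ^ 2) * h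

/-- Fermat's right triangle theorem: `x ^ 4 = y ^ 4 + z ^ 2` has only trivial primitive solutions
with `x` odd. -/
lemma eq_zero_of_pow_four_eq_pow_four_add_sq {x y z : ℤ} (hx : 0 < x) (hxo : Odd x) (hy : 0 < y)
    (hco : IsCoprime x y) (h : x ^ 4 = y ^ 4 + z ^ 2) : z = 0 := by
  by_contra hz0
  rcases Int.even_or_odd z with hz | hz
  · have hyo : Odd y := by
      have h1 : Odd (y ^ 4 + z ^ 2) := h ▸ hxo.pow
      have h2 : Even (z ^ 2) := hz.pow_of_ne_zero two_ne_zero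
      exact (Int.odd_pow.mp ((Int.odd_add.mp h1).mpr h2)).resolve_right (by norm_num)
    have hyz : IsCoprime (y ^ 2) |z| := by
      have h1 : IsCoprime (y ^ 4) (z ^ 2 + y ^ 4 * 1) := by
        rw [show z ^ 2 + y ^ 4 * 1 = x ^ 4 by linarith]
        exact hco.symm.pow
      have h2 := (IsCoprime.pow_iff (by norm_num) two_pos).mp (IsCoprime.of_add_mul_left_right h1)
      exact (IsCoprime.abs_right_iff ..).mpr h2.pow_left
    obtain ⟨m, n, hm, hn, h1, -, h3, hmn, -⟩ := exists_pos_of_sq_add_sq_eq_sq (z := x ^ 2)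
      hyo.pow (abs_pos.mpr hz0) (by positivity) hyz (by rw [sq_abs]; linarith)
    refine pow_four_ne_pow_four_add_sq_of_odd hm hn (hxo.mul hyo) hmn ?_
    rw [mul_pow, h1, h3]; ring
  · exact pow_four_ne_pow_four_add_sq_of_odd hx hy hz hco h

/-- If `M ^ 2 - c ^ 2 = 4 * A` with `M`, `c` of the same parity, then `A` splits into two positive
factors with sum `M`. -/
lemma exists_add_eq_mul_eq {M c A : ℤ} (hM : 0 < M) (hA : 0 < A) (hM2 : Odd M) (hc : Odd c)
    (h : M ^ 2 - c ^ 2 = 4 * A) : ∃ r s : ℤ, 0 < r ∧ 0 < s ∧ r + s = M ∧ r * s = A := by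
  obtain ⟨r, hr⟩ := hM2.sub_odd hc
  obtain ⟨s, hs⟩ := hM2.add_odd hc
  have hsum : r + s = M := by linarith
  have hprod : r * s = A := by
    have : (r + r) * (s + s) = 4 * A := by rw [← hr, ← hs, ← h]; ring
    linarith
  refine ⟨r, s, ?_, ?_, hsum, hprod⟩ <;> by_contra! h0 <;> nlinarith

/-- If `r`, `s` are positive integers with `r * s = 2 ^ j * c ^ n` and `r + s` is odd and coprime to
`c`, then `r + s = u ^ n + 2 ^ j * v ^ n` with `u * v = c` and `u` odd. -/
lemma exists_add_eq_pow_add_two_pow_mul_pow {r s c : ℤ} {j n : ℕ} (hn : n ≠ 0) (hr : 0 < r)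
    (hs : 0 < s) (hc : 0 < c) (hco : IsCoprime (r + s) c) (hodd : Odd (r + s))
    (h : r * s = 2 ^ j * c ^ n) :
    ∃ u v : ℤ, 0 < u ∧ 0 < v ∧ Odd u ∧ IsCoprime u v ∧ r + s = u ^ n + 2 ^ j * v ^ n ∧
      c = u * v := by
  wlog hro : Odd r generalizing r s
  · have hso : Odd s := Int.not_even_iff_odd.mp fun he => hro ((Int.odd_add.mp hodd).mpr he)
    rw [add_comm r s] at hco hodd ⊢
    exact this hs hr hco hodd (by linarith) hso
  have hrs : IsCoprime r s := by
    have h1 : IsCoprime (s + r * 1) (r * s) := by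
      rw [h, mul_one, add_comm]
      exact (Int.isCoprime_two_right.mpr hodd).pow_right.mul_right hco.pow_right
    exact h1.of_mul_right_left.of_add_mul_left_left.symm
  obtain ⟨u, v, hu, hv, rfl, rfl, rfl⟩ :=
    exists_pow_of_mul_eq_two_pow_mul_pow hn hr hs hc hrs hro h
  refine ⟨u, v, hu, hv, (Int.odd_pow.mp hro).resolve_right hn, ?_, rfl, rfl⟩
  exact (IsCoprime.pow_iff hn.bot_lt hn.bot_lt).mp hrs.of_mul_right_right

/-- The equation `u ^ 4 = p ^ 8 + 4 * p ^ 4 * q ^ 4 - 4 * q ^ 8` has no solution in coprime positive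
integers with `p` and `u` odd other than `p = q = 1`. -/
lemma eq_one_of_pow_four_eq {p q u : ℤ} (hp : 0 < p) (hq : 0 < q) (hpo : Odd p) (huo : Odd u)
    (hco : IsCoprime p q) (h : u ^ 4 = p ^ 8 + 4 * p ^ 4 * q ^ 4 - 4 * q ^ 8) :
    p = 1 ∧ q = 1 := by
  have hMo : Odd (p ^ 4 + 2 * q ^ 4) := hpo.pow.add_even (even_two_mul _)
  obtain ⟨r, w, hr, hw, hsum, hprod⟩ := exists_add_eq_mul_eq (M := p ^ 4 + 2 * q ^ 4) (c := u ^ 2)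
    (A := 2 * q ^ 8) (by positivity) (by positivity) hMo huo.pow (by linear_combination -h)
  have hM : IsCoprime (r + w) q := by
    rw [hsum, show p ^ 4 + 2 * q ^ 4 = p ^ 4 + q * (2 * q ^ 3) by ring]
    exact IsCoprime.add_mul_left_left hco.pow_left _
  obtain ⟨s, t, hs, ht, hso, hst, hpow, rfl⟩ := exists_add_eq_pow_add_two_pow_mul_pow (j := 1)
    (n := 8) (by norm_num) hr hw hq hM (hsum ▸ hMo) (by linarith)
  have hpt : IsCoprime p (t ^ 2) := hco.of_mul_right_right.pow_right
  have hz := eq_zero_of_pow_four_eq_pow_four_add_sq (z := s ^ 4 - t ^ 4) hp hpo (by positivity) hpt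
    (by linear_combination hpow - hsum)
  have hst' : s = t := (pow_left_inj₀ hs.le ht.le (by norm_num)).mp (sub_eq_zero.mp hz)
  subst hst'
  have hs1 : s = 1 := by
    rcases Int.isUnit_iff.mp (isCoprime_self.mp hst) with h0 | h0 <;> omega
  subst hs1
  refine ⟨?_, by norm_num⟩
  have hp1 : p ^ 4 = 1 := by linarith
  exact (pow_eq_one_iff_of_nonneg hp.le (by norm_num)).mp hp1

/-- The equation `b ^ 2 = u ^ 8 - 8 * u ^ 4 * v ^ 4 + 32 * v ^ 8` has only the solution
`u = v = 1` in coprime positive integers with `u` odd. -/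
lemma eq_one_of_sq_eq_pow_eight {u v b : ℤ} (hu : 0 < u) (hv : 0 < v) (hb : 0 < b) (huo : Odd u)
    (hco : IsCoprime u v) (h : b ^ 2 = u ^ 8 - 8 * u ^ 4 * v ^ 4 + 32 * v ^ 8) :
    u = 1 ∧ v = 1 := by
  have hxo : Odd (u ^ 4 - 4 * v ^ 4) := huo.pow.sub_even ⟨2 * v ^ 4, by ring⟩
  have hxv : IsCoprime (u ^ 4 - 4 * v ^ 4) v := by
    rw [show u ^ 4 - 4 * v ^ 4 = u ^ 4 + v * (-4 * v ^ 3) by ring]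
    exact IsCoprime.add_mul_left_left hco.pow_left _
  have hx4 : IsCoprime (u ^ 4 - 4 * v ^ 4) (2 ^ 2 * v ^ 4) :=
    (Int.isCoprime_two_right.mpr hxo).pow_right.mul_right hxv.pow_right
  obtain ⟨m, n, hm, hn, h1, h2, -, hmn, hpar⟩ := exists_pos_of_sq_add_sq_eq_sq hxo
    (by positivity) hb hx4 (by linear_combination -h)
  rcases hpar with h0 | h0
  · obtain ⟨p, q, hp, hq, rfl, rfl, rfl⟩ := exists_pow_of_mul_eq_two_pow_mul_pow (j := 1) (n := 4)
      (by norm_num) hm hn hv hmn h0.1 (by linarith)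
    have hpo := (Int.odd_pow.mp h0.1).resolve_right (by norm_num)
    have hpq : IsCoprime p q :=
      (IsCoprime.pow_iff (by norm_num) (by norm_num)).mp hmn.of_mul_right_right
    obtain ⟨rfl, rfl⟩ := eq_one_of_pow_four_eq hp hq hpo huo hpq (by linear_combination h1)
    refine ⟨?_, by norm_num⟩
    have hu1 : u ^ 4 = 1 := by linarith
    exact (pow_eq_one_iff_of_nonneg hu.le (by norm_num)).mp hu1
  · exfalso
    obtain ⟨⟨k, rfl⟩, ⟨l, rfl⟩⟩ := h0
    obtain ⟨j, rfl⟩ := huo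
    ring_nf at h1
    omega

/-- If `a, b, c` are positive integers with `b` odd and `gcd (a, b) = 1`
satisfying `−64a⁸ + 16a⁴b² + b⁴ = c²`, then `(a, b) = (1, 5)` and `c = 31`. -/
theorem diophantine_eq3 (a b c : ℤ) (ha : 0 < a) (hb : 0 < b) (hc : 0 < c)
    (hbo : Odd b) (hcop : IsCoprime a b)
    (h : -64 * a ^ 8 + 16 * a ^ 4 * b ^ 2 + b ^ 4 = c ^ 2) :
    a = 1 ∧ b = 5 ∧ c = 31 := by
  have hMo : Odd (b ^ 2 + 8 * a ^ 4) := hbo.pow.add_even ⟨4 * a ^ 4, by ring⟩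
  have hco : Odd c := by
    have h1 : Odd (c ^ 2) := by
      rw [← h]
      exact Even.add_odd ⟨-32 * a ^ 8 + 8 * a ^ 4 * b ^ 2, by ring⟩ hbo.pow
    exact (Int.odd_pow.mp h1).resolve_right two_ne_zero
  obtain ⟨r, w, hr, hw, hsum, hprod⟩ := exists_add_eq_mul_eq (M := b ^ 2 + 8 * a ^ 4)
    (A := 2 ^ 5 * a ^ 8) (by positivity) (by positivity) hMo hco (by linear_combination h)
  have hM : IsCoprime (r + w) a := by
    rw [hsum, show b ^ 2 + 8 * a ^ 4 = b ^ 2 + a * (8 * a ^ 3) by ring]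
    exact IsCoprime.add_mul_left_left hcop.symm.pow_left _
  obtain ⟨u, v, hu, hv, huo, huv, hpow, rfl⟩ := exists_add_eq_pow_add_two_pow_mul_pow
    (by norm_num) hr hw ha hM (hsum ▸ hMo) hprod
  obtain ⟨rfl, rfl⟩ := eq_one_of_sq_eq_pow_eight hu hv hb huo huv
    (by linear_combination hpow - hsum)
  have hb5 : b = 5 := by nlinarith
  subst hb5
  refine ⟨by norm_num, rfl, ?_⟩
  nlinarith
end

section
/- Let p be a prime and n ≥ 1. For each r ∈ {1,…,n}, let (f_{ir})_{i≥0} be polynomials in n variables x_1,…,x_n with coefficients in ℤ_p, and define F_r : ℤ_p^n → ℤ_p by F_r(x) = Σ_{i=0}^∞ p^i · f_{ir}(x) (the series converges p-adically). Assume: (1) for each r, f_{0r} is homogeneous of some degree d_r ≥ 1; (2) every monomial occurring in any f_{ir} has total degree at least d_r; (3) for every r there exist polynomials h_{1r},…,h_{nr} in x_1,…,x_n over ℤ_p such that h_{1r}·f_{01} + ⋯ + h_{nr}·f_{0n} = H_r is a polynomial in the single variable x_r, and the only solution of the congruence H_r(x) ≡ 0 (mod p) in ℤ_p is x ≡ 0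 (mod p). Then the only solution in p-adic integers x_1,…,x_n of the system F_r(x_1,…,x_n) = 0 for r = 1,…,n is x_1 = ⋯ = x_n = 0. -/
open MvPolynomial

/-- If every monomial of `g` has total degree at least `d`, then scaling the variables by `c`
produces a value divisible by `c ^ d`. -/
theorem MvPolynomial.pow_dvd_eval_smul {σ R : Type*} [CommSemiring R] {g : MvPolynomial σ R}
    {d : ℕ} (hg : ∀ m ∈ g.support, d ≤ m.sum fun _ e => e) (c : R) (y : σ → R) :
    c ^ d ∣ eval (c • y) g := by
  rw [eval_eq]
  refine Finset.dvd_sum fun m hm => Dvd.dvd.mul_left ?_ _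
  simp only [Pi.smul_apply, smul_eq_mul, mul_pow, Finset.prod_mul_distrib,
    Finset.prod_pow_eq_pow_sum]
  exact (pow_dvd_pow c (hg m hm)).mul_right _

/-- A homogeneous polynomial of degree `d` takes the value `c ^ d * g y` at `c • y`. -/
theorem MvPolynomial.IsHomogeneous.eval_smul_eq {σ R : Type*} [CommSemiring R]
    {g : MvPolynomial σ R} {d : ℕ} (hg : g.IsHomogeneous d) (c : R) (y : σ → R) :
    eval (c • y) g = c ^ d * eval y g := by
  rw [eval_eq, eval_eq, Finset.mul_sum]
  refine Finset.sum_congr rfl fun m hm => ?_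
  have hdeg : ∑ i ∈ m.support, m i = d := by
    rw [← hg (mem_support_iff.mp hm), Finsupp.weight_apply, Finsupp.sum]
    simp
  simp only [Pi.smul_apply, smul_eq_mul, mul_pow, Finset.prod_mul_distrib,
    Finset.prod_pow_eq_pow_sum, hdeg]
  ring

theorem PadicInt.summable_pow_mul {p : ℕ} [Fact p.Prime] (a : ℕ → ℤ_[p]) :
    Summable fun i => (p : ℤ_[p]) ^ i * a i := by
  refine Summable.of_norm_bounded (summable_geometric_of_norm_lt_one
    (x := ‖(p : ℤ_[p])‖) (by rw [norm_norm, PadicInt.norm_lt_one_iff_dvd])) fun i => ?_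
  rw [norm_mul, norm_pow]
  exact mul_le_of_le_one_right (by positivity) (PadicInt.norm_le_one _)

/-- The constant term of a vanishing series `Σ p ^ i * a i` is divisible by `p`. -/
theorem PadicInt.dvd_of_tsum_pow_mul_eq_zero {p : ℕ} [Fact p.Prime] {a : ℕ → ℤ_[p]}
    (h : ∑' i, (p : ℤ_[p]) ^ i * a i = 0) : (p : ℤ_[p]) ∣ a 0 := by
  rw [(summable_pow_mul a).tsum_eq_zero_add] at h
  simp only [pow_zero, one_mul, pow_succ', mul_assoc] at h
  rw [(summable_pow_mul fun i => a (i + 1)).tsum_mul_left] at h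
  rw [eq_neg_of_add_eq_zero_left h]
  exact (dvd_mul_right _ _).neg_right

/-- A nonzero vector of `p`-adic integers is a nonzero multiple of one with a coordinate `1`. -/
theorem PadicInt.exists_eq_smul_of_ne_zero {p : ℕ} [Fact p.Prime] {ι : Type*} [Finite ι]
    {x : ι → ℤ_[p]} (hx : x ≠ 0) :
    ∃ (c : ℤ_[p]) (y : ι → ℤ_[p]) (j : ι), c ≠ 0 ∧ x = c • y ∧ y j = 1 := by
  obtain ⟨k, hk⟩ := Function.ne_iff.mp hx
  have : Nonempty ι := ⟨k⟩
  obtain ⟨j, hj⟩ := Finite.exists_max fun i => ‖x i‖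
  have hc : x j ≠ 0 := norm_pos_iff.mp ((norm_pos_iff.mpr hk).trans_le (hj k))
  have hdvd : ∀ i, x j ∣ x i := fun i => by
    obtain h | ⟨b, hb⟩ := ValuationRing.dvd_total (x j) (x i)
    · exact h
    · have hi : 0 < ‖x i‖ := norm_pos_iff.mpr (left_ne_zero_of_mul (hb ▸ hc))
      have hle : ‖x i‖ ≤ ‖x i‖ * ‖b‖ := by rw [← norm_mul, ← hb]; exact hj i
      have hu : IsUnit b := PadicInt.isUnit_iff.mpr
        ((PadicInt.norm_le_one b).antisymm ((le_mul_iff_one_le_right hi).mp hle))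
      rw [hb]
      exact hu.mul_right_dvd.mpr dvd_rfl
  choose y hy using hdvd
  exact ⟨x j, y, j, hc, funext hy, mul_left_cancel₀ hc (by rw [← hy, mul_one])⟩

/-- A theorem à la Skolem: let `p` be a prime, and for `r = 1, …, n` let
`F r x = Σ_{i≥0} p^i · f i r (x)` where the `f i r` are polynomials over `ℤ_p`
in `n` variables.  Assume that each `f 0 r` is homogeneous of degree `d r ≥ 1`,
that every monomial occurring in any `f i r` has total degree at least `d r`,
and that for each `r` some `ℤ_p[x]`-linear combination of `f 0 1, …, f 0 n` is a
polynomial `H r` in the single variable `x r` whose only root mod `p` is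
`0 mod p`.  Then the only solution in `p`-adic integers of the system
`F r (x) = 0`, `r = 1, …, n`, is `x = 0`. -/
theorem skolem_padic_system (p : ℕ) [Fact p.Prime] (n : ℕ) (hn : 1 ≤ n)
    (f : ℕ → Fin n → MvPolynomial (Fin n) ℤ_[p])
    (d : Fin n → ℕ) (hd : ∀ r, 1 ≤ d r)
    (h1 : ∀ r, (f 0 r).IsHomogeneous (d r))
    (h2 : ∀ i r, ∀ m ∈ (f i r).support, d r ≤ m.sum fun _ e => e)
    (h3 : ∀ r : Fin n, ∃ h : Fin n → MvPolynomial (Fin n) ℤ_[p],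
      ∃ H : Polynomial ℤ_[p],
        (∑ s, h s * f 0 s) = Polynomial.aeval (X r) H ∧
        ∀ x : ℤ_[p], (p : ℤ_[p]) ∣ H.eval x → (p : ℤ_[p]) ∣ x)
    (x : Fin n → ℤ_[p])
    (hx : ∀ r : Fin n, (∑' i : ℕ, (p : ℤ_[p]) ^ i * eval x (f i r)) = 0) :
    x = 0 := by
  by_contra hne
  obtain ⟨c, y, j, hc, rfl, hyj⟩ := PadicInt.exists_eq_smul_of_ne_zero hne
  have hf : ∀ r, (p : ℤ_[p]) ∣ eval y (f 0 r) := fun r => by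
    choose a ha using fun i => pow_dvd_eval_smul (h2 i r) c y
    have hcd : c ^ d r ≠ 0 := pow_ne_zero _ hc
    have ha0 : a 0 = eval y (f 0 r) :=
      mul_left_cancel₀ hcd ((ha 0).symm.trans ((h1 r).eval_smul_eq c y))
    rw [← ha0]
    refine PadicInt.dvd_of_tsum_pow_mul_eq_zero ((mul_eq_zero_iff_left hcd).mp ?_)
    rw [← (PadicInt.summable_pow_mul a).tsum_mul_left, ← hx r]
    exact tsum_congr fun i => by rw [ha, mul_left_comm]
  obtain ⟨h, H, hH, hroot⟩ := h3 j
  have hval : (p : ℤ_[p]) ∣ H.eval (y j) := by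
    have heval := congrArg (eval y) hH
    rw [map_sum] at heval
    have : eval y (Polynomial.aeval (X j) H) = H.eval (y j) := by
      rw [← MvPolynomial.coe_aeval_eq_eval, RingHom.coe_coe, ← Polynomial.aeval_algHom_apply]
      simp
    rw [← this, ← heval]
    exact Finset.dvd_sum fun s _ => by rw [map_mul]; exact (hf s).mul_left _
  exact PadicInt.prime_p.not_dvd_one (hyj ▸ hroot _ hval)
end
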